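/- arXiv:math/0502375 — 2 statements merged into one kernel-verified Lean document; each statement's English description precedes it below -/
import Mathlib

section
/- Let C(l) := sup_{k≥1} k^{2/l} e_k(N(0,I_l))² and Q(l) := lim_{k→∞} k^{2/l} e_k(N(0,I_l))² (this limit exists by the finite-dimensional high-resolution quantization theorem). Then lim_{l→∞} C(l)/l = lim_{l→∞} Q(l)/l = inf_{l≥1} C(l)/l = inf_{l≥1} Q(l)/l = 1. -/
open MeasureTheory ProbabilityTheory Filter Real
open scoped RealInnerProductSpace NNReal

/-- The standard Gaussian distribution `N(0, I_l)` on `ℝ^l`. -/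
noncomputable def stdGaussianPi (l : ℕ) : MeasureTheory.Measure (Fin l → ℝ) :=
  MeasureTheory.Measure.pi fun _ => ProbabilityTheory.gaussianReal 0 1

/-- The minimal `k`-th `L²`-quantization error of `N(0, I_l)` with respect to the
Euclidean norm on `ℝ^l`. -/
noncomputable def quantErrStdGaussian (l k : ℕ) : ℝ :=
  sInf { r : ℝ | ∃ α : Finset (Fin l → ℝ), α.Nonempty ∧ α.card ≤ k ∧
    r = (∫ x, sInf ((fun a => ∑ i, (x i - a i) ^ 2) '' (α : Set (Fin l → ℝ)))
          ∂stdGaussianPi l) ^ (1/2 : ℝ) }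


namespace GaussianQuantization

open scoped ENNReal

/-- The squared Euclidean distance on `ℝ^l`. -/
noncomputable def sqDist {l : ℕ} (x a : Fin l → ℝ) : ℝ := ∑ i, (x i - a i) ^ 2

lemma sqDist_nonneg {l : ℕ} (x a : Fin l → ℝ) : 0 ≤ sqDist x a :=
  Finset.sum_nonneg fun _ _ => sq_nonneg _

lemma measurable_sqDist {l : ℕ} :
    Measurable fun p : (Fin l → ℝ) × (Fin l → ℝ) => sqDist p.1 p.2 := by
  unfold sqDist; fun_prop

@[fun_prop]
lemma measurable_sqDist_comp {l : ℕ} {Ω : Type*} [MeasurableSpace Ω] {f g : Ω → Fin l → ℝ}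
    (hf : Measurable f) (hg : Measurable g) : Measurable fun ω => sqDist (f ω) (g ω) :=
  measurable_sqDist.comp (hf.prodMk hg)

instance isProbabilityMeasure_stdGaussianPi (l : ℕ) : IsProbabilityMeasure (stdGaussianPi l) := by
  unfold stdGaussianPi; infer_instance

/-- The squared quantization error of the codebook `α`. -/
noncomputable def distortion {l : ℕ} (α : Finset (Fin l → ℝ)) : ℝ :=
  ∫ x, sInf ((fun a => sqDist x a) '' (α : Set (Fin l → ℝ))) ∂stdGaussianPi l

lemma sInf_sqDist_eq_inf' {l : ℕ} {α : Finset (Fin l → ℝ)} (hα : α.Nonempty) (x : Fin l → ℝ) :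
    sInf ((fun a => sqDist x a) '' (α : Set (Fin l → ℝ))) = α.inf' hα (sqDist x) :=
  (Finset.inf'_eq_csInf_image α hα _).symm

lemma measurable_sInf_sqDist {l : ℕ} (α : Finset (Fin l → ℝ)) (hα : α.Nonempty) :
    Measurable fun x => sInf ((fun a => sqDist x a) '' (α : Set (Fin l → ℝ))) := by
  simp_rw [sInf_sqDist_eq_inf' hα]
  refine (Continuous.finset_inf'_apply hα fun a _ => ?_).measurable
  unfold sqDist; fun_prop

lemma sInf_sqDist_nonneg {l : ℕ} (α : Finset (Fin l → ℝ)) (x : Fin l → ℝ) :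
    0 ≤ sInf ((fun a => sqDist x a) '' (α : Set (Fin l → ℝ))) :=
  Real.sInf_nonneg (by rintro _ ⟨a, -, rfl⟩; exact sqDist_nonneg x a)

lemma sInf_sqDist_le {l : ℕ} {α : Finset (Fin l → ℝ)} {a : Fin l → ℝ} (ha : a ∈ α)
    (x : Fin l → ℝ) :
    sInf ((fun a => sqDist x a) '' (α : Set (Fin l → ℝ))) ≤ sqDist x a :=
  csInf_le ⟨0, by rintro _ ⟨a, -, rfl⟩; exact sqDist_nonneg x a⟩ ⟨a, ha, rfl⟩

lemma exists_sInf_sqDist_eq {l : ℕ} {α : Finset (Fin l → ℝ)} (hα : α.Nonempty)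
    (x : Fin l → ℝ) :
    ∃ a ∈ α, sInf ((fun a => sqDist x a) '' (α : Set (Fin l → ℝ))) = sqDist x a := by
  rw [sInf_sqDist_eq_inf' hα]
  exact Finset.exists_mem_eq_inf' hα _

lemma distortion_nonneg {l : ℕ} (α : Finset (Fin l → ℝ)) : 0 ≤ distortion α :=
  integral_nonneg fun x => sInf_sqDist_nonneg α x

lemma distortion_le_of_lintegral_le {l : ℕ} {α : Finset (Fin l → ℝ)} (hα : α.Nonempty) {b : ℝ}
    (hb : 0 ≤ b)
    (h : ∫⁻ x, ENNReal.ofReal (sInf ((fun a => sqDist x a) '' (α : Set (Fin l → ℝ))))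
      ∂stdGaussianPi l ≤ ENNReal.ofReal b) : distortion α ≤ b := by
  unfold distortion
  rw [integral_eq_lintegral_of_nonneg_ae (ae_of_all _ fun x => sInf_sqDist_nonneg α x)
    (measurable_sInf_sqDist α hα).aestronglyMeasurable]
  exact ENNReal.toReal_le_of_le_ofReal hb h

lemma quantErrStdGaussian_nonneg (l k : ℕ) : 0 ≤ quantErrStdGaussian l k := by
  refine Real.sInf_nonneg ?_
  rintro _ ⟨α, -, -, rfl⟩
  exact Real.rpow_nonneg (distortion_nonneg α) _

lemma quantErrStdGaussian_sq_le {l k : ℕ} {α : Finset (Fin l → ℝ)} (hα : α.Nonempty)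
    (hk : α.card ≤ k) : quantErrStdGaussian l k ^ 2 ≤ distortion α := by
  have h : quantErrStdGaussian l k ≤ √(distortion α) := by
    refine csInf_le ⟨0, ?_⟩ ⟨α, hα, hk, ?_⟩
    · rintro _ ⟨α, -, -, rfl⟩
      exact Real.rpow_nonneg (distortion_nonneg α) _
    · rw [Real.sqrt_eq_rpow]; rfl
  calc quantErrStdGaussian l k ^ 2 ≤ √(distortion α) ^ 2 :=
        pow_le_pow_left₀ (quantErrStdGaussian_nonneg l k) h 2
    _ = distortion α := Real.sq_sqrt (distortion_nonneg α)

lemma le_quantErrStdGaussian_sq {l k : ℕ} (hk : 1 ≤ k) {b : ℝ}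
    (h : ∀ α : Finset (Fin l → ℝ), α.Nonempty → α.card ≤ k → b ≤ distortion α) :
    b ≤ quantErrStdGaussian l k ^ 2 := by
  have h' : √b ≤ quantErrStdGaussian l k := by
    refine le_csInf ⟨_, {0}, by simp, by simpa using hk, rfl⟩ ?_
    rintro _ ⟨α, hα, hc, rfl⟩
    rw [← Real.sqrt_eq_rpow]
    exact Real.sqrt_le_sqrt (h α hα hc)
  exact (Real.sqrt_le_left (quantErrStdGaussian_nonneg l k)).1 h'

lemma lintegral_pi_prod {l : ℕ} (μ : Measure ℝ) [IsProbabilityMeasure μ] (f : Fin l → ℝ → ℝ≥0∞)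
    (hf : ∀ i, Measurable (f i)) :
    ∫⁻ x, ∏ i, f i (x i) ∂(Measure.pi fun _ : Fin l => μ) = ∏ i, ∫⁻ x, f i x ∂μ := by
  have h := lintegral_prod_eq_prod_lintegral_of_indepFun (μ := Measure.pi fun _ : Fin l => μ)
    Finset.univ (fun i (x : Fin l → ℝ) => f i (x i))
    (iIndepFun_pi fun i => (hf i).aemeasurable) (fun i => (hf i).comp (measurable_pi_apply i))
  rw [h]
  refine Finset.prod_congr rfl fun i _ => ?_
  exact (measurePreserving_eval (fun _ : Fin l => μ) i).lintegral_comp (hf i)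

lemma lintegral_gaussianReal_of_mul_pdf_eq {v w : ℝ≥0} (hv : v ≠ 0) (hw : w ≠ 0) {m κ : ℝ}
    (hκ : 0 ≤ κ) {g : ℝ → ℝ}
    (h : ∀ x, gaussianPDFReal 0 v x * g x = κ * gaussianPDFReal m w x) (hg : Measurable g) :
    ∫⁻ x, ENNReal.ofReal (g x) ∂gaussianReal 0 v = ENNReal.ofReal κ := by
  rw [gaussianReal_of_var_ne_zero _ hv,
    lintegral_withDensity_eq_lintegral_mul _ (measurable_gaussianPDF _ _) hg.ennreal_ofReal]
  have : ∀ x, (gaussianPDF 0 v * fun x => ENNReal.ofReal (g x)) x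
      = ENNReal.ofReal κ * gaussianPDF m w x := fun x => by
    simp only [Pi.mul_apply, gaussianPDF]
    rw [← ENNReal.ofReal_mul (gaussianPDFReal_nonneg _ _ _), h, ENNReal.ofReal_mul hκ]
  simp_rw [this]
  rw [lintegral_const_mul _ (measurable_gaussianPDF _ _), lintegral_gaussianPDF_eq_one _ hw,
    mul_one]

/-- Integral of an exponentially tilted Gaussian kernel against `N(0, 1)`. -/
lemma lintegral_exp_sub_sq {s : ℝ} (hs : 0 < s) (a : ℝ) :
    ∫⁻ x, ENNReal.ofReal (exp (x ^ 2 / 2 - s * (x - a) ^ 2)) ∂gaussianReal 0 1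
      = ENNReal.ofReal (√(2 * s))⁻¹ := by
  refine lintegral_gaussianReal_of_mul_pdf_eq (w := (2 * s)⁻¹.toNNReal) (m := a)
    one_ne_zero ?_ (by positivity) ?_ (by fun_prop)
  · simpa using hs
  · intro x
    rw [gaussianPDFReal, gaussianPDFReal, Real.coe_toNNReal _ (by positivity), NNReal.coe_one]
    rw [mul_assoc, ← Real.exp_add, ← mul_assoc, ← mul_inv, ← Real.sqrt_mul (by positivity)]
    congr 2
    · congr 1; field_simp
    · field_simp; ring

/-- The posterior of a Gaussian variable observed through a Gaussian channel has total mass `1`. -/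
lemma lintegral_exp_channel {D : ℝ} (hD : 0 < D) (hD1 : D < 1) (z : ℝ) :
    ∫⁻ y, ENNReal.ofReal ((√D)⁻¹ * exp (z ^ 2 / 2 - (z - y) ^ 2 / (2 * D)))
      ∂gaussianReal 0 (1 - D).toNNReal = 1 := by
  have h1 : 0 < 1 - D := by linarith
  rw [← ENNReal.ofReal_one]
  refine lintegral_gaussianReal_of_mul_pdf_eq (w := (D * (1 - D)).toNNReal)
    (m := (1 - D) * z) ?_ ?_ zero_le_one ?_ (by fun_prop)
  · simpa using hD1
  · simpa using mul_pos hD h1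
  · intro y
    rw [gaussianPDFReal, gaussianPDFReal, Real.coe_toNNReal _ h1.le,
      Real.coe_toNNReal _ (by positivity)]
    rw [mul_mul_mul_comm, ← Real.exp_add, ← mul_inv, ← Real.sqrt_mul (by positivity), one_mul]
    congr 2
    · congr 1; ring
    · field_simp; ring

lemma lintegral_stdGaussianPi_exp_sub {l : ℕ} {s : ℝ} (hs : 0 < s) (a : Fin l → ℝ) :
    ∫⁻ x, ENNReal.ofReal (exp (sqDist x 0 / 2 - s * sqDist x a)) ∂stdGaussianPi l
      = ENNReal.ofReal ((√(2 * s))⁻¹ ^ l) := by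
  have : ∀ x : Fin l → ℝ, ENNReal.ofReal (exp (sqDist x 0 / 2 - s * sqDist x a))
      = ∏ i, ENNReal.ofReal (exp (x i ^ 2 / 2 - s * (x i - a i) ^ 2)) := fun x => by
    rw [← ENNReal.ofReal_prod_of_nonneg fun _ _ => (exp_pos _).le, ← Real.exp_sum]
    simp [sqDist, Finset.sum_div, Finset.mul_sum]
  simp_rw [this, stdGaussianPi]
  rw [lintegral_pi_prod _ (fun i x => ENNReal.ofReal (exp (x ^ 2 / 2 - s * (x - a i) ^ 2)))
    fun i => by fun_prop]
  simp [lintegral_exp_sub_sq hs, ENNReal.ofReal_pow]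

/-- The Gaussian law on `ℝ^l` with independent centered coordinates of variance `v`. -/
noncomputable def codeLaw (l : ℕ) (v : ℝ) : Measure (Fin l → ℝ) :=
  Measure.pi fun _ => gaussianReal 0 v.toNNReal

instance isProbabilityMeasure_codeLaw (l : ℕ) (v : ℝ) : IsProbabilityMeasure (codeLaw l v) := by
  unfold codeLaw; infer_instance

/-- The density of the joint law of `(Z, Y)` with respect to the product of its marginals, where
`Y` has law `codeLaw l (1 - D)` and `Z - Y` is an independent centered Gaussian of variance `D`. -/
noncomputable def jointDensity {l : ℕ} (D : ℝ) (z y : Fin l → ℝ) : ℝ :=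
  (√D)⁻¹ ^ l * exp (sqDist z 0 / 2 - sqDist z y / (2 * D))

lemma jointDensity_nonneg {l : ℕ} (D : ℝ) (z y : Fin l → ℝ) : 0 ≤ jointDensity D z y := by
  unfold jointDensity; positivity

@[fun_prop]
lemma measurable_jointDensity {l : ℕ} {Ω : Type*} [MeasurableSpace Ω] {f g : Ω → Fin l → ℝ}
    (D : ℝ) (hf : Measurable f) (hg : Measurable g) :
    Measurable fun ω => jointDensity D (f ω) (g ω) := by
  unfold jointDensity; fun_prop

lemma lintegral_jointDensity {l : ℕ} {D : ℝ} (hD : 0 < D) (hD1 : D < 1) (z : Fin l → ℝ) :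
    ∫⁻ y, ENNReal.ofReal (jointDensity D z y) ∂codeLaw l (1 - D) = 1 := by
  have : ∀ y : Fin l → ℝ, ENNReal.ofReal (jointDensity D z y)
      = ∏ i, ENNReal.ofReal ((√D)⁻¹ * exp (z i ^ 2 / 2 - (z i - y i) ^ 2 / (2 * D))) := fun y => by
    rw [← ENNReal.ofReal_prod_of_nonneg fun _ _ => by positivity, Finset.prod_mul_distrib,
      ← Real.exp_sum]
    simp [jointDensity, sqDist, Finset.sum_div]
  simp_rw [this, codeLaw]
  rw [lintegral_pi_prod _
    (fun i y => ENNReal.ofReal ((√D)⁻¹ * exp (z i ^ 2 / 2 - (z i - y) ^ 2 / (2 * D))))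
    fun i => by fun_prop]
  simp only [lintegral_exp_channel hD hD1, Finset.prod_const_one]

lemma lintegral_jointDensity_mul_exp {l : ℕ} {D : ℝ} (hD : 0 < D) {s : ℝ} (hs : 2 * s < 1)
    (y : Fin l → ℝ) :
    ∫⁻ z, ENNReal.ofReal (jointDensity D z y * exp (s * (sqDist z y / D))) ∂stdGaussianPi l
      = ENNReal.ofReal ((√(1 - 2 * s))⁻¹ ^ l) := by
  have : ∀ z : Fin l → ℝ, ENNReal.ofReal (jointDensity D z y * exp (s * (sqDist z y / D)))
      = ENNReal.ofReal ((√D)⁻¹ ^ l)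
        * ENNReal.ofReal (exp (sqDist z 0 / 2 - (1 - 2 * s) / (2 * D) * sqDist z y)) := fun z => by
    rw [← ENNReal.ofReal_mul (by positivity), jointDensity, mul_assoc, ← Real.exp_add]
    congr 3
    field_simp; ring
  simp_rw [this]
  have h1 : 0 < 1 - 2 * s := by linarith
  rw [lintegral_const_mul _ (by fun_prop), lintegral_stdGaussianPi_exp_sub (by positivity),
    ← ENNReal.ofReal_mul (by positivity), ← mul_pow, ← mul_inv, ← Real.sqrt_mul hD.le]
  congr 4
  field_simp

lemma measurePreserving_eval_stdGaussianPi {l : ℕ} (i : Fin l) :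
    MeasurePreserving (Function.eval i) (stdGaussianPi l) (gaussianReal 0 1) :=
  measurePreserving_eval (fun _ : Fin l => gaussianReal 0 1) i

lemma integrable_sq_sub_gaussianReal (a : ℝ) :
    Integrable (fun x : ℝ => (x - a) ^ 2) (gaussianReal 0 1) :=
  (((memLp_id_gaussianReal' 2 (by simp)).sub (memLp_const a)).integrable_sq :)

lemma integrable_sqDist {l : ℕ} (a : Fin l → ℝ) :
    Integrable (fun x => sqDist x a) (stdGaussianPi l) :=
  integrable_finsetSum _ fun i _ =>
    (measurePreserving_eval_stdGaussianPi i).integrable_comp_of_integrable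
      (integrable_sq_sub_gaussianReal (a i))

lemma integral_sqDist_zero (l : ℕ) : ∫ x, sqDist x 0 ∂stdGaussianPi l = l := by
  have h1 : ∫ x : ℝ, (x - 0) ^ 2 ∂gaussianReal 0 1 = 1 := by
    have h := variance_fun_id_gaussianReal (μ := 0) (v := 1)
    rw [variance_eq_integral measurable_id'.aemeasurable] at h
    simpa using h
  have h2 : ∀ i : Fin l, ∫ x : Fin l → ℝ, (x i - 0) ^ 2 ∂stdGaussianPi l = 1 := fun i => by
    rw [← h1, ← (measurePreserving_eval_stdGaussianPi i).map_eq,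
      integral_map (measurable_pi_apply i).aemeasurable (by fun_prop)]
  unfold sqDist
  simp_rw [Pi.zero_apply]
  have hi : ∀ i ∈ Finset.univ, Integrable (fun x : Fin l → ℝ => (x i - 0) ^ 2) (stdGaussianPi l) :=
    fun i _ => (measurePreserving_eval_stdGaussianPi i).integrable_comp_of_integrable
      (integrable_sq_sub_gaussianReal 0)
  rw [integral_finsetSum _ hi, Finset.sum_congr rfl fun i _ => h2 i]
  simp

lemma integrable_sInf_sqDist {l : ℕ} {α : Finset (Fin l → ℝ)} (hα : α.Nonempty) :
    Integrable (fun x => sInf ((fun a => sqDist x a) '' (α : Set (Fin l → ℝ))))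
      (stdGaussianPi l) := by
  obtain ⟨a, ha⟩ := hα
  refine (integrable_sqDist a).mono' (measurable_sInf_sqDist α ⟨a, ha⟩).aestronglyMeasurable
    (ae_of_all _ fun x => ?_)
  rw [Real.norm_of_nonneg (sInf_sqDist_nonneg α x)]
  exact sInf_sqDist_le ha x

lemma sqrt_rpow_two_div_pow {l : ℕ} (hl : l ≠ 0) {x : ℝ} (hx : 0 ≤ x) :
    √(x ^ ((2 : ℝ) / l)) ^ l = x := by
  rw [Real.sqrt_eq_rpow, ← Real.rpow_mul hx, ← Real.rpow_natCast, ← Real.rpow_mul hx]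
  have : (2 : ℝ) / l * (1 / 2) * l = 1 := by field_simp
  rw [this, Real.rpow_one]

/-- The Shannon lower bound. -/
lemma le_rpow_mul_distortion {l k : ℕ} (hl : 1 ≤ l) {α : Finset (Fin l → ℝ)}
    (hα : α.Nonempty) (hk : α.card ≤ k) :
    (l : ℝ) ≤ (k : ℝ) ^ ((2 : ℝ) / l) * distortion α := by
  set c : ℝ := (k : ℝ) ^ ((2 : ℝ) / l) with hc
  have hk0 : 0 < k := hα.card_pos.trans_le hk
  have hc0 : 0 < c := by positivity
  set d : (Fin l → ℝ) → ℝ := fun x => sInf ((fun a => sqDist x a) '' (α : Set (Fin l → ℝ)))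
    with hd
  have hdm : Measurable d := measurable_sInf_sqDist α hα
  have hsc : (√(2 * (c / 2)))⁻¹ ^ l = (k : ℝ)⁻¹ := by
    rw [mul_div_cancel₀ _ two_ne_zero, inv_pow, hc, sqrt_rpow_two_div_pow (by omega) (by positivity)]
  have hexp : ∫⁻ x, ENNReal.ofReal (exp (sqDist x 0 / 2 - c / 2 * d x)) ∂stdGaussianPi l ≤ 1 := by
    calc ∫⁻ x, ENNReal.ofReal (exp (sqDist x 0 / 2 - c / 2 * d x)) ∂stdGaussianPi l
        ≤ ∫⁻ x, ∑ a ∈ α, ENNReal.ofReal (exp (sqDist x 0 / 2 - c / 2 * sqDist x a))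
            ∂stdGaussianPi l := by
          refine lintegral_mono fun x => ?_
          obtain ⟨a, ha, h⟩ := exists_sInf_sqDist_eq hα x
          simp only [hd, h]
          exact Finset.single_le_sum
            (f := fun a => ENNReal.ofReal (exp (sqDist x 0 / 2 - c / 2 * sqDist x a)))
            (fun _ _ => zero_le) ha
      _ = α.card * ENNReal.ofReal (k : ℝ)⁻¹ := by
          rw [lintegral_finsetSum _ fun a _ => by fun_prop]
          simp only [lintegral_stdGaussianPi_exp_sub (half_pos hc0), hsc, Finset.sum_const,
            nsmul_eq_mul]
      _ ≤ k * ENNReal.ofReal (k : ℝ)⁻¹ := by gcongr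
      _ = 1 := by
          rw [← ENNReal.ofReal_natCast k, ← ENNReal.ofReal_mul (by positivity),
            mul_inv_cancel₀ (by positivity), ENNReal.ofReal_one]
  have hint : Integrable (fun x => exp (sqDist x 0 / 2 - c / 2 * d x)) (stdGaussianPi l) := by
    refine ⟨(by fun_prop : Measurable _).aestronglyMeasurable, ?_⟩
    rw [hasFiniteIntegral_iff_ofReal (ae_of_all _ fun x => (exp_pos _).le)]
    exact hexp.trans_lt ENNReal.one_lt_top
  have hle : ∫ x, exp (sqDist x 0 / 2 - c / 2 * d x) ∂stdGaussianPi l ≤ 1 := by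
    rw [integral_eq_lintegral_of_nonneg_ae (ae_of_all _ fun x => (exp_pos _).le)
      hint.aestronglyMeasurable]
    exact ENNReal.toReal_le_of_le_ofReal zero_le_one (by simpa using hexp)
  have i1 : Integrable (fun x => sqDist x 0 / 2) (stdGaussianPi l) :=
    (integrable_sqDist 0).div_const 2
  have i2 : Integrable (fun x => c / 2 * d x) (stdGaussianPi l) :=
    (integrable_sInf_sqDist hα).const_mul _
  have i3 : Integrable (fun x => sqDist x 0 / 2 - c / 2 * d x) (stdGaussianPi l) := i1.sub i2
  have hlin : ∫ x, (sqDist x 0 / 2 - c / 2 * d x + 1) ∂stdGaussianPi l ≤ 1 :=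
    (integral_mono (i3.add (integrable_const 1)) hint
      fun x => Real.add_one_le_exp _).trans hle
  rw [integral_add i3 (integrable_const 1), integral_sub i1 i2, integral_div,
    integral_sqDist_zero, integral_const_mul] at hlin
  simp only [integral_const, probReal_univ, smul_eq_mul, mul_one] at hlin
  have : distortion α = ∫ x, d x ∂stdGaussianPi l := rfl
  rw [this]
  linarith

lemma le_rpow_mul_quantErr_sq {l k : ℕ} (hl : 1 ≤ l) (hk : 1 ≤ k) :
    (l : ℝ) ≤ (k : ℝ) ^ ((2 : ℝ) / l) * quantErrStdGaussian l k ^ 2 := by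
  have hc0 : 0 < (k : ℝ) ^ ((2 : ℝ) / l) := by positivity
  rw [← div_le_iff₀' hc0]
  refine le_quantErrStdGaussian_sq hk fun α hα hc => ?_
  rw [div_le_iff₀' hc0]
  exact le_rpow_mul_distortion hl hα hc

lemma quantErr_sq_le_dim {l k : ℕ} (hk : 1 ≤ k) : quantErrStdGaussian l k ^ 2 ≤ l := by
  have h := quantErrStdGaussian_sq_le (l := l) (k := k) (α := {0}) (by simp) (by simpa using hk)
  simpa [distortion, integral_sqDist_zero] using h

/-- Random coding: for a relation `S` between sources and codewords, some `n` codewords do at least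
as well as `n` independent codewords of law `P` do on average. -/
lemma exists_codebook_lintegral_le {Z Y : Type*} [MeasurableSpace Z] [MeasurableSpace Y]
    (μ : Measure Z) [SFinite μ] (P : Measure Y) [IsProbabilityMeasure P] {S : Set (Z × Y)}
    (hS : MeasurableSet S) (n : ℕ) :
    ∀ F : Z → ℝ≥0∞, Measurable F → ∃ T : Finset Y, T.card ≤ n ∧
      ∫⁻ z in {z | ∀ y ∈ T, (z, y) ∈ S}, F z ∂μ ≤ ∫⁻ z, F z * P (Prod.mk z ⁻¹' S) ^ n ∂μ := by
  classical
  induction n with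
  | zero => exact fun F _ => ⟨∅, by simp⟩
  | succ n ih =>
    intro F hF
    have hr : Measurable fun z => P (Prod.mk z ⁻¹' S) := measurable_measure_prodMk_left hS
    obtain ⟨T, hT, hle⟩ := ih (fun z => F z * P (Prod.mk z ⁻¹' S)) (hF.mul hr)
    have hTm : MeasurableSet {z | ∀ y ∈ T, (z, y) ∈ S} := by
      have : {z | ∀ y ∈ T, (z, y) ∈ S} = ⋂ y ∈ T, (fun z => (z, y)) ⁻¹' S := by
        ext; simp
      rw [this]
      exact Finset.measurableSet_biInter _ fun y _ => measurable_prodMk_right hS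
    set ν := μ.restrict {z | ∀ y ∈ T, (z, y) ∈ S} with hν
    have hmeas : Measurable fun p : Z × Y => F p.1 * S.indicator 1 p :=
      (hF.comp measurable_fst).mul (measurable_one.indicator hS)
    obtain ⟨y, hy⟩ := exists_le_lintegral (μ := P)
      (f := fun y => ∫⁻ z, F z * S.indicator 1 (z, y) ∂ν) hmeas.lintegral_prod_left'.aemeasurable
    refine ⟨insert y T, (Finset.card_insert_le _ _).trans (by omega), ?_⟩
    calc ∫⁻ z in {z | ∀ y' ∈ insert y T, (z, y') ∈ S}, F z ∂μ
        = ∫⁻ z, F z * S.indicator 1 (z, y) ∂ν := by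
          have hset : {z | ∀ y' ∈ insert y T, (z, y') ∈ S}
              = (fun z => (z, y)) ⁻¹' S ∩ {z | ∀ y ∈ T, (z, y) ∈ S} := by
            ext; simp
          rw [hset, ← Measure.restrict_restrict (measurable_prodMk_right hS),
            ← lintegral_indicator (measurable_prodMk_right hS)]
          refine lintegral_congr fun z => ?_
          by_cases h : (z, y) ∈ S <;> simp [h]
      _ ≤ ∫⁻ y, ∫⁻ z, F z * S.indicator 1 (z, y) ∂ν ∂P := hy
      _ = ∫⁻ z, ∫⁻ y, F z * S.indicator 1 (z, y) ∂P ∂ν :=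
          (lintegral_lintegral_swap (μ := ν) (ν := P)
            (f := fun z y => F z * S.indicator 1 (z, y)) hmeas.aemeasurable).symm
      _ = ∫⁻ z, F z * P (Prod.mk z ⁻¹' S) ∂ν := by
          refine lintegral_congr fun z => ?_
          have hz : MeasurableSet (Prod.mk z ⁻¹' S) := measurable_prodMk_left hS
          have : Measurable fun y => S.indicator (1 : Z × Y → ℝ≥0∞) (z, y) :=
            (measurable_one.indicator hS).comp measurable_prodMk_left
          rw [lintegral_const_mul _ this]
          congr 1
          exact lintegral_indicator_one hz
      _ ≤ ∫⁻ z, F z * P (Prod.mk z ⁻¹' S) * P (Prod.mk z ⁻¹' S) ^ n ∂μ := hle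
      _ = ∫⁻ z, F z * P (Prod.mk z ⁻¹' S) ^ (n + 1) ∂μ := by
          simp_rw [mul_assoc, ← pow_succ']

/-- An `m`-dependent grid on the line with `2 m - 1` points and local mesh `(1 + |z|)² / m`. -/
lemma exists_scalar_codebook {m : ℕ} (hm : 1 ≤ m) :
    ∃ β : Finset ℝ, β.card ≤ 2 * m - 1 ∧ ∀ z : ℝ, ∃ a ∈ β, (z - a) ^ 2 ≤ (1 + |z|) ^ 4 / m ^ 2 := by
  classical
  have hm0 : (0 : ℝ) < m := by exact_mod_cast hm
  have key : ∀ z : ℝ, 0 ≤ z → ∃ j : ℕ, j < m ∧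
      (z - j / (m - j)) ^ 2 ≤ (1 + |z|) ^ 4 / (m : ℝ) ^ 2 := by
    intro z hz
    have hz1 : 0 < 1 + z := by linarith
    have hu : 0 ≤ m * z / (1 + z) := by positivity
    have h1 := Nat.floor_le hu
    have h2 := Nat.lt_floor_add_one (m * z / (1 + z))
    set j := ⌊m * z / (1 + z)⌋₊
    rw [le_div_iff₀ hz1] at h1
    rw [div_lt_iff₀ hz1] at h2
    have hjm : (j : ℝ) < m := by nlinarith
    have hmj : 0 < (m : ℝ) - j := sub_pos.2 hjm
    refine ⟨j, by exact_mod_cast hjm, ?_⟩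
    have e : z - j / (m - j) = (z * m - j * (1 + z)) / (m - j) := by field_simp; ring
    have e1 : (0 : ℝ) ≤ z - j / (m - j) := by
      rw [e]; exact div_nonneg (by nlinarith) hmj.le
    have e2 : z - j / (m - j) ≤ (1 + z) ^ 2 / m := by
      rw [e, div_le_div_iff₀ hmj hm0]
      have h3 : m ≤ (m - j) * (1 + z) := by nlinarith
      have h4 : z * m - j * (1 + z) ≤ 1 + z := by nlinarith
      calc (z * m - j * (1 + z)) * m ≤ (1 + z) * ((m - j) * (1 + z)) := by gcongr
        _ = (1 + z) ^ 2 * (m - j) := by ring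
    calc (z - j / (m - j)) ^ 2 ≤ ((1 + z) ^ 2 / m) ^ 2 := pow_le_pow_left₀ e1 e2 2
      _ = (1 + |z|) ^ 4 / (m : ℝ) ^ 2 := by rw [abs_of_nonneg hz]; ring
  let p : ℕ → ℝ := fun j => j / (m - j)
  refine ⟨(Finset.range m).image p ∪ (Finset.Ico 1 m).image (fun j => - p j), ?_, fun z => ?_⟩
  · refine (Finset.card_union_le _ _).trans ((add_le_add Finset.card_image_le
      Finset.card_image_le).trans ?_)
    simp only [Finset.card_range, Nat.card_Ico]
    omega
  · rcases le_total 0 z with hz | hz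
    · obtain ⟨j, hj, h⟩ := key z hz
      exact ⟨p j, Finset.mem_union_left _ (Finset.mem_image_of_mem _ (Finset.mem_range.2 hj)), h⟩
    · obtain ⟨j, hj, h⟩ := key (-z) (by linarith)
      refine ⟨- p j, ?_, ?_⟩
      · rcases Nat.eq_zero_or_pos j with rfl | h0
        · refine Finset.mem_union_left _ (Finset.mem_image.2 ⟨0, Finset.mem_range.2 hj, ?_⟩)
          simp [p]
        · exact Finset.mem_union_right _ (Finset.mem_image_of_mem _ (Finset.mem_Ico.2 ⟨h0, hj⟩))
      · rw [abs_neg] at h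
        calc (z - - p j) ^ 2 = (-z - j / (m - j)) ^ 2 := by simp only [p]; ring
          _ ≤ _ := h

/-- The pointwise bound for the error of product codebooks, normalized by the dimension. -/
noncomputable def meanFourth {l : ℕ} (z : Fin l → ℝ) : ℝ := (∑ i, (1 + |z i|) ^ 4) / l

lemma meanFourth_nonneg {l : ℕ} (z : Fin l → ℝ) : 0 ≤ meanFourth z := by
  unfold meanFourth; positivity

@[fun_prop]
lemma measurable_meanFourth {l : ℕ} : Measurable (meanFourth (l := l)) := by
  unfold meanFourth; fun_prop

lemma exists_product_codebook {l n : ℕ} (hl : 1 ≤ l) (hn : 1 ≤ n) :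
    ∃ β : Finset (Fin l → ℝ), β.card ≤ n ∧
      ∀ z, ∃ a ∈ β, sqDist z a ≤ 16 * l * ((n : ℝ) ^ ((2 : ℝ) / l))⁻¹ * meanFourth z := by
  have hl0 : (0 : ℝ) < l := by exact_mod_cast hl
  have hn1 : (1 : ℝ) ≤ n := by exact_mod_cast hn
  set x : ℝ := (n : ℝ) ^ ((1 : ℝ) / l) with hx
  have hx1 : 1 ≤ x := Real.one_le_rpow hn1 (by positivity)
  have hxl : x ^ l = n := by
    rw [hx, ← Real.rpow_natCast, ← Real.rpow_mul (by positivity), one_div_mul_cancel hl0.ne',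
      Real.rpow_one]
  have hx2 : x ^ 2 = (n : ℝ) ^ ((2 : ℝ) / l) := by
    rw [hx, ← Real.rpow_natCast, ← Real.rpow_mul (by positivity)]
    congr 1; push_cast; ring
  set N := ⌊x⌋₊ with hN
  have hN1 : 1 ≤ N := Nat.le_floor (by exact_mod_cast hx1)
  have hNx : (N : ℝ) ≤ x := Nat.floor_le (by linarith)
  have hxN : x < N + 1 := Nat.lt_floor_add_one x
  set m := (N + 1) / 2 with hm
  have hm1 : 1 ≤ m := by omega
  have hm2 : 2 * m - 1 ≤ N := by omega
  have hm3 : N ≤ 2 * m := by omega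
  have hm0 : (0 : ℝ) < m := by exact_mod_cast hm1
  have hxm : x ≤ 4 * m := by
    have h1 : (N : ℝ) ≤ 2 * m := by exact_mod_cast hm3
    have h2 : (1 : ℝ) ≤ N := by exact_mod_cast hN1
    linarith
  obtain ⟨β, hβ, h⟩ := exists_scalar_codebook hm1
  choose a ha hle using h
  refine ⟨Fintype.piFinset fun _ => β, ?_, fun z => ⟨fun i => a (z i), ?_, ?_⟩⟩
  · rw [Fintype.card_piFinset_const]
    have h1 : β.card ^ l ≤ N ^ l := Nat.pow_le_pow_left (hβ.trans hm2) l
    have h2 : ((N ^ l : ℕ) : ℝ) ≤ n := by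
      rw [← hxl]; push_cast; gcongr
    exact h1.trans (by exact_mod_cast h2)
  · exact Fintype.mem_piFinset.2 fun i => ha _
  · rw [← hx2]
    calc sqDist z (fun i => a (z i)) ≤ ∑ i, (1 + |z i|) ^ 4 / (m : ℝ) ^ 2 :=
          Finset.sum_le_sum fun i _ => hle (z i)
      _ = ((m : ℝ) ^ 2)⁻¹ * (l * meanFourth z) := by
          rw [meanFourth, mul_div_cancel₀ _ hl0.ne', Finset.mul_sum]
          exact Finset.sum_congr rfl fun i _ => by ring
      _ ≤ (16 * (x ^ 2)⁻¹) * (l * meanFourth z) := by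
          have := meanFourth_nonneg z
          gcongr
          rw [← div_eq_mul_inv, inv_le_iff_one_le_mul₀ (by positivity), div_mul_eq_mul_div,
            one_le_div (by positivity)]
          nlinarith
      _ = _ := by ring

/-- The eighth moment bounding the second moment of `meanFourth`. -/
noncomputable def eighthMoment : ℝ := ∫ x : ℝ, (1 + |x|) ^ 8 ∂gaussianReal 0 1

lemma eighthMoment_nonneg : 0 ≤ eighthMoment := integral_nonneg fun x => by positivity

lemma lintegral_eighth :
    ∫⁻ x : ℝ, ENNReal.ofReal ((1 + |x|) ^ 8) ∂gaussianReal 0 1 = ENNReal.ofReal eighthMoment := by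
  refine (ofReal_integral_eq_lintegral_ofReal ?_ (ae_of_all _ fun x => by positivity)).symm
  have h : MemLp (fun x : ℝ => 1 + |x|) 8 (gaussianReal 0 1) :=
    (memLp_const (1 : ℝ)).add (f := fun _ : ℝ => (1 : ℝ)) (g := fun x : ℝ => |x|)
      (memLp_id_gaussianReal' (μ := 0) (v := 1) 8 (by simp)).abs
  have := h.integrable_norm_pow (p := 8) (by norm_num)
  refine this.congr (ae_of_all _ fun x => ?_)
  simp only [Real.norm_eq_abs]
  rw [abs_of_nonneg (by positivity)]

lemma lintegral_meanFourth_sq_le {l : ℕ} (hl : 1 ≤ l) :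
    ∫⁻ z, ENNReal.ofReal (meanFourth z ^ 2) ∂stdGaussianPi l ≤ ENNReal.ofReal eighthMoment := by
  have hl0 : (0 : ℝ) < l := by exact_mod_cast hl
  calc ∫⁻ z, ENNReal.ofReal (meanFourth z ^ 2) ∂stdGaussianPi l
      ≤ ∫⁻ z : Fin l → ℝ, ENNReal.ofReal (l : ℝ)⁻¹ * ∑ i, ENNReal.ofReal ((1 + |z i|) ^ 8)
          ∂stdGaussianPi l := by
        refine lintegral_mono fun z => ?_
        rw [← ENNReal.ofReal_sum_of_nonneg fun _ _ => by positivity,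
          ← ENNReal.ofReal_mul (by positivity)]
        refine ENNReal.ofReal_le_ofReal ?_
        have h := sq_sum_le_card_mul_sum_sq (s := Finset.univ) (f := fun i => (1 + |z i|) ^ 4)
        simp only [Finset.card_univ, Fintype.card_fin, ← pow_mul] at h
        rw [meanFourth, div_pow, div_le_iff₀ (by positivity)]
        refine h.trans (le_of_eq ?_)
        field_simp
    _ = ENNReal.ofReal (l : ℝ)⁻¹ * (l * ENNReal.ofReal eighthMoment) := by
        rw [lintegral_const_mul _ (by fun_prop), lintegral_finsetSum _ fun i _ => by fun_prop]
        congr 1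
        have : ∀ i : Fin l, ∫⁻ z : Fin l → ℝ, ENNReal.ofReal ((1 + |z i|) ^ 8) ∂stdGaussianPi l
            = ENNReal.ofReal eighthMoment := fun i => by
          rw [← lintegral_eighth]
          exact (measurePreserving_eval_stdGaussianPi i).lintegral_comp
            (f := fun x => ENNReal.ofReal ((1 + |x|) ^ 8)) (by fun_prop)
        simp [this]
    _ = ENNReal.ofReal eighthMoment := by
        rw [← mul_assoc, ← ENNReal.ofReal_natCast l, ← ENNReal.ofReal_mul (by positivity),
          inv_mul_cancel₀ hl0.ne', ENNReal.ofReal_one, one_mul]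

lemma lintegral_lintegral_jointDensity_mul_exp {l : ℕ} {D : ℝ} (hD : 0 < D) {s : ℝ}
    (hs : 2 * s < 1) (b : ℝ) :
    ∫⁻ z, ∫⁻ y, ENNReal.ofReal (jointDensity D z y * exp (s * (sqDist z y / D) + l * b))
      ∂codeLaw l (1 - D) ∂stdGaussianPi l = ENNReal.ofReal (((√(1 - 2 * s))⁻¹ * exp b) ^ l) := by
  rw [lintegral_lintegral_swap
    (f := fun z y => ENNReal.ofReal (jointDensity D z y * exp (s * (sqDist z y / D) + l * b)))
    (by unfold Function.uncurry; fun_prop)]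
  have : ∀ z y : Fin l → ℝ,
      ENNReal.ofReal (jointDensity D z y * exp (s * (sqDist z y / D) + l * b))
      = ENNReal.ofReal (jointDensity D z y * exp (s * (sqDist z y / D)))
        * ENNReal.ofReal (exp b ^ l) := fun z y => by
    rw [← ENNReal.ofReal_mul (mul_nonneg (jointDensity_nonneg _ _ _) (exp_pos _).le),
      Real.exp_add, Real.exp_nat_mul, mul_assoc]
  simp_rw [this]
  have h2 : ∀ y : Fin l → ℝ,
      ∫⁻ z, ENNReal.ofReal (jointDensity D z y * exp (s * (sqDist z y / D)))
        * ENNReal.ofReal (exp b ^ l) ∂stdGaussianPi l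
      = ENNReal.ofReal (((√(1 - 2 * s))⁻¹ * exp b) ^ l) := fun y => by
    rw [lintegral_mul_const _ (by fun_prop), lintegral_jointDensity_mul_exp hD hs,
      ← ENNReal.ofReal_mul (by positivity), mul_pow]
  simp [h2]

lemma lintegral_lintegral_jointDensity_mul_exp_source {l : ℕ} {D : ℝ} (hD : 0 < D) (hD1 : D < 1)
    {s : ℝ} (hs : 2 * s < 1) (b : ℝ) :
    ∫⁻ z, ∫⁻ y, ENNReal.ofReal (jointDensity D z y * exp (s * sqDist z 0 + l * b))
      ∂codeLaw l (1 - D) ∂stdGaussianPi l = ENNReal.ofReal (((√(1 - 2 * s))⁻¹ * exp b) ^ l) := by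
  have : ∀ z : Fin l → ℝ,
      ∫⁻ y, ENNReal.ofReal (jointDensity D z y * exp (s * sqDist z 0 + l * b)) ∂codeLaw l (1 - D)
      = ENNReal.ofReal (exp (sqDist z 0 / 2 - (1 - 2 * s) / 2 * sqDist z 0))
        * ENNReal.ofReal (exp b ^ l) := fun z => by
    simp_rw [ENNReal.ofReal_mul (jointDensity_nonneg _ _ _)]
    rw [lintegral_mul_const _ (by fun_prop), lintegral_jointDensity hD hD1, one_mul,
      ← ENNReal.ofReal_mul (exp_pos _).le, ← Real.exp_nat_mul, ← Real.exp_add]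
    congr 2; ring
  simp_rw [this]
  rw [lintegral_mul_const _ (by fun_prop),
    lintegral_stdGaussianPi_exp_sub (half_pos (by linarith : 0 < 1 - 2 * s)),
    ← ENNReal.ofReal_mul (by positivity), mul_div_cancel₀ _ two_ne_zero, mul_pow]

/-- Pairs of a source and a codeword for which both the distortion and the source energy are
within a factor `1 ± δ` of their means under the joint law. -/
def typicalSet (l : ℕ) (D δ : ℝ) : Set ((Fin l → ℝ) × (Fin l → ℝ)) :=
  {p | sqDist p.1 p.2 / D ≤ l * (1 + δ) ∧ l * (1 - δ) ≤ sqDist p.1 p.2 / D ∧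
    sqDist p.1 0 ≤ l * (1 + δ)}

lemma measurableSet_typicalSet (l : ℕ) (D δ : ℝ) : MeasurableSet (typicalSet l D δ) := by
  have h1 : MeasurableSet {p : (Fin l → ℝ) × (Fin l → ℝ) | sqDist p.1 p.2 / D ≤ l * (1 + δ)} :=
    measurableSet_le (by fun_prop) (by fun_prop)
  have h2 : MeasurableSet {p : (Fin l → ℝ) × (Fin l → ℝ) | l * (1 - δ) ≤ sqDist p.1 p.2 / D} :=
    measurableSet_le (by fun_prop) (by fun_prop)
  have h3 : MeasurableSet {p : (Fin l → ℝ) × (Fin l → ℝ) | sqDist p.1 0 ≤ l * (1 + δ)} :=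
    measurableSet_le (by fun_prop) (by fun_prop)
  exact h1.inter (h2.inter h3)

/-- Chernoff bound for the probability of atypical pairs, with parameter `s`. -/
noncomputable def atypicalBound (s δ : ℝ) (l : ℕ) : ℝ :=
  ((√(1 - 2 * s))⁻¹ * exp (-(s * (1 + δ)))) ^ l + ((√(1 - 2 * -s))⁻¹ * exp (s * (1 - δ))) ^ l
    + ((√(1 - 2 * s))⁻¹ * exp (-(s * (1 + δ)))) ^ l

lemma atypicalBound_nonneg (s δ : ℝ) (l : ℕ) : 0 ≤ atypicalBound s δ l := by
  unfold atypicalBound; positivity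

lemma lintegral_atypical_le {l : ℕ} {D δ s : ℝ} (hD : 0 < D) (hD1 : D < 1) (hs0 : 0 < s)
    (hs : 2 * s < 1) :
    ∫⁻ z, ∫⁻ y in (Prod.mk z ⁻¹' typicalSet l D δ)ᶜ, ENNReal.ofReal (jointDensity D z y)
      ∂codeLaw l (1 - D) ∂stdGaussianPi l ≤ ENNReal.ofReal (atypicalBound s δ l) := by
  have hpt : ∀ z y : Fin l → ℝ,
      ((Prod.mk z ⁻¹' typicalSet l D δ)ᶜ).indicator
        (fun y => ENNReal.ofReal (jointDensity D z y)) y ≤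
      ENNReal.ofReal (jointDensity D z y
          * exp (s * (sqDist z y / D) + l * -(s * (1 + δ))))
        + ENNReal.ofReal (jointDensity D z y
          * exp (-s * (sqDist z y / D) + l * (s * (1 - δ))))
        + ENNReal.ofReal (jointDensity D z y
          * exp (s * sqDist z 0 + l * -(s * (1 + δ)))) := by
    intro z y
    refine Set.indicator_apply_le' (fun hy => ?_) fun _ => zero_le
    have key : ∀ e : ℝ, 0 ≤ e →
        ENNReal.ofReal (jointDensity D z y) ≤ ENNReal.ofReal (jointDensity D z y * exp e) :=
      fun e he => ENNReal.ofReal_le_ofReal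
        (le_mul_of_one_le_right (jointDensity_nonneg _ _ _) (Real.one_le_exp he))
    simp only [typicalSet, Set.mem_compl_iff, Set.mem_preimage, Set.mem_ofPred_eq, not_and_or,
      not_le] at hy
    rcases hy with h | h | h
    · exact (key _ (by nlinarith)).trans (le_self_add.trans le_self_add)
    · exact (key _ (by nlinarith)).trans (le_add_self.trans le_self_add)
    · exact (key _ (by nlinarith)).trans le_add_self
  calc ∫⁻ z, ∫⁻ y in (Prod.mk z ⁻¹' typicalSet l D δ)ᶜ, ENNReal.ofReal (jointDensity D z y)
        ∂codeLaw l (1 - D) ∂stdGaussianPi l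
      ≤ ∫⁻ z, ∫⁻ y, (ENNReal.ofReal (jointDensity D z y
          * exp (s * (sqDist z y / D) + l * -(s * (1 + δ))))
        + ENNReal.ofReal (jointDensity D z y
          * exp (-s * (sqDist z y / D) + l * (s * (1 - δ))))
        + ENNReal.ofReal (jointDensity D z y
          * exp (s * sqDist z 0 + l * -(s * (1 + δ))))) ∂codeLaw l (1 - D) ∂stdGaussianPi l := by
        refine lintegral_mono fun z => ?_
        rw [← lintegral_indicator (measurable_prodMk_left (measurableSet_typicalSet l D δ)).compl]
        exact lintegral_mono (hpt z)
    _ = ENNReal.ofReal (atypicalBound s δ l) := by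
        have hm : ∀ f : (Fin l → ℝ) × (Fin l → ℝ) → ℝ, Measurable f →
            Measurable fun z => ∫⁻ y, ENNReal.ofReal (jointDensity D z y * exp (f (z, y)))
              ∂codeLaw l (1 - D) := fun f hf =>
          Measurable.lintegral_prod_right'
            (f := fun p => ENNReal.ofReal (jointDensity D p.1 p.2 * exp (f p))) (by fun_prop)
        have h1 := hm (fun p => s * (sqDist p.1 p.2 / D) + l * -(s * (1 + δ))) (by fun_prop)
        have h2 := hm (fun p => -s * (sqDist p.1 p.2 / D) + l * (s * (1 - δ))) (by fun_prop)
        rw [lintegral_congr fun z => by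
          rw [lintegral_add_left (by fun_prop), lintegral_add_left (by fun_prop)]]
        rw [lintegral_add_left (by exact h1.add h2), lintegral_add_left h1,
          lintegral_lintegral_jointDensity_mul_exp hD hs,
          lintegral_lintegral_jointDensity_mul_exp hD (by linarith),
          lintegral_lintegral_jointDensity_mul_exp_source hD hD1 hs,
          ← ENNReal.ofReal_add (by positivity) (by positivity),
          ← ENNReal.ofReal_add (by positivity) (by positivity)]
        rfl

/-- The covering estimate at the heart of random coding: if `j` is a probability density for `P`
that is bounded by `M` on `A`, then `n` independent samples of `P` all miss `A` with probability at
most the `j`-mass of the complement of `A` plus `exp (-n / M)`. -/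
lemma measure_compl_pow_le {Y : Type*} [MeasurableSpace Y] (P : Measure Y) [IsProbabilityMeasure P]
    {j : Y → ℝ≥0∞} (hj1 : ∫⁻ y, j y ∂P = 1) {A : Set Y}
    (hA : MeasurableSet A) {M : ℝ} (hM : 0 < M) (hjM : ∀ y ∈ A, j y ≤ ENNReal.ofReal M) (n : ℕ) :
    P Aᶜ ^ n ≤ ∫⁻ y in Aᶜ, j y ∂P + ENNReal.ofReal (exp (-(n / M))) := by
  have hsum := lintegral_add_compl j hA (μ := P)
  rw [hj1] at hsum
  have hq : ∫⁻ y in A, j y ∂P ≤ ENNReal.ofReal M * P A := by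
    rw [← setLIntegral_const]
    exact setLIntegral_mono' hA hjM
  set q := ∫⁻ y in A, j y ∂P with hqdef
  set b := ∫⁻ y in Aᶜ, j y ∂P with hbdef
  have hqt : q ≠ ∞ := fun h => by simp [h] at hsum
  have hbt : b ≠ ∞ := fun h => by simp [h] at hsum
  have hsum' : q.toReal + b.toReal = 1 := by
    rw [← ENNReal.toReal_add hqt hbt, hsum, ENNReal.toReal_one]
  have hq' : q.toReal ≤ M * P.real A := by
    have := ENNReal.toReal_mono (by finiteness) hq
    rwa [ENNReal.toReal_mul, ENNReal.toReal_ofReal hM.le] at this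
  have hq0 : 0 ≤ q.toReal := ENNReal.toReal_nonneg
  have hb0 : 0 ≤ b.toReal := ENNReal.toReal_nonneg
  have hPc : P.real Aᶜ ≤ exp (-(q.toReal / M)) := by
    rw [probReal_compl_eq_one_sub hA]
    have h1 : q.toReal / M ≤ P.real A := by rwa [div_le_iff₀' hM]
    have h2 := Real.add_one_le_exp (-(q.toReal / M))
    linarith
  have hreal : P.real Aᶜ ^ n ≤ b.toReal + exp (-(n / M)) := by
    calc P.real Aᶜ ^ n ≤ exp (-(q.toReal / M)) ^ n :=
          pow_le_pow_left₀ measureReal_nonneg hPc n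
      _ = exp (b.toReal * 0 + q.toReal * (-(n / M))) := by
          rw [← Real.exp_nat_mul]; congr 1; ring
      _ ≤ b.toReal * exp 0 + q.toReal * exp (-(n / M)) :=
          convexOn_exp.2 (Set.mem_univ _) (Set.mem_univ _) hb0 hq0 (by linarith)
      _ ≤ b.toReal + exp (-(n / M)) := by
          have : q.toReal * exp (-(n / M)) ≤ 1 * exp (-(n / M)) := by
            gcongr; linarith
          simpa using this
  calc P Aᶜ ^ n = ENNReal.ofReal (P.real Aᶜ ^ n) := by
        rw [ENNReal.ofReal_pow measureReal_nonneg, ofReal_measureReal]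
    _ ≤ ENNReal.ofReal (b.toReal + exp (-(n / M))) := ENNReal.ofReal_le_ofReal hreal
    _ = b + ENNReal.ofReal (exp (-(n / M))) := by
        rw [ENNReal.ofReal_add hb0 (exp_pos _).le, ENNReal.ofReal_toReal hbt]

lemma lintegral_miss_pow_le {l : ℕ} {D δ s : ℝ} (hD : 0 < D) (hD1 : D < 1) (hs0 : 0 < s)
    (hs : 2 * s < 1) (n : ℕ) :
    ∫⁻ z, codeLaw l (1 - D) {y | D * (l * (1 + δ)) < sqDist z y} ^ n ∂stdGaussianPi l
      ≤ ENNReal.ofReal (atypicalBound s δ l + exp (-(n * (√D ^ l * exp (-(l * δ)))))) := by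
  have hM : 0 < (√D)⁻¹ ^ l * exp (l * δ) := by positivity
  have hrw : (n : ℝ) * (√D ^ l * exp (-(l * δ))) = n / ((√D)⁻¹ ^ l * exp (l * δ)) := by
    rw [Real.exp_neg, div_eq_mul_inv, mul_inv, inv_pow, inv_inv]
  have hpt : ∀ z : Fin l → ℝ, codeLaw l (1 - D) {y | D * (l * (1 + δ)) < sqDist z y} ^ n ≤
      ∫⁻ y in (Prod.mk z ⁻¹' typicalSet l D δ)ᶜ, ENNReal.ofReal (jointDensity D z y)
        ∂codeLaw l (1 - D) + ENNReal.ofReal (exp (-(n * (√D ^ l * exp (-(l * δ)))))) := by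
    intro z
    rw [hrw]
    refine le_trans ?_ (measure_compl_pow_le (codeLaw l (1 - D)) (lintegral_jointDensity hD hD1 z)
      (measurable_prodMk_left (measurableSet_typicalSet l D δ)) hM ?_ n)
    · gcongr
      rintro y hy ⟨h1, -, -⟩
      rw [div_le_iff₀' hD] at h1
      exact absurd h1 (not_le.2 hy)
    · rintro y ⟨-, h2, h3⟩
      refine ENNReal.ofReal_le_ofReal ?_
      unfold jointDensity
      gcongr
      have : sqDist z y / (2 * D) = sqDist z y / D / 2 := by field_simp
      simp only at h2 h3
      rw [this]
      linarith
  calc _ ≤ _ := lintegral_mono hpt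
    _ ≤ _ := by
        rw [lintegral_add_right _ measurable_const, ENNReal.ofReal_add (atypicalBound_nonneg _ _ _)
          (exp_pos _).le]
        gcongr
        · exact lintegral_atypical_le hD hD1 hs0 hs
        · simp

lemma mul_le_sq_add_div {θ : ℝ} (hθ : 0 < θ) {g : ℝ} (hg : 0 ≤ g) {h : ℝ≥0∞} (hh : h ≤ 1) :
    ENNReal.ofReal g * h ≤ ENNReal.ofReal (θ * g ^ 2) + ENNReal.ofReal θ⁻¹ * h := by
  rcases le_total g θ⁻¹ with hgt | hgt
  · exact le_add_of_nonneg_of_le zero_le (by gcongr)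
  · refine le_add_of_le_of_nonneg ?_ zero_le
    calc ENNReal.ofReal g * h ≤ ENNReal.ofReal g * 1 := by gcongr
      _ ≤ ENNReal.ofReal (θ * g ^ 2) := by
          rw [mul_one]
          refine ENNReal.ofReal_le_ofReal ?_
          have h1 : 1 ≤ θ * g := by
            rwa [inv_le_iff_one_le_mul₀' hθ] at hgt
          nlinarith

/-- Random coding bound combined with a product codebook for the uncovered sources. -/
lemma quantErr_sq_le_random_coding {l n k : ℕ} (hl : 1 ≤ l) (hn : 1 ≤ n) (hk : 2 * n ≤ k)
    {D δ s θ : ℝ} (hD : 0 < D) (hD1 : D < 1) (hδ : 0 < δ) (hs0 : 0 < s) (hs : 2 * s < 1)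
    (hθ : 0 < θ) :
    quantErrStdGaussian l k ^ 2 ≤ D * (l * (1 + δ))
      + 16 * l * ((n : ℝ) ^ ((2 : ℝ) / l))⁻¹ * (θ * eighthMoment
        + θ⁻¹ * (atypicalBound s δ l + exp (-(n * (√D ^ l * exp (-(l * δ))))))) := by
  classical
  set t := D * (l * (1 + δ)) with ht
  set c := 16 * l * ((n : ℝ) ^ ((2 : ℝ) / l))⁻¹ with hc
  set η := atypicalBound s δ l + exp (-(n * (√D ^ l * exp (-(l * δ))))) with hη
  have ht0 : 0 ≤ t := by positivity
  have hc0 : 0 ≤ c := by positivity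
  have hη0 : 0 ≤ η := add_nonneg (atypicalBound_nonneg _ _ _) (exp_pos _).le
  have he0 := eighthMoment_nonneg
  obtain ⟨β, hβ, hβle⟩ := exists_product_codebook hl hn
  have hβne : β.Nonempty := let ⟨a, ha, _⟩ := hβle 0; ⟨a, ha⟩
  have hS : MeasurableSet {p : (Fin l → ℝ) × (Fin l → ℝ) | t < sqDist p.1 p.2} :=
    measurableSet_lt (by fun_prop) (by fun_prop)
  obtain ⟨T, hT, hTle⟩ := exists_codebook_lintegral_le (stdGaussianPi l) (codeLaw l (1 - D)) hS n
    (fun z => ENNReal.ofReal c * ENNReal.ofReal (meanFourth z)) (by fun_prop)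
  have hα : (T ∪ β).Nonempty := hβne.mono Finset.subset_union_right
  have hcard : (T ∪ β).card ≤ k := (Finset.card_union_le _ _).trans (by omega)
  refine (quantErrStdGaussian_sq_le hα hcard).trans
    (distortion_le_of_lintegral_le hα (by positivity) ?_)
  have hbad : MeasurableSet {z : Fin l → ℝ | ∀ y ∈ T, t < sqDist z y} := by
    have : {z : Fin l → ℝ | ∀ y ∈ T, t < sqDist z y} = ⋂ y ∈ T, {z | t < sqDist z y} := by
      ext; simp
    rw [this]
    exact Finset.measurableSet_biInter _ fun y _ => measurableSet_lt (by fun_prop) (by fun_prop)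
  calc ∫⁻ x, ENNReal.ofReal (sInf ((fun a => sqDist x a) '' ((T ∪ β : Finset _) :
          Set (Fin l → ℝ)))) ∂stdGaussianPi l
      ≤ ∫⁻ x, (ENNReal.ofReal t + {z : Fin l → ℝ | ∀ y ∈ T, t < sqDist z y}.indicator
          (fun z => ENNReal.ofReal c * ENNReal.ofReal (meanFourth z)) x) ∂stdGaussianPi l := by
        refine lintegral_mono fun x => ?_
        by_cases hx : ∀ y ∈ T, t < sqDist x y
        · rw [Set.indicator_of_mem (s := {z : Fin l → ℝ | ∀ y ∈ T, t < sqDist z y}) hx,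
            ← ENNReal.ofReal_mul hc0]
          obtain ⟨a, ha, hle⟩ := hβle x
          exact le_add_of_nonneg_of_le zero_le (ENNReal.ofReal_le_ofReal
            ((sInf_sqDist_le (Finset.mem_union_right _ ha) x).trans hle))
        · push Not at hx
          obtain ⟨y, hy, hle⟩ := hx
          exact le_add_of_le_of_nonneg (ENNReal.ofReal_le_ofReal
            ((sInf_sqDist_le (Finset.mem_union_left _ hy) x).trans hle)) zero_le
    _ = ENNReal.ofReal t + ∫⁻ z in {z : Fin l → ℝ | ∀ y ∈ T, t < sqDist z y},
          ENNReal.ofReal c * ENNReal.ofReal (meanFourth z) ∂stdGaussianPi l := by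
        rw [lintegral_add_left measurable_const, lintegral_indicator hbad]
        simp
    _ ≤ ENNReal.ofReal t + ∫⁻ z, ENNReal.ofReal c * ENNReal.ofReal (meanFourth z)
          * codeLaw l (1 - D) {y | t < sqDist z y} ^ n ∂stdGaussianPi l := by
        exact add_le_add_right hTle _
    _ ≤ ENNReal.ofReal t + ∫⁻ z, ENNReal.ofReal c * (ENNReal.ofReal θ
          * ENNReal.ofReal (meanFourth z ^ 2)
          + ENNReal.ofReal θ⁻¹ * codeLaw l (1 - D) {y | t < sqDist z y} ^ n) ∂stdGaussianPi l := by
        refine add_le_add_right (lintegral_mono fun z => ?_) _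
        rw [mul_assoc, ← ENNReal.ofReal_mul hθ.le]
        gcongr
        exact mul_le_sq_add_div hθ (meanFourth_nonneg z) (pow_le_one₀ zero_le prob_le_one)
    _ ≤ ENNReal.ofReal t + ENNReal.ofReal c * (ENNReal.ofReal θ * ENNReal.ofReal eighthMoment
          + ENNReal.ofReal θ⁻¹ * ENNReal.ofReal η) := by
        have hr : Measurable fun z => codeLaw l (1 - D) {y | t < sqDist z y} :=
          measurable_measure_prodMk_left hS
        rw [lintegral_const_mul _ (by fun_prop), lintegral_add_left (by fun_prop),
          lintegral_const_mul _ (by fun_prop), lintegral_const_mul _ (by fun_prop)]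
        gcongr
        · exact lintegral_meanFourth_sq_le hl
        · exact lintegral_miss_pow_le hD hD1 hs0 hs n
    _ = ENNReal.ofReal (t + c * (θ * eighthMoment + θ⁻¹ * η)) := by
        rw [ENNReal.ofReal_add ht0 (by positivity), ENNReal.ofReal_mul hc0,
          ENNReal.ofReal_add (p := θ * eighthMoment) (by positivity) (by positivity),
          ENNReal.ofReal_mul hθ.le, ENNReal.ofReal_mul (p := θ⁻¹) (by positivity)]

lemma tendsto_atypicalBound {δ : ℝ} (hδ : 0 < δ) (hδ1 : δ < 1) :
    Tendsto (atypicalBound (δ / 4) δ) atTop (nhds 0) := by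
  have base : ∀ a b : ℝ, 0 < a → exp (2 * b) < a → (√a)⁻¹ * exp b < 1 := fun a b ha h => by
    rw [inv_mul_lt_iff₀ (Real.sqrt_pos.2 ha), mul_one]
    refine Real.lt_sqrt_of_sq_lt ?_
    rwa [← Real.exp_nat_mul]
  have hup : (√(1 - 2 * (δ / 4)))⁻¹ * exp (-(δ / 4 * (1 + δ))) < 1 := by
    have h1 : 0 < 1 - 2 * (δ / 4) := by linarith
    refine base _ _ h1 ?_
    rw [← inv_lt_inv₀ h1 (exp_pos _), ← Real.exp_neg]
    calc (1 - 2 * (δ / 4))⁻¹ = δ / 2 / (1 - 2 * (δ / 4)) + 1 := by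
          rw [inv_eq_one_div, div_add_one h1.ne']; congr 1; ring
      _ ≤ exp (δ / 2 / (1 - 2 * (δ / 4))) := Real.add_one_le_exp _
      _ < exp (-(2 * -(δ / 4 * (1 + δ)))) := by
          rw [Real.exp_lt_exp, div_lt_iff₀ h1]
          nlinarith [mul_pos hδ hδ, mul_pos (mul_pos hδ hδ) (sub_pos.2 hδ1)]
  have hlow : (√(1 - 2 * -(δ / 4)))⁻¹ * exp (δ / 4 * (1 - δ)) < 1 := by
    have h1 : 0 < 1 - 2 * -(δ / 4) := by linarith
    refine base _ _ h1 ?_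
    rw [← inv_lt_inv₀ h1 (exp_pos _), ← Real.exp_neg]
    calc (1 - 2 * -(δ / 4))⁻¹ = -(δ / 2 / (1 - 2 * -(δ / 4))) + 1 := by
          rw [inv_eq_one_div, ← neg_div (1 - 2 * -(δ / 4)), div_add_one h1.ne']; congr 1; ring
      _ ≤ exp (-(δ / 2 / (1 - 2 * -(δ / 4)))) := Real.add_one_le_exp _
      _ < exp (-(2 * (δ / 4 * (1 - δ)))) := by
          rw [Real.exp_lt_exp, neg_lt_neg_iff, lt_div_iff₀ h1]
          nlinarith [mul_pos hδ hδ, mul_pos (mul_pos hδ hδ) hδ]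
  have t1 := tendsto_pow_atTop_nhds_zero_of_lt_one (by positivity) hup
  have t2 := tendsto_pow_atTop_nhds_zero_of_lt_one (by positivity) hlow
  have h := (t1.add t2).add t1
  simp only [add_zero] at h
  exact h

/-- A bound for `k^{2/l} e_k² / l` that is uniform in `k`. -/
noncomputable def scaledBound (δ θ : ℝ) (l : ℕ) : ℝ :=
  (3 : ℝ) ^ ((2 : ℝ) / l) * (exp (4 * δ) * (1 + δ)
    + 16 * (θ * eighthMoment + θ⁻¹ * (atypicalBound (δ / 4) δ l + exp (-exp (l * δ)))))

lemma tendsto_scaledBound {δ θ : ℝ} (hδ : 0 < δ) (hδ1 : δ < 1) :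
    Tendsto (scaledBound δ θ) atTop
      (nhds (exp (4 * δ) * (1 + δ) + 16 * (θ * eighthMoment))) := by
  have h3 : Tendsto (fun l : ℕ => (3 : ℝ) ^ ((2 : ℝ) / l)) atTop (nhds 1) := by
    have := ((Real.continuous_const_rpow (a := 3) (by norm_num)).tendsto 0).comp
      (tendsto_const_div_atTop_nhds_zero_nat (2 : ℝ))
    simpa [Function.comp_def] using this
  have hexp : Tendsto (fun l : ℕ => exp (-exp (l * δ))) atTop (nhds 0) :=
    Real.tendsto_exp_neg_atTop_nhds_zero.comp
      (Real.tendsto_exp_atTop.comp (tendsto_natCast_atTop_atTop.atTop_mul_const hδ))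
  have h := h3.mul (((((tendsto_atypicalBound hδ hδ1).add hexp).const_mul θ⁻¹).const_add
    (θ * eighthMoment)).const_mul 16 |>.const_add (exp (4 * δ) * (1 + δ)))
  simp only [mul_zero, add_zero, one_mul] at h
  exact h

lemma rpow_mul_quantErr_sq_le_scaledBound {l k : ℕ} (hl : 1 ≤ l) (hk : 1 ≤ k) {δ θ : ℝ}
    (hδ : 0 < δ) (hδ1 : δ < 1) (hθ : 0 < θ) :
    (k : ℝ) ^ ((2 : ℝ) / l) * quantErrStdGaussian l k ^ 2 ≤ l * scaledBound δ θ l := by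
  have hl0 : (0 : ℝ) < l := by exact_mod_cast hl
  have he0 := eighthMoment_nonneg
  have ha0 := atypicalBound_nonneg (δ / 4) δ l
  set R := 16 * (θ * eighthMoment + θ⁻¹ * (atypicalBound (δ / 4) δ l + exp (-exp (l * δ))))
    with hR
  have hR0 : 0 ≤ R := by positivity
  have h31 : 1 ≤ (3 : ℝ) ^ ((2 : ℝ) / l) := Real.one_le_rpow (by norm_num) (by positivity)
  have hexp1 : 1 ≤ exp (4 * δ) := Real.one_le_exp (by positivity)
  have hq := quantErr_sq_le_dim (l := l) hk
  have hSB : scaledBound δ θ l = (3 : ℝ) ^ ((2 : ℝ) / l) * (exp (4 * δ) * (1 + δ) + R) := rfl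
  have hinner : exp (4 * δ) ≤ exp (4 * δ) * (1 + δ) + R := by nlinarith
  rcases hk.eq_or_lt with rfl | hk2
  · have h1 : 1 ≤ scaledBound δ θ l := by
      rw [hSB]; exact one_le_mul_of_one_le_of_one_le h31 (hexp1.trans hinner)
    simp only [Nat.cast_one, Real.one_rpow, one_mul]
    nlinarith
  obtain ⟨n, hn, hnk, hkn⟩ : ∃ n : ℕ, 1 ≤ n ∧ 2 * n ≤ k ∧ k ≤ 3 * n :=
    ⟨k / 2, by omega, by omega, by omega⟩
  have hn0 : (0 : ℝ) < n := by exact_mod_cast hn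
  set x := (n : ℝ) ^ ((2 : ℝ) / l) with hx
  have hx0 : 0 < x := by positivity
  have hkx : (k : ℝ) ^ ((2 : ℝ) / l) ≤ (3 : ℝ) ^ ((2 : ℝ) / l) * x := by
    rw [hx, ← Real.mul_rpow (by norm_num) hn0.le]
    exact Real.rpow_le_rpow (by positivity) (by exact_mod_cast hkn) (by positivity)
  have hmain : x * quantErrStdGaussian l k ^ 2 ≤ l * (exp (4 * δ) * (1 + δ) + R) := by
    rcases le_or_gt x (exp (4 * δ)) with hsmall | hbig
    · calc x * quantErrStdGaussian l k ^ 2 ≤ exp (4 * δ) * l := by gcongr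
        _ = l * exp (4 * δ) := mul_comm _ _
        _ ≤ _ := by gcongr
    · have hD1 : exp (4 * δ) / x < 1 := (div_lt_one hx0).2 hbig
      have hDl : √(exp (4 * δ) / x) ^ l = exp (l * (2 * δ)) / n := by
        rw [Real.sqrt_div (exp_pos _).le, div_pow, hx, sqrt_rpow_two_div_pow (by omega) hn0.le,
          Real.exp_nat_mul]
        congr 2
        rw [Real.sqrt_eq_iff_mul_self_eq (exp_pos _).le (exp_pos _).le, ← Real.exp_add]
        congr 1; ring
      have hcov : n * (√(exp (4 * δ) / x) ^ l * exp (-(l * δ))) = exp (l * δ) := by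
        rw [hDl, div_mul_eq_mul_div, mul_div_cancel₀ _ hn0.ne', ← Real.exp_add]
        congr 1; ring
      have h := quantErr_sq_le_random_coding hl hn hnk (D := exp (4 * δ) / x) (δ := δ)
        (s := δ / 4) (by positivity) hD1 hδ (by positivity) (by linarith) hθ
      rw [hcov, ← hx] at h
      refine (mul_le_mul_of_nonneg_left h hx0.le).trans (le_of_eq ?_)
      rw [hR]
      field_simp
  calc (k : ℝ) ^ ((2 : ℝ) / l) * quantErrStdGaussian l k ^ 2
      ≤ (3 : ℝ) ^ ((2 : ℝ) / l) * x * quantErrStdGaussian l k ^ 2 := by gcongr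
    _ = (3 : ℝ) ^ ((2 : ℝ) / l) * (x * quantErrStdGaussian l k ^ 2) := mul_assoc _ _ _
    _ ≤ (3 : ℝ) ^ ((2 : ℝ) / l) * (l * (exp (4 * δ) * (1 + δ) + R)) := by gcongr
    _ = l * scaledBound δ θ l := by rw [hSB]; ring

lemma eventually_rpow_mul_quantErr_sq_le {ε : ℝ} (hε : 0 < ε) :
    ∀ᶠ l : ℕ in atTop, ∀ k : ℕ, 1 ≤ k →
      (k : ℝ) ^ ((2 : ℝ) / l) * quantErrStdGaussian l k ^ 2 ≤ l * (1 + ε) := by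
  have hlim : Tendsto (fun δ : ℝ => exp (4 * δ) * (1 + δ) + 16 * (δ * eighthMoment))
      (nhdsWithin 0 (Set.Ioi 0)) (nhds 1) := by
    have : Continuous fun δ : ℝ => exp (4 * δ) * (1 + δ) + 16 * (δ * eighthMoment) := by fun_prop
    simpa using (this.tendsto 0).mono_left nhdsWithin_le_nhds
  obtain ⟨δ, hlt, hδ, hδ1⟩ := ((hlim.eventually_lt_const (by linarith : 1 < 1 + ε)).and
    (Ioo_mem_nhdsGT (zero_lt_one (α := ℝ)))).exists
  filter_upwards [(tendsto_scaledBound (θ := δ) hδ hδ1).eventually_lt_const hlt,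
    eventually_ge_atTop 1] with l hl hl1 k hk
  refine (rpow_mul_quantErr_sq_le_scaledBound hl1 hk hδ hδ1 hδ).trans ?_
  gcongr

lemma sInf_eq_one_of_tendsto {u : ℕ → ℝ} (h1 : ∀ l, 1 ≤ l → 1 ≤ u l)
    (hu : Tendsto u atTop (nhds 1)) : sInf {r : ℝ | ∃ l : ℕ, 1 ≤ l ∧ r = u l} = 1 := by
  have hb : ∀ r ∈ {r : ℝ | ∃ l : ℕ, 1 ≤ l ∧ r = u l}, 1 ≤ r := by
    rintro _ ⟨l, hl, rfl⟩
    exact h1 l hl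
  refine le_antisymm ?_ (le_csInf ⟨u 1, 1, le_rfl, rfl⟩ hb)
  refine ge_of_tendsto hu ?_
  filter_upwards [eventually_ge_atTop 1] with l hl
  exact csInf_le ⟨1, hb⟩ ⟨l, hl, rfl⟩

lemma tendsto_one_of_eventually_le {u : ℕ → ℝ} (h1 : ∀ l, 1 ≤ l → 1 ≤ u l)
    (hu : ∀ ε : ℝ, 0 < ε → ∀ᶠ l in atTop, u l ≤ 1 + ε) : Tendsto u atTop (nhds 1) := by
  refine tendsto_order.2 ⟨fun a ha => ?_, fun a ha => ?_⟩
  · filter_upwards [eventually_ge_atTop 1] with l hl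
    exact ha.trans_le (h1 l hl)
  · filter_upwards [hu ((a - 1) / 2) (by linarith)] with l hl
    linarith

end GaussianQuantization

/-- With `C(l) = sup_{k ≥ 1} k^{2/l} e_k(N(0,I_l))²` and
`Q(l) = lim_{k → ∞} k^{2/l} e_k(N(0,I_l))²` (the limit exists by the finite-dimensional
high-resolution theorem), one has
`lim_l C(l)/l = lim_l Q(l)/l = inf_{l ≥ 1} C(l)/l = inf_{l ≥ 1} Q(l)/l = 1`. -/
theorem gaussian_quantization_constants_asymptotics
    (C Q : ℕ → ℝ)
    (hC : ∀ l : ℕ, 1 ≤ l →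
      C l = sSup { r : ℝ | ∃ k : ℕ, 1 ≤ k ∧
        r = (k : ℝ) ^ ((2 : ℝ)/l) * quantErrStdGaussian l k ^ 2 })
    (hQ : ∀ l : ℕ, 1 ≤ l →
      Tendsto (fun k : ℕ => (k : ℝ) ^ ((2 : ℝ)/l) * quantErrStdGaussian l k ^ 2)
        atTop (nhds (Q l))) :
    Tendsto (fun l : ℕ => C l / l) atTop (nhds 1) ∧
    Tendsto (fun l : ℕ => Q l / l) atTop (nhds 1) ∧
    sInf { r : ℝ | ∃ l : ℕ, 1 ≤ l ∧ r = C l / l } = 1 ∧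
    sInf { r : ℝ | ∃ l : ℕ, 1 ≤ l ∧ r = Q l / l } = 1 := by
  have hbdd : ∀ l : ℕ, 1 ≤ l → BddAbove { r : ℝ | ∃ k : ℕ, 1 ≤ k ∧
      r = (k : ℝ) ^ ((2 : ℝ)/l) * quantErrStdGaussian l k ^ 2 } := fun l hl => by
    refine (hQ l hl).bddAbove_range.mono ?_
    rintro _ ⟨k, -, rfl⟩
    exact ⟨k, rfl⟩
  have hQ1 : ∀ l : ℕ, 1 ≤ l → 1 ≤ Q l / l := fun l hl => by
    rw [one_le_div (by exact_mod_cast hl)]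
    refine ge_of_tendsto (hQ l hl) ?_
    filter_upwards [eventually_ge_atTop 1] with k hk
    exact GaussianQuantization.le_rpow_mul_quantErr_sq hl hk
  have hQC : ∀ l : ℕ, 1 ≤ l → Q l / l ≤ C l / l := fun l hl => by
    gcongr
    refine le_of_tendsto (hQ l hl) ?_
    filter_upwards [eventually_ge_atTop 1] with k hk
    rw [hC l hl]
    exact le_csSup (hbdd l hl) ⟨k, hk, rfl⟩
  have hCle : ∀ ε : ℝ, 0 < ε → ∀ᶠ l : ℕ in atTop, C l / l ≤ 1 + ε := fun ε hε => by
    filter_upwards [GaussianQuantization.eventually_rpow_mul_quantErr_sq_le hε,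
      eventually_ge_atTop 1] with l hl hl1
    rw [div_le_iff₀' (by exact_mod_cast hl1), hC l hl1]
    refine csSup_le ⟨_, 1, le_rfl, rfl⟩ ?_
    rintro _ ⟨k, hk, rfl⟩
    exact hl k hk
  have hC1 : ∀ l : ℕ, 1 ≤ l → 1 ≤ C l / l := fun l hl => (hQ1 l hl).trans (hQC l hl)
  have hQle : ∀ ε : ℝ, 0 < ε → ∀ᶠ l : ℕ in atTop, Q l / l ≤ 1 + ε := fun ε hε => by
    filter_upwards [hCle ε hε, eventually_ge_atTop 1] with l hl hl1
    exact (hQC l hl1).trans hl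
  have tC := GaussianQuantization.tendsto_one_of_eventually_le hC1 hCle
  have tQ := GaussianQuantization.tendsto_one_of_eventually_le hQ1 hQle
  exact ⟨tC, tQ, GaussianQuantization.sInf_eq_one_of_tendsto hC1 tC,
    GaussianQuantization.sInf_eq_one_of_tendsto hQ1 tQ⟩
end

section
/- Let X be a centered Gaussian random vector in a separable Hilbert space H with infinite-dimensional Cameron–Martin space, whose ordered nonzero covariance eigenvalues satisfy λ_j ~ φ(j) as j → ∞, where φ is decreasing and regularly varying at infinity of index −b with b > 1. For n ∈ ℕ let d_n(X) := min{ dim span(α) : α ⊆ H an L²-optimal n-quantizer for X }. Then liminf_{n→∞} d_n(X) / ((2 log n)/b) ≥ b^{−1/(b−1)}, i.e. d_n(X) ≳ b^{−1/(b−1)} · (2 log n)/b as n → ∞. -/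
open MeasureTheory ProbabilityTheory Filter Real
open scoped RealInnerProductSpace NNReal

/-- The minimal `n`-th `L²`-quantization error of an `H`-valued random vector `X`. -/
noncomputable def quantErr {H : Type*} [NormedAddCommGroup H] [InnerProductSpace ℝ H]
    {Ω : Type*} [MeasurableSpace Ω] (P : Measure Ω) (X : Ω → H) (n : ℕ) : ℝ :=
  sInf { r : ℝ | ∃ α : Finset H, α.Nonempty ∧ α.card ≤ n ∧
    r = (∫ ω, sInf ((fun a => ‖X ω - a‖ ^ 2) '' (α : Set H)) ∂P) ^ (1/2 : ℝ) }

/-- Upper and lower Potter bounds for a decreasing regularly varying function. -/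
theorem potter_real {s b : ℝ} (hb : 1 < b) {φ : ℝ → ℝ} (hφ_pos : ∀ x, s < x → 0 < φ x)
    (hφ_dec : ∀ x y, s < x → x ≤ y → φ y ≤ φ x)
    (hφ_rv : ∀ c : ℝ, 0 < c →
      Tendsto (fun x : ℝ => φ (c * x) / φ x) atTop (nhds (c ^ (-b))))
    {δ : ℝ} (hδ : 0 < δ) :
    ∃ K : ℝ, 0 < K ∧ s < K ∧ ∀ x y, K ≤ x → x ≤ y →
      φ y ≤ (1 + δ) * (x / y) ^ (b - δ) * φ x ∧
      φ x ≤ (1 + δ) * (y / x) ^ (b + δ) * φ y := by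
  obtain ⟨q, hq1, hq2⟩ : ∃ q : ℝ, 1 < q ∧ q ^ (b + δ) < 1 + δ := by
    have hc : Tendsto (fun q : ℝ => q ^ (b + δ)) (nhdsWithin 1 (Set.Ioi 1)) (nhds 1) := by
      have : ContinuousAt (fun q : ℝ => q ^ (b + δ)) 1 :=
        Real.continuousAt_rpow_const _ _ (Or.inl one_ne_zero)
      have h := this.tendsto
      rw [Real.one_rpow] at h
      exact h.mono_left nhdsWithin_le_nhds
    have h1 := hc.eventually (gt_mem_nhds (show (1 : ℝ) < 1 + δ by linarith))
    obtain ⟨q, h, h'⟩ := (h1.and self_mem_nhdsWithin).exists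
    exact ⟨q, h', h⟩
  have hq0 : 0 < q := by linarith
  have hl : q ^ (-(b + δ)) < q ^ (-b) := Real.rpow_lt_rpow_of_exponent_lt hq1 (by linarith)
  have hr : q ^ (-b) < q ^ (-(b - δ)) := Real.rpow_lt_rpow_of_exponent_lt hq1 (by linarith)
  have hev := (hφ_rv q hq0).eventually (Ioo_mem_nhds hl hr)
  obtain ⟨K₀, hK₀⟩ := eventually_atTop.1 hev
  set K := max K₀ (max 1 (s + 1)) with hK
  have hKs : s + 1 ≤ K := le_trans (le_max_right _ _) (le_max_right _ _)
  have hK1 : 1 ≤ K := le_trans (le_max_left _ _) (le_max_right _ _)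
  have hKK : K₀ ≤ K := le_max_left _ _
  have step : ∀ x, K ≤ x → φ (q * x) ≤ q ^ (-(b - δ)) * φ x ∧ q ^ (-(b + δ)) * φ x ≤ φ (q * x) := by
    intro x hx
    have hp := hφ_pos x (by linarith)
    have := hK₀ x (by linarith)
    rw [lt_div_iff₀ hp, div_lt_iff₀ hp] at this
    exact ⟨this.2.le, this.1.le⟩
  have iter : ∀ i : ℕ, ∀ x, K ≤ x →
      φ (q ^ i * x) ≤ (q ^ i) ^ (-(b - δ)) * φ x ∧ (q ^ i) ^ (-(b + δ)) * φ x ≤ φ (q ^ i * x) := by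
    intro i
    induction i with
    | zero => intro x hx; simp
    | succ i ih =>
      intro x hx
      have hx' : K ≤ q ^ i * x := by
        have : 1 ≤ q ^ i := one_le_pow₀ hq1.le
        nlinarith
      obtain ⟨h1, h2⟩ := ih x hx
      obtain ⟨h3, h4⟩ := step _ hx'
      have e : q ^ (i + 1) * x = q * (q ^ i * x) := by ring
      rw [e, pow_succ, Real.mul_rpow (by positivity) hq0.le, Real.mul_rpow (by positivity) hq0.le]
      constructor
      · calc _ ≤ _ := h3
          _ ≤ q ^ (-(b - δ)) * ((q ^ i) ^ (-(b - δ)) * φ x) := by gcongr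
          _ = _ := by ring
      · calc _ = q ^ (-(b + δ)) * ((q ^ i) ^ (-(b + δ)) * φ x) := by ring
          _ ≤ q ^ (-(b + δ)) * φ (q ^ i * x) := by gcongr
          _ ≤ _ := h4
  refine ⟨K, by linarith, by linarith, ?_⟩
  intro x y hx hxy
  have hx0 : 0 < x := by linarith
  have hy0 : 0 < y := by linarith
  have hpx := hφ_pos x (by linarith)
  have hpy := hφ_pos y (by linarith)
  obtain ⟨i, hi1, hi2⟩ := exists_nat_pow_near (x := y / x) (y := q)
    (by rw [le_div_iff₀ hx0]; linarith) hq1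
  rw [le_div_iff₀ hx0] at hi1
  rw [div_lt_iff₀ hx0] at hi2
  have hone : 1 ≤ q ^ i := one_le_pow₀ hq1.le
  have hone' : 1 ≤ q ^ (i + 1) := one_le_pow₀ hq1.le
  have hqb : q ^ (b - δ) ≤ 1 + δ :=
    (Real.rpow_le_rpow_of_exponent_le hq1.le (by linarith)).trans hq2.le
  constructor
  · by_cases hbd : 0 ≤ b - δ
    · have h1 : φ y ≤ φ (q ^ i * x) := hφ_dec _ _ (by nlinarith) hi1
      have h2 := (iter i x hx).1
      have h3 : (q ^ i) ^ (-(b - δ)) ≤ (1 + δ) * (x / y) ^ (b - δ) := by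
        rw [Real.rpow_neg (by positivity), ← Real.inv_rpow (by positivity)]
        calc ((q ^ i)⁻¹) ^ (b - δ) ≤ (q * (x / y)) ^ (b - δ) := by
              apply Real.rpow_le_rpow (by positivity) _ hbd
              rw [inv_le_iff_one_le_mul₀ (by positivity)]
              have : q * (x / y) * q ^ i = q ^ (i + 1) * x / y := by ring
              rw [this, one_le_div hy0]; exact hi2.le
          _ = q ^ (b - δ) * (x / y) ^ (b - δ) := Real.mul_rpow hq0.le (by positivity)
          _ ≤ _ := by gcongr
      calc φ y ≤ (q ^ i) ^ (-(b - δ)) * φ x := h1.trans h2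
        _ ≤ _ := by gcongr
    · have h1 : φ y ≤ φ x := hφ_dec _ _ (by linarith) hxy
      have h2 : 1 ≤ (x / y) ^ (b - δ) :=
        Real.one_le_rpow_of_pos_of_le_one_of_nonpos (by positivity)
          (by rw [div_le_one hy0]; exact hxy) (by linarith)
      have : 1 ≤ (1 + δ) * (x / y) ^ (b - δ) := by nlinarith
      nlinarith
  · have h1 : φ (q ^ (i + 1) * x) ≤ φ y := hφ_dec _ _ (by linarith) hi2.le
    have h2 := (iter (i + 1) x hx).2.trans h1
    rw [Real.rpow_neg (by positivity), inv_mul_le_iff₀ (by positivity)] at h2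
    refine h2.trans ?_
    gcongr
    calc (q ^ (i + 1)) ^ (b + δ) ≤ (q * (y / x)) ^ (b + δ) := by
          apply Real.rpow_le_rpow (by positivity) _ (by linarith)
          rw [pow_succ, mul_comm]
          gcongr
          rw [le_div_iff₀ hx0]; exact hi1
      _ = q ^ (b + δ) * (y / x) ^ (b + δ) := Real.mul_rpow hq0.le (by positivity)
      _ ≤ _ := by gcongr

/-- Potter bounds for a sequence asymptotically equivalent to a decreasing regularly varying
function. -/
theorem potter_seq {s b : ℝ} (hb : 1 < b) {φ : ℝ → ℝ} (hφ_pos : ∀ x, s < x → 0 < φ x)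
    (hφ_dec : ∀ x y, s < x → x ≤ y → φ y ≤ φ x)
    (hφ_rv : ∀ c : ℝ, 0 < c →
      Tendsto (fun x : ℝ => φ (c * x) / φ x) atTop (nhds (c ^ (-b))))
    {lam : ℕ → ℝ} (hasymp : Tendsto (fun j : ℕ => lam j / φ j) atTop (nhds 1))
    {δ : ℝ} (hδ : 0 < δ) :
    ∃ K : ℕ, 0 < K ∧ ∀ k j : ℕ, K ≤ k → k ≤ j →
      lam j ≤ (1 + δ) * ((k : ℝ) / j) ^ (b - δ) * lam k ∧
      lam k ≤ (1 + δ) * ((j : ℝ) / k) ^ (b + δ) * lam j := by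
  obtain ⟨η, hη0, hη1, hηδ⟩ : ∃ η : ℝ, 0 < η ∧ η < δ ∧ (1 + η) * ((1 + η) * (1 + η)) ≤ 1 + δ := by
    refine ⟨min (δ / 8) 1, by positivity, ?_, ?_⟩
    · have := min_le_left (δ / 8) 1; linarith
    · have h1 := min_le_left (δ / 8) 1
      have h2 := min_le_right (δ / 8) 1
      have h3 : 0 < min (δ / 8) 1 := by positivity
      nlinarith [mul_pos h3 h3]
  obtain ⟨K₁, hK₁, hsK₁, hP⟩ := potter_real hb hφ_pos hφ_dec hφ_rv hη0
  have hl : (1 + η)⁻¹ < 1 := inv_lt_one_of_one_lt₀ (by linarith)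
  obtain ⟨K₂, hK₂⟩ := eventually_atTop.1
    (hasymp.eventually (Ioo_mem_nhds hl (show (1 : ℝ) < 1 + η by linarith)))
  refine ⟨max K₂ (max 1 ⌈K₁⌉₊), by positivity, ?_⟩
  have key : ∀ k : ℕ, max K₂ (max 1 ⌈K₁⌉₊) ≤ k → 0 < (k : ℝ) ∧ K₁ ≤ (k : ℝ) ∧ 0 < φ k ∧
      lam k ≤ (1 + η) * φ k ∧ φ k ≤ (1 + η) * lam k := by
    intro k hk
    simp only [max_le_iff] at hk
    obtain ⟨h1, h2, h3⟩ := hk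
    have h3' : K₁ ≤ k := (Nat.le_ceil _).trans (by exact_mod_cast h3)
    have hp := hφ_pos k (by linarith)
    have := hK₂ k h1
    rw [lt_div_iff₀ hp, div_lt_iff₀ hp, inv_mul_lt_iff₀ (by linarith)] at this
    exact ⟨by exact_mod_cast h2, h3', hp, this.2.le, this.1.le⟩
  intro k j hk hkj
  obtain ⟨k1, k2, k3, k4, k5⟩ := key k hk
  obtain ⟨j1, j2, j3, j4, j5⟩ := key j (hk.trans hkj)
  have hkj' : (k : ℝ) ≤ j := by exact_mod_cast hkj
  obtain ⟨p1, p2⟩ := hP k j k2 hkj'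
  have lk : 0 < lam k := by nlinarith
  have lj : 0 < lam j := by nlinarith
  have e1 : ((k : ℝ) / j) ^ (b - η) ≤ ((k : ℝ) / j) ^ (b - δ) :=
    Real.rpow_le_rpow_of_exponent_ge (by positivity) (by rw [div_le_one j1]; exact hkj')
      (by linarith)
  have e2 : ((j : ℝ) / k) ^ (b + η) ≤ ((j : ℝ) / k) ^ (b + δ) :=
    Real.rpow_le_rpow_of_exponent_le (by rw [one_le_div k1]; exact hkj') (by linarith)
  constructor
  · calc lam j ≤ (1 + η) * ((1 + η) * ((k : ℝ) / j) ^ (b - η) * ((1 + η) * lam k)) := by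
          refine j4.trans ?_
          gcongr
          refine p1.trans ?_
          gcongr
      _ = ((1 + η) * ((1 + η) * (1 + η))) * ((k : ℝ) / j) ^ (b - η) * lam k := by ring
      _ ≤ _ := by gcongr
  · calc lam k ≤ (1 + η) * ((1 + η) * ((j : ℝ) / k) ^ (b + η) * ((1 + η) * lam j)) := by
          refine k4.trans ?_
          gcongr
          refine p2.trans ?_
          gcongr
      _ = ((1 + η) * ((1 + η) * (1 + η))) * ((j : ℝ) / k) ^ (b + η) * lam j := by ring
      _ ≤ _ := by gcongr

/-- The two-sided power bounds satisfied by regularly varying sequences of index `-b`. -/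
def PotterBounds (b : ℝ) (lam : ℕ → ℝ) : Prop :=
  ∀ δ : ℝ, 0 < δ → ∃ K : ℕ, 0 < K ∧ ∀ k j : ℕ, K ≤ k → k ≤ j →
    lam j ≤ (1 + δ) * ((k : ℝ) / j) ^ (b - δ) * lam k ∧
    lam k ≤ (1 + δ) * ((j : ℝ) / k) ^ (b + δ) * lam j

theorem one_sub_mul_le_one_add_rpow_neg {s q : ℝ} (hs : -1 < s) (hq : 0 ≤ q) :
    1 - q * s ≤ (1 + s) ^ (-q) := by
  have h0 : 0 < 1 + s := by linarith
  rw [Real.rpow_def_of_pos h0]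
  have h1 := Real.add_one_le_exp (Real.log (1 + s) * -q)
  have h2 := Real.log_le_sub_one_of_pos h0
  nlinarith

theorem rpow_sub_rpow_succ_le {x p : ℝ} (hx : 0 < x) (hp : 1 < p) :
    x ^ (1 - p) - (x + 1) ^ (1 - p) ≤ (p - 1) * x ^ (-p) := by
  have h := one_sub_mul_le_one_add_rpow_neg (s := 1 / x) (q := p - 1)
    (by have : 0 < 1 / x := by positivity
        linarith) (by linarith)
  have e1 : (x + 1) ^ (1 - p) = x ^ (1 - p) * (1 + 1 / x) ^ (-(p - 1)) := by
    rw [neg_sub, ← Real.mul_rpow hx.le (by positivity)]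
    congr 1; field_simp
  have e2 : x ^ (-p) = x ^ (1 - p) * (1 / x) := by
    rw [show -p = (1 - p) - 1 by ring, Real.rpow_sub_one hx.ne']; ring
  rw [e1, e2]
  have : 0 < x ^ (1 - p) := by positivity
  nlinarith

theorem le_rpow_sub_rpow_succ {x p : ℝ} (hx : 0 < x) (hp : 1 < p) :
    (p - 1) * (x + 1) ^ (-p) ≤ x ^ (1 - p) - (x + 1) ^ (1 - p) := by
  have hx1 : 0 < x + 1 := by linarith
  have hlt : 1 / (x + 1) < 1 := by rw [div_lt_one hx1]; linarith
  have h := one_sub_mul_le_one_add_rpow_neg (s := -(1 / (x + 1))) (q := p - 1)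
    (by linarith) (by linarith)
  have e1 : x ^ (1 - p) = (x + 1) ^ (1 - p) * (1 + -(1 / (x + 1))) ^ (-(p - 1)) := by
    rw [neg_sub, ← Real.mul_rpow hx1.le (by linarith)]
    congr 1; field_simp; ring
  have e2 : (x + 1) ^ (-p) = (x + 1) ^ (1 - p) * (1 / (x + 1)) := by
    rw [show -p = (1 - p) - 1 by ring, Real.rpow_sub_one hx1.ne']; ring
  rw [e1, e2]
  have : 0 < (x + 1) ^ (1 - p) := by positivity
  nlinarith

theorem sum_rpow_le {m p : ℝ} (hm : 0 < m) (hp : 1 < p) (N : ℕ) :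
    ∑ i ∈ Finset.range N, (m / (m + (i + 1))) ^ p ≤ m / (p - 1) := by
  have key : ∀ N : ℕ, (p - 1) * ∑ i ∈ Finset.range N, (m + (i + 1)) ^ (-p) ≤
      m ^ (1 - p) - (m + N) ^ (1 - p) := by
    intro N
    induction N with
    | zero => simp
    | succ N ih =>
      rw [Finset.sum_range_succ, mul_add]
      have := le_rpow_sub_rpow_succ (x := m + N) (by positivity) hp
      push_cast
      rw [add_assoc] at this
      linarith
  have e : ∑ i ∈ Finset.range N, (m / (m + (i + 1))) ^ p =
      m ^ p * ∑ i ∈ Finset.range N, (m + (i + 1)) ^ (-p) := by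
    rw [Finset.mul_sum]
    refine Finset.sum_congr rfl fun i _ => ?_
    rw [Real.div_rpow hm.le (by positivity), Real.rpow_neg (by positivity)]; rfl
  have hk : (p - 1) * ∑ i ∈ Finset.range N, (m + (i + 1)) ^ (-p) ≤ m ^ (1 - p) :=
    (key N).trans (by have : 0 ≤ (m + N) ^ (1 - p) := by positivity
                      linarith)
  rw [e, le_div_iff₀ (by linarith)]
  calc _ = m ^ p * ((p - 1) * ∑ i ∈ Finset.range N, (m + (i + 1)) ^ (-p)) := by ring
    _ ≤ m ^ p * m ^ (1 - p) := by gcongr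
    _ = m := by rw [← Real.rpow_add hm]; simp

theorem le_tsum_rpow {k p : ℝ} (hk : 0 < k) (hp : 1 < p) {f : ℕ → ℝ} (hf : Summable f)
    {c : ℝ} (hc : 0 ≤ c) (h : ∀ i : ℕ, c * (k / (k + i)) ^ p ≤ f i) :
    c * (k / (p - 1)) ≤ ∑' i, f i := by
  have key : ∀ N : ℕ, k ^ (1 - p) - (k + N) ^ (1 - p) ≤
      (p - 1) * ∑ i ∈ Finset.range N, (k + i) ^ (-p) := by
    intro N
    induction N with
    | zero => simp
    | succ N ih =>
      rw [Finset.sum_range_succ, mul_add]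
      have := rpow_sub_rpow_succ_le (x := k + N) (by positivity) hp
      push_cast
      rw [add_assoc] at this
      linarith
  have e : ∀ N, ∑ i ∈ Finset.range N, c * (k / (k + i)) ^ p =
      c * k ^ p * ∑ i ∈ Finset.range N, (k + i) ^ (-p) := by
    intro N
    rw [Finset.mul_sum]
    refine Finset.sum_congr rfl fun i _ => ?_
    rw [Real.div_rpow hk.le (by positivity), Real.rpow_neg (by positivity)]; ring
  have hS : ∀ N, c * (k / (p - 1)) - c * k ^ p / (p - 1) * (k + N) ^ (1 - p)
      ≤ ∑ i ∈ Finset.range N, f i := by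
    intro N
    refine le_trans ?_ (Finset.sum_le_sum fun i _ => h i)
    rw [e]
    have h1 := mul_le_mul_of_nonneg_left (key N) (show 0 ≤ c * k ^ p / (p - 1) from
      div_nonneg (by positivity) (by linarith))
    have e2 : k ^ p * k ^ (1 - p) = k := by rw [← Real.rpow_add hk]; simp
    have hp' : p - 1 ≠ 0 := by linarith
    calc _ = c * k ^ p / (p - 1) * (k ^ (1 - p) - (k + N) ^ (1 - p)) := by
          rw [mul_sub]
          congr 1
          rw [← e2]
          simp only [mul_div_assoc]
          rw [e2]
          field_simp
      _ ≤ _ := h1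
      _ = _ := by field_simp
  have hlim : Tendsto (fun N : ℕ => c * (k / (p - 1)) - c * k ^ p / (p - 1) * (k + N) ^ (1 - p))
      atTop (nhds (c * (k / (p - 1)) - c * k ^ p / (p - 1) * 0)) := by
    refine tendsto_const_nhds.sub (tendsto_const_nhds.mul ?_)
    have h1 : Tendsto (fun N : ℕ => k + (N : ℝ)) atTop atTop :=
      tendsto_atTop_add_const_left _ _ tendsto_natCast_atTop_atTop
    have h2 := (tendsto_rpow_neg_atTop (y := p - 1) (by linarith)).comp h1
    simpa [Function.comp_def] using h2
  have := le_of_tendsto_of_tendsto' hlim hf.hasSum.tendsto_sum_nat hS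
  simpa using this

theorem PotterBounds.summable {b : ℝ} {lam : ℕ → ℝ} (hP : PotterBounds b lam) (hb : 1 < b)
    (hpos : ∀ j, 0 < lam j) : Summable lam := by
  obtain ⟨K, hK, h⟩ := hP ((b - 1) / 2) (by linarith)
  rw [← summable_nat_add_iff (K + 1)]
  refine summable_of_sum_range_le (c := (1 + (b - 1) / 2) * lam K * (K / (b - (b - 1) / 2 - 1)))
    (fun n => (hpos _).le) fun N => ?_
  have hK' : (0 : ℝ) < K := by exact_mod_cast hK
  refine le_trans ?_ (mul_le_mul_of_nonneg_left
    (sum_rpow_le (m := K) hK' (p := b - (b - 1) / 2) (by linarith) N)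
    (mul_nonneg (by linarith) (hpos K).le))
  rw [Finset.mul_sum]
  refine Finset.sum_le_sum fun i _ => ?_
  have := (h K (i + (K + 1)) le_rfl (by omega)).1
  push_cast at this
  rw [show (i : ℝ) + (K + 1) = K + (i + 1) by ring] at this
  linarith

/-- Upper Karamata bound for the tails. -/
theorem PotterBounds.tail_le {b : ℝ} {lam : ℕ → ℝ} (hP : PotterBounds b lam) (hb : 1 < b)
    (hpos : ∀ j, 0 < lam j) {δ : ℝ} (hδ : 0 < δ) (hδb : δ < b - 1) :
    ∀ᶠ m : ℕ in atTop, ∑' j, lam (m + j) ≤ lam m + (1 + δ) * lam m * (m / (b - δ - 1)) := by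
  obtain ⟨K, hK, h⟩ := hP δ hδ
  filter_upwards [eventually_ge_atTop K] with m hm
  have hsum := hP.summable hb hpos
  have hs : Summable fun j => lam (m + j) := by
    simpa [add_comm] using (summable_nat_add_iff m).2 hsum
  rw [hs.tsum_eq_zero_add]
  simp only [add_zero]
  gcongr
  refine Real.tsum_le_of_sum_range_le (fun n => (hpos _).le) fun N => ?_
  have hm' : (0 : ℝ) < m := by exact_mod_cast (hK.trans_le hm)
  refine le_trans ?_ (mul_le_mul_of_nonneg_left
    (sum_rpow_le (m := m) hm' (p := b - δ) (by linarith) N)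
    (mul_nonneg (by linarith) (hpos m).le))
  rw [Finset.mul_sum]
  refine Finset.sum_le_sum fun i _ => ?_
  have := (h m (m + (i + 1)) hm (by omega)).1
  push_cast at this
  linarith

/-- Lower Karamata bound for the tails. -/
theorem PotterBounds.le_tail {b : ℝ} {lam : ℕ → ℝ} (hP : PotterBounds b lam) (hb : 1 < b)
    (hpos : ∀ j, 0 < lam j) {δ : ℝ} (hδ : 0 < δ) :
    ∀ᶠ k : ℕ in atTop, (1 + δ)⁻¹ * lam k * (k / (b + δ - 1)) ≤ ∑' j, lam (k + j) := by
  obtain ⟨K, hK, h⟩ := hP δ hδ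
  filter_upwards [eventually_ge_atTop K] with k hk
  have hs : Summable fun j => lam (k + j) := by
    simpa [add_comm] using (summable_nat_add_iff k).2 (hP.summable hb hpos)
  have hk' : (0 : ℝ) < k := by exact_mod_cast (hK.trans_le hk)
  refine le_tsum_rpow hk' (by linarith) hs (mul_nonneg (by positivity) (hpos k).le) fun i => ?_
  have := (h k (k + i) hk (by omega)).2
  push_cast at this
  rw [← inv_div, Real.inv_rpow (by positivity)]
  have h1 : 0 < (((k : ℝ) + i) / k) ^ (b + δ) := by positivity
  calc _ ≤ (1 + δ)⁻¹ * ((1 + δ) * (((k : ℝ) + i) / k) ^ (b + δ) * lam (k + i)) *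
        ((((k : ℝ) + i) / k) ^ (b + δ))⁻¹ := by gcongr
    _ = _ := by field_simp

/-- Comparison of the tail sum at `ρ m` with the reverse water-filling distortion at `m`. -/
theorem PotterBounds.waterfilling_lt_tail {b : ℝ} {lam : ℕ → ℝ} (hP : PotterBounds b lam)
    (hb : 1 < b) (hpos : ∀ j, 0 < lam j) {ρ : ℝ} (hρ0 : 0 < ρ) (hρ1 : ρ < 1)
    (hρ : b < ρ ^ (1 - b)) :
    ∃ η : ℝ, 0 < η ∧ ∀ᶠ m : ℕ in atTop,
      (1 + η) * (m * lam m) + ∑' j, lam (m + j) < ∑' j, lam (⌈ρ * m⌉₊ + j) := by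
  obtain ⟨δ, ⟨hδ0, hδb, hδρ⟩, hδ⟩ : ∃ δ : ℝ, (0 < δ ∧ δ < b - 1 ∧ ρ * (1 + δ) < 1) ∧
      1 + 2 * δ + (1 + δ) / (b - δ - 1) <
        ((1 + δ)⁻¹ * (1 + δ)⁻¹) * ((ρ * (1 + δ)) ^ (-(b - δ - 1)) / (b + δ - 1)) := by
    have c1 : ContinuousAt (fun δ : ℝ => 1 + 2 * δ + (1 + δ) / (b - δ - 1)) 0 := by
      refine ContinuousAt.add (by fun_prop) (ContinuousAt.div (by fun_prop) (by fun_prop) ?_)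
      simp; linarith
    have c2 : ContinuousAt (fun δ : ℝ => ((1 + δ)⁻¹ * (1 + δ)⁻¹) *
        ((ρ * (1 + δ)) ^ (-(b - δ - 1)) / (b + δ - 1))) 0 := by
      refine ContinuousAt.mul (ContinuousAt.mul ?_ ?_) (ContinuousAt.div ?_ (by fun_prop) ?_)
      · exact ContinuousAt.inv₀ (by fun_prop) (by simp)
      · exact ContinuousAt.inv₀ (by fun_prop) (by simp)
      · refine ContinuousAt.rpow (by fun_prop) (by fun_prop) (Or.inl ?_)
        simp; exact hρ0.ne'
      · simp; linarith
    have c3 : ContinuousAt (fun δ : ℝ => ρ * (1 + δ)) 0 := by fun_prop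
    have hb1 : 0 < b - 1 := by linarith
    have hlt := c1.eventually_lt c2 (by
      simp only [mul_zero, add_zero, sub_zero, inv_one, mul_one, one_mul, neg_sub]
      rw [show (1 : ℝ) + 1 / (b - 1) = b / (b - 1) by field_simp; ring]
      gcongr)
    have h3 := c3.eventually (gt_mem_nhds (show ρ * (1 + 0) < 1 by simpa using hρ1))
    have h4 : ∀ᶠ δ : ℝ in nhds 0, δ < b - 1 := gt_mem_nhds hb1
    have hall := ((hlt.and (h3.and h4)).filter_mono
      (nhdsWithin_le_nhds (s := Set.Ioi (0 : ℝ)))).and self_mem_nhdsWithin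
    obtain ⟨δ, ⟨a1, a2, a3⟩, a4⟩ := hall.exists
    exact ⟨δ, ⟨a4, a3, a2⟩, a1⟩
  refine ⟨δ, hδ0, ?_⟩
  obtain ⟨K, hK, hPK⟩ := hP δ hδ0
  have hceil : Tendsto (fun m : ℕ => ⌈ρ * (m : ℝ)⌉₊) atTop atTop := by
    refine tendsto_nat_ceil_atTop.comp ?_
    exact tendsto_natCast_atTop_atTop.const_mul_atTop hρ0
  have hbig : ∀ᶠ m : ℕ in atTop, (ρ * δ)⁻¹ + δ⁻¹ ≤ (m : ℝ) :=
    tendsto_natCast_atTop_atTop.eventually_ge_atTop _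
  filter_upwards [hP.tail_le hb hpos hδ0 hδb, hceil.eventually (hP.le_tail hb hpos hδ0),
    hceil.eventually_ge_atTop K, hbig, eventually_ge_atTop 1] with m h1 h2 h3 h4 h5
  set k := ⌈ρ * (m : ℝ)⌉₊ with hk
  have hm : (0 : ℝ) < m := by exact_mod_cast h5
  have hk0 : (0 : ℝ) < k := by exact_mod_cast (hK.trans_le h3)
  have g1 : 1 ≤ ρ * δ * m := by
    have : (ρ * δ)⁻¹ ≤ m := by
      have : 0 < δ⁻¹ := by positivity
      linarith
    rwa [inv_le_iff_one_le_mul₀' (by positivity)] at this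
  have g2 : 1 ≤ δ * m := by
    have : δ⁻¹ ≤ m := by
      have : 0 < (ρ * δ)⁻¹ := by positivity
      linarith
    rwa [inv_le_iff_one_le_mul₀' (by positivity)] at this
  have hkle : (k : ℝ) ≤ ρ * (1 + δ) * m := by
    have := (Nat.ceil_lt_add_one (show 0 ≤ ρ * (m : ℝ) by positivity)).le
    rw [← hk] at this
    linarith
  have hkm : k ≤ m := by
    have : (k : ℝ) ≤ m := hkle.trans (by nlinarith)
    exact_mod_cast this
  have h6 := (hPK k m h3 hkm).1
  have lm := hpos m
  have lk := hpos k
  refine lt_of_lt_of_le ?_ h2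
  have hbδ : 0 < b - δ - 1 := by linarith
  calc (1 + δ) * (m * lam m) + ∑' j, lam (m + j)
      ≤ (1 + δ) * (m * lam m) + (lam m + (1 + δ) * lam m * (m / (b - δ - 1))) := by gcongr
    _ ≤ (m * lam m) * (1 + 2 * δ + (1 + δ) / (b - δ - 1)) := by
        have : lam m ≤ lam m * (δ * m) := le_mul_of_one_le_right lm.le g2
        have e : (1 + δ) * lam m * (m / (b - δ - 1)) = m * lam m * ((1 + δ) / (b - δ - 1)) := by
          ring
        rw [e]; nlinarith
    _ < (m * lam m) * (((1 + δ)⁻¹ * (1 + δ)⁻¹) *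
          ((ρ * (1 + δ)) ^ (-(b - δ - 1)) / (b + δ - 1))) := by gcongr
    _ ≤ (m * lam m) * (((1 + δ)⁻¹ * (1 + δ)⁻¹) *
          (((k : ℝ) / m) ^ (-(b - δ - 1)) / (b + δ - 1))) := by
        have : (ρ * (1 + δ)) ^ (-(b - δ - 1)) ≤ ((k : ℝ) / m) ^ (-(b - δ - 1)) :=
          Real.rpow_le_rpow_of_nonpos (by positivity) (by rw [div_le_iff₀ hm]; exact hkle)
            (by linarith)
        have : 0 < b + δ - 1 := by linarith
        gcongr
    _ ≤ (m * ((1 + δ) * ((k : ℝ) / m) ^ (b - δ) * lam k)) * (((1 + δ)⁻¹ * (1 + δ)⁻¹) *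
          (((k : ℝ) / m) ^ (-(b - δ - 1)) / (b + δ - 1))) := by
        have : 0 < b + δ - 1 := by linarith
        gcongr
    _ = _ := by
        have e : ((k : ℝ) / m) ^ (b - δ) * ((k : ℝ) / m) ^ (-(b - δ - 1)) = k / m := by
          rw [← Real.rpow_add (by positivity)]
          simp
        have : b + δ - 1 ≠ 0 := by linarith
        calc _ = m * (((k : ℝ) / m) ^ (b - δ) * ((k : ℝ) / m) ^ (-(b - δ - 1))) * lam k *
              (1 + δ)⁻¹ * ((1 + δ) * (1 + δ)⁻¹) / (b + δ - 1) := by ring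
          _ = _ := by
            rw [e, mul_inv_cancel₀ (by linarith)]
            field_simp

theorem sum_log_div_le (m : ℕ) : ∑ j ∈ Finset.range m, Real.log ((m : ℝ) / j) ≤ m := by
  rcases Nat.eq_zero_or_pos m with rfl | hm
  · simp
  have hm' : (0 : ℝ) < m := by exact_mod_cast hm
  have h1 : ∑ j ∈ Finset.range m, Real.log ((m : ℝ) / j) =
      ∑ j ∈ Finset.range m, Real.log ((m : ℝ) / (j + 1 : ℕ)) := by
    have a := Finset.sum_range_succ (fun j : ℕ => Real.log ((m : ℝ) / j)) m
    have b := Finset.sum_range_succ' (fun j : ℕ => Real.log ((m : ℝ) / j)) m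
    rw [a] at b
    simpa [hm'.ne'] using b
  have h2 : ∀ N : ℕ, ∑ j ∈ Finset.range N, Real.log ((m : ℝ) / (j + 1 : ℕ)) =
      Real.log ((m : ℝ) ^ N / (N.factorial : ℝ)) := by
    intro N
    induction N with
    | zero => simp
    | succ N ih =>
      rw [Finset.sum_range_succ, ih, ← Real.log_mul (by positivity) (by positivity)]
      congr 1
      rw [Nat.factorial_succ]
      push_cast
      field_simp
      ring
  rw [h1, h2]
  have := Real.log_le_log (by positivity) (Real.pow_div_factorial_le_exp (m : ℝ) hm'.le m)
  rwa [Real.log_exp] at this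

theorem PotterBounds.log_zero_div_le {b : ℝ} {lam : ℕ → ℝ} (hP : PotterBounds b lam)
    (hb : 1 < b) (hpos : ∀ j, 0 < lam j) :
    ∃ C : ℝ, ∀ᶠ m : ℕ in atTop, Real.log (lam 0 / lam m) ≤ C + (b + 1) * Real.log m := by
  obtain ⟨K, hK, h⟩ := hP 1 one_pos
  refine ⟨Real.log (lam 0 / lam K) + Real.log 2, ?_⟩
  filter_upwards [eventually_ge_atTop K] with m hm
  have hK' : (1 : ℝ) ≤ K := by exact_mod_cast hK
  have hm' : (0 : ℝ) < m := by exact_mod_cast (hK.trans_le hm)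
  have h1 := (h K m le_rfl hm).2
  have h2 : lam 0 / lam m ≤ lam 0 / lam K * 2 * (m : ℝ) ^ (b + 1) := by
    have l0 := hpos 0
    have lm := hpos m
    have lK := hpos K
    have h3 : ((m : ℝ) / K) ^ (b + 1) ≤ (m : ℝ) ^ (b + 1) := by
      apply Real.rpow_le_rpow (by positivity) (div_le_self hm'.le hK') (by linarith)
    have h4 : lam K ≤ 2 * (m : ℝ) ^ (b + 1) * lam m := by
      refine h1.trans ?_
      norm_num
      gcongr
    rw [div_le_iff₀ lm]
    calc lam 0 = lam 0 / lam K * lam K := by field_simp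
      _ ≤ lam 0 / lam K * (2 * (m : ℝ) ^ (b + 1) * lam m) := by gcongr
      _ = _ := by ring
  have h3 := Real.log_le_log (div_pos (hpos 0) (hpos m)) h2
  have l0 := div_pos (hpos 0) (hpos K)
  rwa [Real.log_mul (by positivity) (by positivity), Real.log_mul (by positivity) (by norm_num),
    Real.log_rpow hm'] at h3

/-- The rate needed by reverse water-filling at level `lam m`. -/
theorem PotterBounds.sum_log_le {b : ℝ} {lam : ℕ → ℝ} (hP : PotterBounds b lam)
    (hb : 1 < b) (hpos : ∀ j, 0 < lam j) (hanti : Antitone lam) {η : ℝ} (hη : 0 < η) :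
    ∀ᶠ m : ℕ in atTop, ∑ j ∈ Finset.range m, Real.log (lam j / lam m) ≤ (b + η) * m := by
  obtain ⟨C, hC⟩ := hP.log_zero_div_le hb hpos
  obtain ⟨K, hK, h⟩ := hP (η / 3) (by positivity)
  have hlittle : ∀ᶠ m : ℕ in atTop, K * (C + (b + 1) * Real.log m) ≤ η / 3 * m := by
    have h1 : Tendsto (fun x : ℝ => Real.log x / x) atTop (nhds 0) := by
      simpa using Real.isLittleO_log_id_atTop.tendsto_div_nhds_zero
    have h2 : Tendsto (fun x : ℝ => K * (C * x⁻¹ + (b + 1) * (Real.log x / x))) atTop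
        (nhds (K * (C * 0 + (b + 1) * 0))) :=
      tendsto_const_nhds.mul ((tendsto_const_nhds.mul tendsto_inv_atTop_zero).add
        (tendsto_const_nhds.mul h1))
    have h3 := (h2.comp tendsto_natCast_atTop_atTop).eventually
      (gt_mem_nhds (show (K : ℝ) * (C * 0 + (b + 1) * 0) < η / 3 by simp; positivity))
    filter_upwards [h3, eventually_gt_atTop 0] with m hm hm0
    have hm' : (0 : ℝ) < m := by exact_mod_cast hm0
    simp only [Function.comp] at hm
    calc K * (C + (b + 1) * Real.log m)
        = K * (C * (m : ℝ)⁻¹ + (b + 1) * (Real.log m / m)) * m := by field_simp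
      _ ≤ _ := by gcongr
  filter_upwards [hC, hlittle, eventually_ge_atTop K] with m h1 h2 h3
  have hm' : (0 : ℝ) < m := by exact_mod_cast (hK.trans_le h3)
  have bound : ∀ j ∈ Finset.range m, Real.log (lam j / lam m) ≤
      (if j < K then C + (b + 1) * Real.log m else 0) +
        (η / 3 + (b + η / 3) * Real.log ((m : ℝ) / j)) := by
    intro j hj
    have hjm : j < m := Finset.mem_range.1 hj
    have hlog : 0 ≤ Real.log ((m : ℝ) / j) := by
      rcases Nat.eq_zero_or_pos j with rfl | hj0
      · simp
      · refine Real.log_nonneg ?_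
        rw [one_le_div (by exact_mod_cast hj0)]
        exact_mod_cast hjm.le
    split_ifs with hjK
    · have : Real.log (lam j / lam m) ≤ Real.log (lam 0 / lam m) := by
        refine Real.log_le_log (div_pos (hpos _) (hpos _)) ?_
        have := hpos m
        gcongr
        exact hanti (Nat.zero_le _)
      have : 0 ≤ (b + η / 3) * Real.log ((m : ℝ) / j) := mul_nonneg (by linarith) hlog
      linarith
    · push Not at hjK
      have hj0 : (0 : ℝ) < j := by exact_mod_cast (hK.trans_le hjK)
      have h4 := (h j m hjK hjm.le).2
      rw [← div_le_iff₀ (hpos m)] at h4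
      have h5 := Real.log_le_log (div_pos (hpos _) (hpos _)) h4
      rw [Real.log_mul (by positivity) (by positivity), Real.log_rpow (by positivity)] at h5
      have h6 := Real.log_le_sub_one_of_pos (show 0 < 1 + η / 3 by positivity)
      linarith
  have hC0 : 0 ≤ C + (b + 1) * Real.log m := by
    refine le_trans (Real.log_nonneg ?_) h1
    rw [one_le_div (hpos m)]
    exact hanti (Nat.zero_le _)
  have hif : ∑ j ∈ Finset.range m, (if j < K then C + (b + 1) * Real.log m else 0) ≤
      K * (C + (b + 1) * Real.log m) := by
    rw [← Finset.sum_filter, Finset.sum_const, nsmul_eq_mul]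
    gcongr
    calc _ ≤ (Finset.range K).card := Finset.card_le_card (fun j hj => by
          simp at hj ⊢; exact hj.2)
      _ = K := by simp
  refine (Finset.sum_le_sum bound).trans ?_
  rw [Finset.sum_add_distrib, Finset.sum_add_distrib, ← Finset.mul_sum]
  have h7 := mul_le_mul_of_nonneg_left (sum_log_div_le m) (show 0 ≤ b + η / 3 by linarith)
  simp only [Finset.sum_const, Finset.card_range, nsmul_eq_mul]
  nlinarith

theorem PotterBounds.tendsto_exp_neg_div {b : ℝ} {lam : ℕ → ℝ} (hP : PotterBounds b lam)
    (hb : 1 < b) (hpos : ∀ j, 0 < lam j) {c : ℝ} (hc : 0 < c) :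
    Tendsto (fun m : ℕ => Real.exp (-(c * m)) / lam m) atTop (nhds 0) := by
  obtain ⟨C, hC⟩ := hP.log_zero_div_le hb hpos
  have h1 := ((tendsto_rpow_mul_exp_neg_mul_atTop_nhds_zero (b + 1) c hc).comp
    tendsto_natCast_atTop_atTop).const_mul (Real.exp C / lam 0)
  rw [mul_zero] at h1
  refine squeeze_zero' (Eventually.of_forall fun m => div_nonneg (Real.exp_pos _).le (hpos m).le)
    ?_ h1
  filter_upwards [hC, eventually_gt_atTop 0] with m hm hm0
  have hm' : (0 : ℝ) < m := by exact_mod_cast hm0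
  have l0 := hpos 0
  have lm := hpos m
  rw [Real.log_le_iff_le_exp (by positivity), Real.exp_add, mul_comm (b + 1),
    ← Real.rpow_def_of_pos hm'] at hm
  simp only [Function.comp, neg_mul]
  calc Real.exp (-(c * m)) / lam m = Real.exp (-(c * m)) * (lam 0 / lam m) / lam 0 := by
        field_simp
    _ ≤ Real.exp (-(c * m)) * (Real.exp C * (m : ℝ) ^ (b + 1)) / lam 0 := by gcongr
    _ = _ := by ring

open scoped ENNReal

theorem lintegral_pi_prod {m : ℕ} (μ : Fin m → Measure ℝ) [∀ i, SigmaFinite (μ i)]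
    {F : Fin m → ℝ → ℝ≥0∞} (hF : ∀ i, Measurable (F i)) :
    ∫⁻ x, ∏ i, F i (x i) ∂(Measure.pi μ) = ∏ i, ∫⁻ t, F i t ∂(μ i) := by
  induction m with
  | zero => simp
  | succ m ih =>
    have h := (measurePreserving_piFinSuccAbove μ 0).symm
    rw [← h.lintegral_comp_emb (MeasurableEquiv.measurableEmbedding _)]
    simp_rw [MeasurableEquiv.piFinSuccAbove_symm_apply, Fin.insertNthEquiv, Fin.prod_univ_succ,
      Fin.insertNth_zero]
    simp only [Fin.zero_succAbove, Equiv.coe_fn_mk, Fin.cons_zero, Fin.cons_succ, cast_eq]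
    rw [lintegral_prod_mul (f := fun t => F 0 t)
      (g := fun x : Fin m → ℝ => ∏ i : Fin m, F i.succ (x i))
      (hF 0).aemeasurable
      (Finset.measurable_prod _ fun i _ => (hF _).comp (measurable_pi_apply i)).aemeasurable,
      ih (fun i => μ i.succ) (fun i => hF _)]

/-- Conditional density of the Gaussian test channel with respect to the law of its output. -/
noncomputable def channelDensity (l θ x y : ℝ) : ℝ :=
  √(l / θ) * Real.exp (x ^ 2 / (2 * l) - (x - y) ^ 2 / (2 * θ))

theorem channelDensity_nonneg (l θ x y : ℝ) : 0 ≤ channelDensity l θ x y := by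
  unfold channelDensity; positivity

theorem measurable_channelDensity (l θ : ℝ) :
    Measurable fun z : ℝ × ℝ => channelDensity l θ z.1 z.2 := by
  unfold channelDensity; fun_prop

theorem lintegral_gaussianReal_eq {v : ℝ≥0} (hv : v ≠ 0) (μ : ℝ) {g : ℝ → ℝ}
    (hg : Measurable g) :
    ∫⁻ x, ENNReal.ofReal (g x) ∂(gaussianReal μ v) =
      ∫⁻ x, ENNReal.ofReal (gaussianPDFReal μ v x * g x) := by
  rw [gaussianReal_of_var_ne_zero _ hv, lintegral_withDensity_eq_lintegral_mul _
    (measurable_gaussianPDF _ _) (by fun_prop)]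
  refine lintegral_congr fun x => ?_
  rw [Pi.mul_apply, gaussianPDF, ENNReal.ofReal_mul (gaussianPDFReal_nonneg _ _ _)]

theorem lintegral_channelDensity {l θ : ℝ≥0} (hθ : 0 < θ) (hl : θ ≤ l) (x : ℝ) :
    ∫⁻ y, ENNReal.ofReal (channelDensity l θ x y) ∂(gaussianReal 0 (l - θ)) = 1 := by
  have hl0 : 0 < l := hθ.trans_le hl
  have hθ' : (0 : ℝ) < θ := by exact_mod_cast hθ
  have hl' : (0 : ℝ) < l := by exact_mod_cast hl0
  rcases hl.eq_or_lt with h | h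
  · subst h
    simp only [tsub_self, gaussianReal_zero_var]
    rw [lintegral_dirac]
    simp [channelDensity, hθ'.ne']
  · have hd : 0 < l - θ := tsub_pos_of_lt h
    have hdr : ((l - θ : ℝ≥0) : ℝ) = l - θ := NNReal.coe_sub hl
    have hd' : (0 : ℝ) < l - θ := by rw [← hdr]; exact_mod_cast hd
    set w : ℝ≥0 := θ * (l - θ) / l with hw
    have hw0 : w ≠ 0 := by positivity
    have hwr : (w : ℝ) = θ * (l - θ) / l := by rw [hw]; push_cast [hl]; rfl
    rw [lintegral_gaussianReal_eq hd.ne' _ (g := fun y => channelDensity l θ x y)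
      ((measurable_channelDensity l θ).comp measurable_prodMk_left)]
    rw [← lintegral_gaussianPDFReal_eq_one (x * (l - θ) / l) hw0]
    refine lintegral_congr fun y => ?_
    congr 1
    simp only [gaussianPDFReal, channelDensity, hdr, hwr]
    have e1 : (√(2 * π * (l - θ)))⁻¹ * √((l : ℝ) / θ) = (√(2 * π * (θ * (l - θ) / l)))⁻¹ := by
      rw [← Real.sqrt_inv, ← Real.sqrt_inv, ← Real.sqrt_mul (by positivity)]
      congr 1
      field_simp
    rw [← e1]
    have e2 : -(y - x * (l - θ) / l) ^ 2 / (2 * (θ * (l - θ) / l)) =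
        -(y - 0) ^ 2 / (2 * ((l : ℝ) - θ)) + (x ^ 2 / (2 * l) - (x - y) ^ 2 / (2 * θ)) := by
      field_simp
      ring
    rw [e2, Real.exp_add]
    ring

theorem gaussianPDFReal_mul_exp {v : ℝ≥0} (hv : 0 < v) {a : ℝ≥0} (ha : 0 < a) (y x : ℝ) :
    gaussianPDFReal y v x * Real.exp ((1 - 1 / a) / 2 * ((x - y) ^ 2 / v)) =
      √a * gaussianPDFReal y (a * v) x := by
  have hv' : (0 : ℝ) < v := by exact_mod_cast hv
  have ha' : (0 : ℝ) < a := by exact_mod_cast ha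
  simp only [gaussianPDFReal, NNReal.coe_mul]
  have e1 : √(a : ℝ) * (√(2 * π * (a * v)))⁻¹ = (√(2 * π * v))⁻¹ := by
    rw [← Real.sqrt_inv, ← Real.sqrt_inv, ← Real.sqrt_mul (by positivity)]
    congr 1
    field_simp
  rw [← mul_assoc, e1, mul_assoc, ← Real.exp_add]
  congr 2
  field_simp
  ring

theorem lintegral_exp_sq {v : ℝ≥0} (hv : 0 < v) {a : ℝ≥0} (ha : 0 < a) :
    ∫⁻ x, ENNReal.ofReal (Real.exp ((1 - 1 / a) / 2 * (x ^ 2 / v))) ∂(gaussianReal 0 v) =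
      ENNReal.ofReal (√a) := by
  rw [lintegral_gaussianReal_eq hv.ne' _ (by fun_prop)]
  have : ∀ x, gaussianPDFReal 0 v x * Real.exp ((1 - 1 / a) / 2 * (x ^ 2 / v)) =
      √a * gaussianPDFReal 0 (a * v) x := fun x => by
    simpa using gaussianPDFReal_mul_exp hv ha 0 x
  simp_rw [this, ENNReal.ofReal_mul (Real.sqrt_nonneg _)]
  rw [lintegral_const_mul _ (by fun_prop), lintegral_gaussianPDFReal_eq_one _ (by positivity),
    mul_one]

theorem lintegral_lintegral_channelDensity_exp {l θ : ℝ≥0} (hθ : 0 < θ) (hl : θ ≤ l)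
    {a : ℝ≥0} (ha : 0 < a) :
    ∫⁻ x, ∫⁻ y, ENNReal.ofReal (channelDensity l θ x y *
      Real.exp ((1 - 1 / a) / 2 * ((x - y) ^ 2 / θ))) ∂(gaussianReal 0 (l - θ))
      ∂(gaussianReal 0 l) = ENNReal.ofReal (√a) := by
  have hl0 : 0 < l := hθ.trans_le hl
  have hθ' : (0 : ℝ) < θ := by exact_mod_cast hθ
  have hl' : (0 : ℝ) < l := by exact_mod_cast hl0
  have hmeas : Measurable fun z : ℝ × ℝ => channelDensity l θ z.1 z.2 *
      Real.exp ((1 - 1 / a) / 2 * ((z.1 - z.2) ^ 2 / θ)) :=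
    (measurable_channelDensity l θ).mul (by fun_prop)
  rw [lintegral_lintegral_swap (hmeas.ennreal_ofReal.aemeasurable)]
  have inner : ∀ y : ℝ, ∫⁻ x, ENNReal.ofReal (channelDensity l θ x y *
      Real.exp ((1 - 1 / a) / 2 * ((x - y) ^ 2 / θ))) ∂(gaussianReal 0 l) =
      ENNReal.ofReal (√a) := by
    intro y
    rw [lintegral_gaussianReal_eq hl0.ne' _ (g := fun x => channelDensity l θ x y *
      Real.exp ((1 - 1 / a) / 2 * ((x - y) ^ 2 / θ))) (by unfold channelDensity; fun_prop)]
    have : ∀ x, gaussianPDFReal 0 l x * (channelDensity l θ x y *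
        Real.exp ((1 - 1 / a) / 2 * ((x - y) ^ 2 / θ))) =
        √a * gaussianPDFReal y (a * θ) x := fun x => by
      rw [← gaussianPDFReal_mul_exp hθ ha, ← mul_assoc]
      congr 1
      simp only [gaussianPDFReal, channelDensity]
      have e1 : (√(2 * π * l))⁻¹ * √((l : ℝ) / θ) = (√(2 * π * θ))⁻¹ := by
        rw [← Real.sqrt_inv, ← Real.sqrt_inv, ← Real.sqrt_mul (by positivity)]
        congr 1
        field_simp
      rw [← e1]
      have e2 : -(x - y) ^ 2 / (2 * θ) =
          -(x - 0) ^ 2 / (2 * (l : ℝ)) + (x ^ 2 / (2 * l) - (x - y) ^ 2 / (2 * θ)) := by ring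
      rw [e2, Real.exp_add]
      ring
    simp_rw [this, ENNReal.ofReal_mul (Real.sqrt_nonneg _)]
    rw [lintegral_const_mul _ (by fun_prop), lintegral_gaussianPDFReal_eq_one _ (by positivity),
      mul_one]
  simp_rw [inner]
  simp

/-- Chernoff weight, with tilting parameter `a`, of the pair `(x, y)` under the Gaussian test
channel. -/
noncomputable def chernoffWeight {m : ℕ} (l : Fin m → ℝ≥0) (θ a : ℝ≥0) (x y : Fin m → ℝ) : ℝ≥0∞ :=
  ENNReal.ofReal (Real.exp (-(m * ((a : ℝ) - 1) / 2))) *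
    ∏ j, ENNReal.ofReal (channelDensity (l j) θ (x j) (y j) *
      Real.exp ((1 - 1 / a) / 2 * ((x j - y j) ^ 2 / θ)))

theorem measurable_chernoffWeight {m : ℕ} (l : Fin m → ℝ≥0) (θ a : ℝ≥0) :
    Measurable fun z : (Fin m → ℝ) × (Fin m → ℝ) => chernoffWeight l θ a z.1 z.2 := by
  unfold chernoffWeight channelDensity
  fun_prop

theorem prod_channelDensity {m : ℕ} {l : Fin m → ℝ≥0} {θ : ℝ≥0} (hθ : 0 < θ)
    (hl : ∀ j, θ ≤ l j) (x y : Fin m → ℝ) :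
    ∏ j, channelDensity (l j) θ (x j) (y j) =
      Real.exp (∑ j, Real.log (l j / θ) / 2 + (∑ j, x j ^ 2 / l j) / 2 -
        (∑ j, (x j - y j) ^ 2 / θ) / 2) := by
  rw [Finset.sum_div, Finset.sum_div, ← Finset.sum_add_distrib, ← Finset.sum_sub_distrib,
    Real.exp_sum]
  refine Finset.prod_congr rfl fun j _ => ?_
  have hθ' : (0 : ℝ) < θ := by exact_mod_cast hθ
  have hl' : (0 : ℝ) < l j := by exact_mod_cast hθ.trans_le (hl j)
  have e : √((l j : ℝ) / θ) = Real.exp (Real.log (l j / θ) / 2) := by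
    rw [Real.sqrt_eq_rpow, Real.rpow_def_of_pos (by positivity)]
    ring_nf
  rw [channelDensity, e, ← Real.exp_add]
  congr 1
  field_simp
  ring

theorem chernoffWeight_eq {m : ℕ} (l : Fin m → ℝ≥0) (θ : ℝ≥0) {a : ℝ≥0} (ha : 0 < a)
    (x y : Fin m → ℝ) :
    chernoffWeight l θ a x y = ENNReal.ofReal ((∏ j, channelDensity (l j) θ (x j) (y j)) *
      Real.exp ((1 - 1 / a) / 2 * (∑ j, (x j - y j) ^ 2 / θ - a * m))) := by
  have ha' : (0 : ℝ) < a := by exact_mod_cast ha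
  rw [chernoffWeight, ← ENNReal.ofReal_prod_of_nonneg
    (fun j _ => mul_nonneg (channelDensity_nonneg _ _ _ _) (Real.exp_pos _).le),
    ← ENNReal.ofReal_mul (Real.exp_pos _).le]
  congr 1
  rw [Finset.prod_mul_distrib, ← Real.exp_sum, mul_left_comm, ← Real.exp_add, ← Finset.mul_sum]
  congr 2
  field_simp
  ring

theorem lintegral_chernoffWeight {m : ℕ} {l : Fin m → ℝ≥0} {θ : ℝ≥0} (hθ : 0 < θ)
    (hl : ∀ j, θ ≤ l j) {a : ℝ≥0} (ha : 0 < a) :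
    ∫⁻ x, ∫⁻ y, chernoffWeight l θ a x y ∂(Measure.pi fun j => gaussianReal 0 (l j - θ))
      ∂(Measure.pi fun j => gaussianReal 0 (l j)) =
      ENNReal.ofReal ((√a * Real.exp (-((a : ℝ) - 1) / 2)) ^ m) := by
  have hm : ∀ j : Fin m, Measurable fun z : ℝ × ℝ => ENNReal.ofReal (channelDensity (l j) θ z.1 z.2 *
      Real.exp ((1 - 1 / a) / 2 * ((z.1 - z.2) ^ 2 / θ))) := fun j =>
    ((measurable_channelDensity (l j) θ).mul (by fun_prop)).ennreal_ofReal
  have inner : ∀ x : Fin m → ℝ,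
      ∫⁻ y, chernoffWeight l θ a x y ∂(Measure.pi fun j => gaussianReal 0 (l j - θ)) =
      ENNReal.ofReal (Real.exp (-(m * ((a : ℝ) - 1) / 2))) *
        ∏ j, ∫⁻ t, ENNReal.ofReal (channelDensity (l j) θ (x j) t *
          Real.exp ((1 - 1 / a) / 2 * ((x j - t) ^ 2 / θ))) ∂(gaussianReal 0 (l j - θ)) := by
    intro x
    have hmx : ∀ j : Fin m, Measurable fun t : ℝ => ENNReal.ofReal
        (channelDensity (l j) θ (x j) t * Real.exp ((1 - 1 / a) / 2 * ((x j - t) ^ 2 / θ))) :=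
      fun j => by unfold channelDensity; fun_prop
    unfold chernoffWeight
    rw [lintegral_const_mul' _ _ ENNReal.ofReal_ne_top, lintegral_pi_prod _ hmx]
  simp_rw [inner]
  have hmj : ∀ j : Fin m, Measurable fun s : ℝ => ∫⁻ t, ENNReal.ofReal
      (channelDensity (l j) θ s t * Real.exp ((1 - 1 / a) / 2 * ((s - t) ^ 2 / θ)))
      ∂(gaussianReal 0 (l j - θ)) := fun j => (hm j).lintegral_prod_right'
  rw [lintegral_const_mul' _ _ ENNReal.ofReal_ne_top, lintegral_pi_prod _ hmj]
  simp_rw [lintegral_lintegral_channelDensity_exp hθ (hl _) ha]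
  rw [Finset.prod_const, Finset.card_univ, Fintype.card_fin,
    ← ENNReal.ofReal_pow (Real.sqrt_nonneg _), ← ENNReal.ofReal_mul (Real.exp_pos _).le, mul_pow,
    mul_comm, ← Real.exp_nat_mul]
  congr 3
  ring

theorem lintegral_pi_exp_sq {m : ℕ} {l : Fin m → ℝ≥0} (hl : ∀ j, 0 < l j) {a : ℝ≥0} (ha : 0 < a) :
    ∫⁻ x, ENNReal.ofReal (Real.exp ((1 - 1 / a) / 2 * ∑ j, x j ^ 2 / l j))
      ∂(Measure.pi fun j : Fin m => gaussianReal 0 (l j)) = ENNReal.ofReal (√a ^ m) := by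
  simp_rw [Finset.mul_sum, Real.exp_sum, ENNReal.ofReal_prod_of_nonneg
    (fun _ _ => (Real.exp_pos _).le)]
  rw [lintegral_pi_prod (fun j : Fin m => gaussianReal 0 (l j))
    (F := fun j t => ENNReal.ofReal (Real.exp ((1 - 1 / a) / 2 * (t ^ 2 / l j))))
    (fun j => by fun_prop)]
  simp_rw [lintegral_exp_sq (hl _) ha]
  rw [Finset.prod_const, Finset.card_univ, Fintype.card_fin,
    ← ENNReal.ofReal_pow (Real.sqrt_nonneg _)]

/-- Lower bound for the probability that a random codeword covers a typical point. -/
theorem one_le_cover {m : ℕ} {l : Fin m → ℝ≥0} {θ : ℝ≥0} (hθ : 0 < θ) (hl : ∀ j, θ ≤ l j)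
    {δ : ℝ≥0} (hδ0 : 0 < δ) (hδ1 : δ < 1) {x : Fin m → ℝ}
    (hx : ∑ j, x j ^ 2 / l j ≤ (1 + δ) * m) :
    1 ≤ ENNReal.ofReal (Real.exp (∑ j, Real.log (l j / θ) / 2 + δ * m)) *
        (Measure.pi fun j => gaussianReal 0 (l j - θ))
          {y | ∑ j, (x j - y j) ^ 2 ≤ (1 + δ) * (m * θ)} +
      ∫⁻ y, (chernoffWeight l θ (1 + δ) x y + chernoffWeight l θ (1 - δ) x y)
        ∂(Measure.pi fun j => gaussianReal 0 (l j - θ)) := by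
  have hθ' : (0 : ℝ) < θ := by exact_mod_cast hθ
  have hd1 : 0 < 1 - δ := tsub_pos_of_lt hδ1
  have hd1r : ((1 - δ : ℝ≥0) : ℝ) = 1 - δ := by push_cast [hδ1.le]; rfl
  have hδ0' : (0 : ℝ) < δ := by exact_mod_cast hδ0
  have hd1' : (0 : ℝ) < 1 - δ := by rw [← hd1r]; exact_mod_cast hd1
  set ν := Measure.pi fun j => gaussianReal 0 (l j - θ) with hν
  set B : Set (Fin m → ℝ) := {y | ∑ j, (x j - y j) ^ 2 ≤ (1 + δ) * (m * θ)} with hB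
  have hBm : MeasurableSet B := measurableSet_le (by fun_prop) (by fun_prop)
  set G := Real.exp (∑ j, Real.log (l j / θ) / 2 + δ * m) with hG
  have h1 : ∫⁻ y, ∏ j, ENNReal.ofReal (channelDensity (l j) θ (x j) (y j)) ∂ν = 1 := by
    rw [hν, lintegral_pi_prod _ (F := fun j t => ENNReal.ofReal (channelDensity (l j) θ (x j) t))
      (fun j => by unfold channelDensity; fun_prop)]
    simp_rw [lintegral_channelDensity hθ (hl _)]
    simp
  rw [← h1, ← lintegral_indicator_const hBm, ← lintegral_add_left
    (measurable_const.indicator hBm)]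
  refine lintegral_mono fun y => ?_
  rw [← ENNReal.ofReal_prod_of_nonneg (fun j _ => channelDensity_nonneg _ _ _ _),
    chernoffWeight_eq l θ (by positivity), chernoffWeight_eq l θ hd1]
  have hF : 0 ≤ ∏ j, channelDensity (l j) θ (x j) (y j) :=
    Finset.prod_nonneg fun j _ => channelDensity_nonneg _ _ _ _
  have hS : ∑ j, (x j - y j) ^ 2 / (θ : ℝ) = (∑ j, (x j - y j) ^ 2) / θ := by
    rw [Finset.sum_div]
  by_cases hy : y ∈ B
  · by_cases hy2 : (1 - δ) * m ≤ ∑ j, (x j - y j) ^ 2 / (θ : ℝ)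
    · refine le_trans ?_ le_self_add
      rw [Set.indicator_of_mem hy]
      refine ENNReal.ofReal_le_ofReal ?_
      rw [prod_channelDensity hθ hl, hG, Real.exp_le_exp]
      linarith
    · refine le_trans ?_ le_add_self
      refine le_trans ?_ le_add_self
      refine ENNReal.ofReal_le_ofReal (le_mul_of_one_le_right hF (Real.one_le_exp ?_))
      push Not at hy2
      rw [hd1r]
      refine mul_nonneg_of_nonpos_of_nonpos ?_ (by linarith)
      have : 1 ≤ 1 / (1 - (δ : ℝ)) := by rw [le_div_iff₀ hd1']; linarith
      linarith
  · refine le_trans ?_ le_add_self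
    refine le_trans ?_ le_self_add
    refine ENNReal.ofReal_le_ofReal (le_mul_of_one_le_right hF (Real.one_le_exp ?_))
    have hy' : (1 + δ) * (m * θ) < ∑ j, (x j - y j) ^ 2 := by simpa [hB] using hy
    push_cast
    refine mul_nonneg ?_ ?_
    · have : 1 / (1 + (δ : ℝ)) ≤ 1 := by rw [div_le_one (by positivity)]; linarith
      linarith
    · rw [hS, sub_nonneg, le_div_iff₀ hθ']
      linarith

theorem one_sub_pow_le_of_one_le {p : ℝ} (hp0 : 0 ≤ p) (hp1 : p ≤ 1) (γ : ℝ) (M : ℕ) {r : ℝ≥0∞}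
    (h : 1 ≤ ENNReal.ofReal (Real.exp γ) * ENNReal.ofReal p + r) :
    ENNReal.ofReal (1 - p) ^ M ≤ r + ENNReal.ofReal (Real.exp (-(M * Real.exp (-γ)))) := by
  rcases eq_or_ne r ∞ with rfl | hr
  · simp
  lift r to ℝ≥0 using hr
  have hr0 : (0 : ℝ) ≤ r := r.2
  rw [← ENNReal.ofReal_mul (Real.exp_pos _).le, ← ENNReal.ofReal_coe_nnreal,
    ← ENNReal.ofReal_add (by positivity) hr0, ENNReal.one_le_ofReal] at h
  rw [← ENNReal.ofReal_pow (by linarith), ← ENNReal.ofReal_coe_nnreal,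
    ← ENNReal.ofReal_add hr0 (Real.exp_pos _).le]
  refine ENNReal.ofReal_le_ofReal ?_
  have hpow1 : (1 - p) ^ M ≤ 1 := pow_le_one₀ (by linarith) (by linarith)
  rcases le_or_gt 1 (r : ℝ) with hr1 | hr1
  · have := Real.exp_pos (-(M * Real.exp (-γ)))
    linarith
  · set Q : ℝ := M * Real.exp (-γ) with hQ
    have hpl : Real.exp (-γ) * (1 - r) ≤ p := by
      rw [Real.exp_neg, inv_mul_le_iff₀ (Real.exp_pos _)]
      linarith
    have h1 : (1 - p) ^ M ≤ Real.exp (-(Q * (1 - r))) := by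
      calc (1 - p) ^ M ≤ (Real.exp (-p)) ^ M :=
            pow_le_pow_left₀ (by linarith) (Real.one_sub_le_exp_neg p) M
        _ = Real.exp (-(M * p)) := by rw [← Real.exp_nat_mul]; ring_nf
        _ ≤ _ := by
            rw [Real.exp_le_exp, neg_le_neg_iff, hQ, mul_assoc]
            gcongr
    have h2 := convexOn_exp.2 (Set.mem_univ (-Q)) (Set.mem_univ 0)
      (show 0 ≤ 1 - (r : ℝ) by linarith) hr0 (by ring)
    simp only [smul_eq_mul, mul_zero, add_zero, Real.exp_zero, mul_one] at h2
    rw [show (1 - (r : ℝ)) * -Q = -(Q * (1 - r)) by ring] at h2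
    have h3 : (1 - (r : ℝ)) * Real.exp (-Q) ≤ Real.exp (-Q) :=
      mul_le_of_le_one_left (Real.exp_pos _).le (by linarith)
    linarith

theorem exists_le_of_lintegral_pi {α β : Type*} [MeasurableSpace α] [MeasurableSpace β]
    (μ : Measure α) [SigmaFinite μ] (ν : Measure β) [IsProbabilityMeasure ν] {B : Set (α × β)}
    (hB : MeasurableSet B) {g : α → ℝ≥0∞} (hg : Measurable g) (M : ℕ) :
    ∃ ys : Fin M → β, ∫⁻ x in {x | ∀ i, (x, ys i) ∉ B}, g x ∂μ ≤
      ∫⁻ x, g x * ν {y | (x, y) ∉ B} ^ M ∂μ := by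
  set S : Set (α × (Fin M → β)) := {z | ∀ i, (z.1, z.2 i) ∉ B} with hS
  have hSm : MeasurableSet S := by
    rw [hS, Set.ofPred_forall]
    refine MeasurableSet.iInter fun i => ?_
    have : Measurable fun z : α × (Fin M → β) => (z.1, z.2 i) := by fun_prop
    exact this hB.compl
  set F : α → (Fin M → β) → ℝ≥0∞ := fun x ys => S.indicator (fun z => g z.1) (x, ys) with hF
  have hFm : Measurable (Function.uncurry F) :=
    (hg.comp measurable_fst).indicator hSm
  have hswap := lintegral_lintegral_swap (μ := μ) (ν := Measure.pi fun _ : Fin M => ν)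
    (f := F) hFm.aemeasurable
  have hFx : ∀ x, ∫⁻ ys, F x ys ∂(Measure.pi fun _ : Fin M => ν) =
      g x * ν {y | (x, y) ∉ B} ^ M := by
    intro x
    have e : ∀ ys, F x ys = (Set.univ.pi fun _ : Fin M => {y | (x, y) ∉ B}).indicator
        (fun _ => g x) ys := by
      intro ys
      have hiff : (x, ys) ∈ S ↔ ys ∈ Set.univ.pi fun _ : Fin M => {y | (x, y) ∉ B} := by
        simp [hS]
      by_cases h : (x, ys) ∈ S
      · rw [Set.indicator_of_mem (hiff.1 h)]
        exact Set.indicator_of_mem h _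
      · rw [Set.indicator_of_notMem (mt hiff.2 h)]
        exact Set.indicator_of_notMem h _
    have hm : MeasurableSet (Set.univ.pi fun _ : Fin M => {y | (x, y) ∉ B}) :=
      MeasurableSet.univ_pi fun _ => (measurable_prodMk_left hB).compl
    simp_rw [e]
    rw [lintegral_indicator_const hm, Measure.pi_pi]
    simp
  simp_rw [hFx] at hswap
  rw [hswap]
  obtain ⟨ys, hys⟩ := exists_le_lintegral (μ := Measure.pi fun _ : Fin M => ν)
    (f := fun ys => ∫⁻ x, F x ys ∂μ)
    (hFm.lintegral_prod_left).aemeasurable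
  refine ⟨ys, le_trans (le_of_eq ?_) hys⟩
  have hm : MeasurableSet {x | ∀ i, (x, ys i) ∉ B} := measurable_prodMk_right hSm
  rw [← lintegral_indicator hm]
  rfl

/-- Random coding bound for a Gaussian vector with independent coordinates. -/
theorem exists_codebook {m : ℕ} (M : ℕ) {l : Fin m → ℝ≥0} {θ : ℝ≥0} (hθ : 0 < θ)
    (hl : ∀ j, θ ≤ l j) {δ : ℝ≥0} (hδ0 : 0 < δ) (hδ1 : δ < 1) {L : ℝ} (hL0 : 0 ≤ L)
    (hL : ∀ j, (l j : ℝ) ≤ L) {a : ℝ≥0} (ha : 1 < a) {η : ℝ} (hη : 0 < η) :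
    ∃ ys : Fin M → Fin m → ℝ,
      ∫⁻ x in {x | ∀ i, (1 + δ) * (m * θ) < ∑ j, (x j - ys i j) ^ 2},
        ENNReal.ofReal (∑ j, x j ^ 2) ∂(Measure.pi fun j => gaussianReal 0 (l j)) ≤
      ENNReal.ofReal (L * (η * (2 / ((1 - 1 / a) / 2) ^ 2) * √a ^ m + η⁻¹ *
        (2 * (√(1 + δ) * Real.exp (-δ / 2)) ^ m + (√(1 - δ) * Real.exp (δ / 2)) ^ m +
          Real.exp (-(M * Real.exp (-(∑ j, Real.log (l j / θ) / 2 + δ * m))))))) := by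
  set μ := Measure.pi fun j => gaussianReal 0 (l j) with hμ
  set ν := Measure.pi fun j => gaussianReal 0 (l j - θ) with hν
  set γ := ∑ j, Real.log (l j / θ) / 2 + δ * m with hγ
  set D : ℝ := (1 + δ) * (m * θ) with hD
  set τ : ℝ := (1 - 1 / a) / 2 with hτ
  have ha' : (1 : ℝ) < a := by exact_mod_cast ha
  have hτ0 : 0 < τ := by
    have : 1 / (a : ℝ) < 1 := by rw [div_lt_one (by linarith)]; exact ha'
    rw [hτ]; linarith
  have hlpos : ∀ j, 0 < l j := fun j => hθ.trans_le (hl j)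
  have hlpos' : ∀ j, (0 : ℝ) < l j := fun j => by exact_mod_cast hlpos j
  have hd1 : 0 < 1 - δ := tsub_pos_of_lt hδ1
  have hd1r : ((1 - δ : ℝ≥0) : ℝ) = 1 - δ := by push_cast [hδ1.le]; rfl
  have hδ0' : (0 : ℝ) < δ := by exact_mod_cast hδ0
  set B : Set ((Fin m → ℝ) × (Fin m → ℝ)) := {z | ∑ j, (z.1 j - z.2 j) ^ 2 ≤ D} with hB
  have hBm : MeasurableSet B := measurableSet_le (by fun_prop) (by fun_prop)
  obtain ⟨ys, hys⟩ := exists_le_of_lintegral_pi μ ν hBm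
    (g := fun x => ENNReal.ofReal (∑ j, x j ^ 2)) (by fun_prop) M
  refine ⟨ys, ?_⟩
  simp only [hB, Set.mem_ofPred_eq, not_le] at hys
  refine hys.trans ?_
  set s : (Fin m → ℝ) → ℝ := fun x => ∑ j, x j ^ 2 / l j with hs
  have hsm : Measurable s := by fun_prop
  have hs0 : ∀ x, 0 ≤ s x := fun x => Finset.sum_nonneg fun j _ => by positivity
  set E : Set (Fin m → ℝ) := {x | (1 + δ) * m < s x} with hE
  set r₀ : (Fin m → ℝ) → ℝ≥0∞ := fun x =>
    ∫⁻ y, (chernoffWeight l θ (1 + δ) x y + chernoffWeight l θ (1 - δ) x y) ∂ν with hr₀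
  set w : (Fin m → ℝ) → ℝ≥0∞ := fun x => ENNReal.ofReal
    (Real.exp ((1 - 1 / (1 + δ : ℝ≥0)) / 2 * s x) * Real.exp (-(m * (δ : ℝ) / 2))) with hw
  have hcover : ∀ x, ν {y | D < ∑ j, (x j - y j) ^ 2} ^ M ≤
      (r₀ x + w x) + ENNReal.ofReal (Real.exp (-(M * Real.exp (-γ)))) := by
    intro x
    set Bx : Set (Fin m → ℝ) := {y | ∑ j, (x j - y j) ^ 2 ≤ D} with hBx
    have hBxm : MeasurableSet Bx := measurableSet_le (by fun_prop) (by fun_prop)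
    have hc : {y : Fin m → ℝ | D < ∑ j, (x j - y j) ^ 2} = Bxᶜ := by
      ext y; simp [hBx]
    have hνc : ν Bxᶜ = ENNReal.ofReal (1 - (ν Bx).toReal) := by
      rw [prob_compl_eq_one_sub hBxm, ENNReal.ofReal_sub _ ENNReal.toReal_nonneg,
        ENNReal.ofReal_one, ENNReal.ofReal_toReal (measure_ne_top _ _)]
    have hp1 : (ν Bx).toReal ≤ 1 := by
      have := ENNReal.toReal_mono ENNReal.one_ne_top (prob_le_one (μ := ν) (s := Bx))
      simpa using this
    rw [hc, hνc]
    refine one_sub_pow_le_of_one_le ENNReal.toReal_nonneg hp1 γ M ?_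
    rw [ENNReal.ofReal_toReal (measure_ne_top _ _)]
    by_cases hx : s x ≤ (1 + δ) * m
    · refine (one_le_cover hθ hl hδ0 hδ1 hx).trans ?_
      rw [← add_assoc]
      exact le_self_add
    · push Not at hx
      refine le_trans ?_ le_add_self
      refine le_trans ?_ le_add_self
      rw [hw]
      simp only
      rw [ENNReal.one_le_ofReal, ← Real.exp_add]
      refine Real.one_le_exp ?_
      push_cast
      have e : (1 - 1 / (1 + (δ : ℝ))) / 2 = δ / 2 / (1 + δ) := by field_simp; ring
      rw [e]
      have : (δ : ℝ) / 2 / (1 + δ) * ((1 + δ) * m) ≤ δ / 2 / (1 + δ) * s x := by gcongr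
      have e2 : (δ : ℝ) / 2 / (1 + δ) * ((1 + δ) * m) = m * δ / 2 := by field_simp
      linarith
  have hpt : ∀ x, ENNReal.ofReal (∑ j, x j ^ 2) * ν {y | D < ∑ j, (x j - y j) ^ 2} ^ M ≤
      ENNReal.ofReal (L * (η * (2 / τ ^ 2))) * ENNReal.ofReal (Real.exp (τ * s x)) +
      ENNReal.ofReal (L * η⁻¹) * ((r₀ x + w x) +
        ENNReal.ofReal (Real.exp (-(M * Real.exp (-γ))))) := by
    intro x
    refine le_trans ?_ (add_le_add_right (mul_le_mul_right (hcover x) _) _)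
    set u := ν {y | D < ∑ j, (x j - y j) ^ 2} ^ M with hu
    have hu1 : u ≤ 1 := pow_le_one₀ zero_le prob_le_one
    have hut : u ≠ ∞ := ne_top_of_le_ne_top ENNReal.one_ne_top hu1
    rw [← ENNReal.ofReal_toReal hut]
    have hu0 : 0 ≤ u.toReal := ENNReal.toReal_nonneg
    have hu1' : u.toReal ≤ 1 := by
      simpa using ENNReal.toReal_mono ENNReal.one_ne_top hu1
    rw [← ENNReal.ofReal_mul (Finset.sum_nonneg fun j _ => sq_nonneg _),
      ← ENNReal.ofReal_mul (by positivity), ← ENNReal.ofReal_mul (by positivity),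
      ← ENNReal.ofReal_add (by positivity) (by positivity)]
    refine ENNReal.ofReal_le_ofReal ?_
    have h1 : ∑ j, x j ^ 2 ≤ L * s x := by
      rw [hs]
      simp only
      rw [Finset.mul_sum]
      refine Finset.sum_le_sum fun j _ => ?_
      rw [← mul_div_assoc, le_div_iff₀ (hlpos' j), mul_comm]
      exact mul_le_mul_of_nonneg_right (hL j) (sq_nonneg _)
    have h2 : s x ^ 2 ≤ 2 / τ ^ 2 * Real.exp (τ * s x) := by
      have := Real.quadratic_le_exp_of_nonneg (x := τ * s x) (mul_nonneg hτ0.le (hs0 x))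
      have h0 : 0 ≤ τ * s x := mul_nonneg hτ0.le (hs0 x)
      rw [div_mul_eq_mul_div, le_div_iff₀ (by positivity)]
      nlinarith
    have h3 : s x * u.toReal ≤ η * s x ^ 2 + η⁻¹ * u.toReal := by
      have hsq : 0 ≤ η⁻¹ * (η * s x - u.toReal) ^ 2 := by positivity
      have hexp : η⁻¹ * (η * s x - u.toReal) ^ 2 =
          η * s x ^ 2 - 2 * (s x * u.toReal) + η⁻¹ * u.toReal ^ 2 := by
        field_simp
        ring
      have h5 : η⁻¹ * u.toReal ^ 2 ≤ η⁻¹ * u.toReal := by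
        gcongr; nlinarith
      have h6 : 0 ≤ s x * u.toReal := mul_nonneg (hs0 x) hu0
      linarith
    calc (∑ j, x j ^ 2) * u.toReal ≤ L * s x * u.toReal := by gcongr
      _ = L * (s x * u.toReal) := by ring
      _ ≤ L * (η * (2 / τ ^ 2 * Real.exp (τ * s x)) + η⁻¹ * u.toReal) := by
          gcongr
          exact h3.trans (by gcongr)
      _ = _ := by ring
  have hr₀m : Measurable r₀ :=
    ((measurable_chernoffWeight l θ (1 + δ)).add
      (measurable_chernoffWeight l θ (1 - δ))).lintegral_prod_right'
  have hwm : Measurable w := by fun_prop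
  have hr₀i : ∫⁻ x, r₀ x ∂μ ≤ ENNReal.ofReal ((√(1 + δ) * Real.exp (-δ / 2)) ^ m) +
      ENNReal.ofReal ((√(1 - δ) * Real.exp (δ / 2)) ^ m) := by
    have hsplit : ∀ x, r₀ x = ∫⁻ y, chernoffWeight l θ (1 + δ) x y ∂ν +
        ∫⁻ y, chernoffWeight l θ (1 - δ) x y ∂ν := fun x =>
      lintegral_add_left ((measurable_chernoffWeight l θ (1 + δ)).comp measurable_prodMk_left) _
    simp_rw [hsplit]
    rw [lintegral_add_left (measurable_chernoffWeight l θ (1 + δ)).lintegral_prod_right',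
      lintegral_chernoffWeight hθ hl (by positivity), lintegral_chernoffWeight hθ hl hd1, hd1r]
    push_cast
    refine le_of_eq ?_
    ring_nf
  have hwi : ∫⁻ x, w x ∂μ = ENNReal.ofReal ((√(1 + δ) * Real.exp (-δ / 2)) ^ m) := by
    simp_rw [hw, ENNReal.ofReal_mul (Real.exp_pos _).le]
    rw [lintegral_mul_const' _ _ ENNReal.ofReal_ne_top, lintegral_pi_exp_sq hlpos (by positivity),
      ← ENNReal.ofReal_mul (by positivity), mul_pow, ← Real.exp_nat_mul]
    push_cast
    ring_nf
  refine (lintegral_mono hpt).trans ?_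
  rw [lintegral_add_left (by fun_prop), lintegral_const_mul' _ _ ENNReal.ofReal_ne_top,
    lintegral_const_mul' _ _ ENNReal.ofReal_ne_top, lintegral_add_right _ measurable_const,
    lintegral_add_left hr₀m, hwi, lintegral_const, measure_univ, mul_one,
    lintegral_pi_exp_sq hlpos (by positivity)]
  refine (add_le_add_right (mul_le_mul_right (add_le_add_left (add_le_add_left hr₀i _) _) _)
    _).trans ?_
  have hc1 : 0 ≤ (√(1 + (δ : ℝ)) * Real.exp (-δ / 2)) ^ m := by positivity
  have hc2 : 0 ≤ (√(1 - (δ : ℝ)) * Real.exp (δ / 2)) ^ m := by positivity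
  rw [← ENNReal.ofReal_add hc1 hc2, ← ENNReal.ofReal_add (by positivity) hc1,
    ← ENNReal.ofReal_add (by positivity) (Real.exp_pos _).le, ← ENNReal.ofReal_mul (by positivity),
    ← ENNReal.ofReal_mul (by positivity), ← ENNReal.ofReal_add (by positivity) (by positivity)]
  refine ENNReal.ofReal_le_ofReal (le_of_eq ?_)
  ring

theorem sqrt_mul_exp_lt_one {x : ℝ} (hx0 : x ≠ 0) :
    √(1 + x) * Real.exp (-x / 2) < 1 := by
  have h1 : 1 + x < Real.exp (x / 2) ^ 2 := by
    rw [← Real.exp_nat_mul]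
    have := Real.add_one_lt_exp hx0
    push_cast
    rw [show (2 : ℝ) * (x / 2) = x by ring]
    linarith
  have h2 : √(1 + x) < Real.exp (x / 2) := by
    rw [Real.sqrt_lt' (Real.exp_pos _)]
    exact h1
  calc √(1 + x) * Real.exp (-x / 2) < Real.exp (x / 2) * Real.exp (-x / 2) := by gcongr
    _ = 1 := by rw [← Real.exp_add]; ring_nf; simp

theorem pow_le_exp_neg_mul {q c : ℝ} (hq : 0 < q) (hc : c ≤ -Real.log q) (m : ℕ) :
    q ^ m ≤ Real.exp (-(c * m)) := by
  have : q ≤ Real.exp (-c) := by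
    rw [← Real.log_le_iff_le_exp hq]; linarith
  calc q ^ m ≤ Real.exp (-c) ^ m := pow_le_pow_left₀ hq.le this m
    _ = _ := by rw [← Real.exp_nat_mul]; ring_nf

set_option maxHeartbeats 1000000 in
theorem PotterBounds.eventually_exists_codebook {b : ℝ} {lam : ℕ → ℝ} (hP : PotterBounds b lam)
    (hb : 1 < b) (hpos : ∀ j, 0 < lam j) (hanti : Antitone lam) {κ : ℝ} (hκ : 0 < κ) :
    ∀ᶠ m : ℕ in atTop, ∀ M : ℕ, Real.exp ((b / 2 + κ) * m) ≤ M →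
      ∃ ys : Fin M → Fin m → ℝ,
        ∫⁻ x in {x | ∀ i, (1 + κ) * (m * lam m) < ∑ j, (x j - ys i j) ^ 2},
          ENNReal.ofReal (∑ j, x j ^ 2)
          ∂(Measure.pi fun j : Fin m => gaussianReal 0 (lam j).toNNReal) ≤
        ENNReal.ofReal (κ * (m * lam m)) := by
  set δ : ℝ := min (κ / 4) (1 / 2) with hδ
  have hδ0 : 0 < δ := by rw [hδ]; positivity
  have hδ1 : δ < 1 := (min_le_right _ _).trans_lt (by norm_num)
  have hδκ : δ ≤ κ / 4 := min_le_left _ _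
  set q₁ := √(1 + δ) * Real.exp (-δ / 2) with hq₁
  set q₂ := √(1 - δ) * Real.exp (δ / 2) with hq₂
  have hq₁0 : 0 < q₁ := mul_pos (Real.sqrt_pos.2 (by linarith)) (Real.exp_pos _)
  have hq₂0 : 0 < q₂ := mul_pos (Real.sqrt_pos.2 (by linarith)) (Real.exp_pos _)
  have hq₁1 : q₁ < 1 := sqrt_mul_exp_lt_one hδ0.ne'
  have hq₂1 : q₂ < 1 := by
    have := sqrt_mul_exp_lt_one (x := -δ) (by linarith)
    rwa [neg_neg, ← sub_eq_add_neg] at this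
  set c := min (κ / 4) (min (-Real.log q₁) (-Real.log q₂)) with hc
  have hc0 : 0 < c := by
    have := Real.log_neg hq₁0 hq₁1
    have := Real.log_neg hq₂0 hq₂1
    refine lt_min (by positivity) (lt_min ?_ ?_) <;> linarith
  have hcκ : c ≤ κ / 4 := min_le_left _ _
  have hc₁ : c ≤ -Real.log q₁ := (min_le_right _ _).trans (min_le_left _ _)
  have hc₂ : c ≤ -Real.log q₂ := (min_le_right _ _).trans (min_le_right _ _)
  set a : ℝ := Real.exp (c / 2) with ha
  have ha1 : 1 < a := Real.one_lt_exp_iff.2 (by positivity)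
  set A : ℝ := 2 / ((1 - 1 / a) / 2) ^ 2 with hA
  have hA0 : 0 ≤ A := by positivity
  have hlim := hP.tendsto_exp_neg_div hb hpos (c := c / 4) (by positivity)
  have hL : 0 < lam 0 * (A + 4) := mul_pos (hpos 0) (by positivity)
  filter_upwards [hlim.eventually_le_const (u := κ / (lam 0 * (A + 4))) (by positivity),
    hP.sum_log_le hb hpos hanti hκ, eventually_ge_atTop 1] with m h1 h2 h3 M hM
  have hm1 : (1 : ℝ) ≤ m := by exact_mod_cast h3
  have hpos' : ∀ j, ((lam j).toNNReal : ℝ) = lam j := fun j => Real.coe_toNNReal _ (hpos j).le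
  have hδc : ((δ.toNNReal : ℝ≥0) : ℝ) = δ := Real.coe_toNNReal _ hδ0.le
  have hac : ((a.toNNReal : ℝ≥0) : ℝ) = a := Real.coe_toNNReal _ (by linarith)
  obtain ⟨ys, hys⟩ := exists_codebook (m := m) M (l := fun j => (lam j).toNNReal)
    (θ := (lam m).toNNReal) (Real.toNNReal_pos.2 (hpos m))
    (fun j => Real.toNNReal_le_toNNReal (hanti j.2.le)) (δ := δ.toNNReal)
    (Real.toNNReal_pos.2 hδ0) (by simpa using hδ1) (L := lam 0) (hpos 0).le
    (fun j => by rw [hpos']; exact hanti (Nat.zero_le _)) (a := a.toNNReal)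
    (by simpa using ha1) (η := Real.exp (-(c * m / 2))) (Real.exp_pos _)
  simp only [hpos', hδc, hac] at hys
  refine ⟨ys, (lintegral_mono_set ?_).trans (hys.trans (ENNReal.ofReal_le_ofReal ?_))⟩
  · intro x hx i
    refine lt_of_le_of_lt ?_ (hx i)
    have := hpos m
    gcongr
    linarith
  set γ := ∑ j : Fin m, Real.log (lam j / lam m) / 2 + δ * m with hγ
  have hγle : γ ≤ (b / 2 + κ / 2 + δ) * m := by
    rw [hγ, ← Finset.sum_div, Fin.sum_univ_eq_sum_range (fun j => Real.log (lam j / lam m)) m]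
    linarith
  have hMγ : c * m ≤ M * Real.exp (-γ) := by
    have e1 : c * m ≤ (b / 2 + κ) * m + -γ := by nlinarith
    calc c * m ≤ Real.exp ((b / 2 + κ) * m + -γ) := by
          have := Real.add_one_le_exp ((b / 2 + κ) * m + -γ)
          linarith
      _ = Real.exp ((b / 2 + κ) * m) * Real.exp (-γ) := Real.exp_add _ _
      _ ≤ _ := by gcongr
  have h4 : Real.exp (-(M * Real.exp (-γ))) ≤ Real.exp (-(c * m)) :=
    Real.exp_le_exp.2 (by linarith)
  have h5 := pow_le_exp_neg_mul hq₁0 hc₁ m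
  have h6 := pow_le_exp_neg_mul hq₂0 hc₂ m
  have h7 : √a ^ m = Real.exp (c * m / 4) := by
    rw [ha, ← Real.exp_half, ← Real.exp_nat_mul]
    ring_nf
  have e1 : Real.exp (-(c * m / 2)) * Real.exp (c * m / 4) = Real.exp (-(c / 4 * m)) := by
    rw [← Real.exp_add]; ring_nf
  have e2 : Real.exp (c * m / 2) * Real.exp (-(c * m)) = Real.exp (-(c * m / 2)) := by
    rw [← Real.exp_add]; ring_nf
  have e3 : Real.exp (-(c * m / 2)) ≤ Real.exp (-(c / 4 * m)) := by
    refine Real.exp_le_exp.2 ?_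
    nlinarith
  rw [div_le_div_iff₀ (hpos m) hL] at h1
  rw [h7, ← Real.exp_neg, neg_neg]
  have hl0 := (hpos 0).le
  calc _ ≤ lam 0 * (Real.exp (-(c * m / 2)) * A * Real.exp (c * m / 4) + Real.exp (c * m / 2) *
        (2 * Real.exp (-(c * m)) + Real.exp (-(c * m)) + Real.exp (-(c * m)))) := by gcongr
    _ = lam 0 * (A * (Real.exp (-(c * m / 2)) * Real.exp (c * m / 4)) +
        4 * (Real.exp (c * m / 2) * Real.exp (-(c * m)))) := by ring
    _ ≤ lam 0 * (A * Real.exp (-(c / 4 * m)) + 4 * Real.exp (-(c / 4 * m))) := by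
        rw [e1, e2]; gcongr
    _ = Real.exp (-(c / 4 * m)) * (lam 0 * (A + 4)) := by ring
    _ ≤ κ * lam m := h1
    _ ≤ κ * (m * lam m) := by
        have := hpos m
        gcongr
        nlinarith

/-- `X` is a centered Gaussian vector whose covariance operator has the ordered positive eigenvalues
`lam` with orthonormal eigenvectors `u`. -/
structure IsGaussianWithSpectrum {H : Type*} [NormedAddCommGroup H] [InnerProductSpace ℝ H]
    {Ω : Type*} [MeasurableSpace Ω] (P : Measure Ω) (X : Ω → H) (u : ℕ → H) (lam : ℕ → ℝ) :
    Prop where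
  meas : AEStronglyMeasurable X P
  int : Integrable (fun ω => ‖X ω‖ ^ 2) P
  gauss : ∀ y : H, ∃ v : ℝ≥0, Measure.map (fun ω => ⟪y, X ω⟫) P = gaussianReal 0 v
  orth : Orthonormal ℝ u
  pos : ∀ j, 0 < lam j
  anti : Antitone lam
  eig : ∀ j, ∀ y : H, ∫ ω, ⟪u j, X ω⟫ * ⟪y, X ω⟫ ∂P = lam j * ⟪u j, y⟫
  span : ∀ᵐ ω ∂P, X ω ∈ closure (Submodule.span ℝ (Set.range u) : Set H)

section Spectrum

variable {H : Type*} [NormedAddCommGroup H] [InnerProductSpace ℝ H]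
  {Ω : Type*} [MeasurableSpace Ω] {P : Measure Ω} {X : Ω → H} {u : ℕ → H} {lam : ℕ → ℝ}

theorem IsGaussianWithSpectrum.memLp (h : IsGaussianWithSpectrum P X u lam) : MemLp X 2 P :=
  (memLp_two_iff_integrable_sq_norm h.meas).2 h.int

theorem IsGaussianWithSpectrum.memLp_inner (h : IsGaussianWithSpectrum P X u lam) (y : H) :
    MemLp (fun ω => ⟪y, X ω⟫) 2 P :=
  h.memLp.const_inner y

theorem IsGaussianWithSpectrum.integrable_inner_mul (h : IsGaussianWithSpectrum P X u lam)
    (y z : H) : Integrable (fun ω => ⟪y, X ω⟫ * ⟪z, X ω⟫) P :=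
  (h.memLp_inner y).integrable_mul (h.memLp_inner z)

theorem IsGaussianWithSpectrum.integral_inner_sq (h : IsGaussianWithSpectrum P X u lam) (j : ℕ) :
    ∫ ω, ⟪u j, X ω⟫ ^ 2 ∂P = lam j := by
  simp_rw [pow_two, h.eig j, real_inner_self_eq_norm_sq, h.orth.1 j]
  simp

/-- The eigencoordinates of `X` are independent centered Gaussians with variances `lam`. -/
theorem IsGaussianWithSpectrum.map_coords_eq_pi [IsProbabilityMeasure P]
    (h : IsGaussianWithSpectrum P X u lam) (m : ℕ) :
    P.map (fun ω (j : Fin m) => ⟪u j, X ω⟫) =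
      Measure.pi fun j : Fin m => gaussianReal 0 (lam j).toNNReal := by
  have hm : ∀ y, AEMeasurable (fun ω => ⟪y, X ω⟫) P := fun y =>
    (h.memLp_inner y).aestronglyMeasurable.aemeasurable
  have hmp : AEMeasurable (fun ω (j : Fin m) => ⟪u j, X ω⟫) P :=
    aemeasurable_pi_lambda _ fun j => hm _
  have : IsProbabilityMeasure (P.map (fun ω (j : Fin m) => ⟪u j, X ω⟫)) :=
    Measure.isProbabilityMeasure_map hmp
  rw [← charFun_eq_pi_iff]
  intro t
  set y : H := ∑ j : Fin m, t j • u j with hy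
  obtain ⟨v, hv⟩ := h.gauss y
  have hyu : ∀ j : Fin m, ⟪u j, y⟫ = t j := by
    intro j
    have ho : Orthonormal ℝ fun i : Fin m => u i := h.orth.comp _ Fin.val_injective
    rw [hy]
    exact ho.inner_right_fintype t j
  have hyx : ∀ ω, ⟪y, X ω⟫ = ∑ j : Fin m, t j * ⟪u j, X ω⟫ := by
    intro ω
    rw [hy, sum_inner]
    simp_rw [real_inner_smul_left]
  have hvar : (v : ℝ) = ∑ j : Fin m, t j ^ 2 * lam j := by
    have h1 : ∫ x, x ^ 2 ∂(gaussianReal 0 v) = v := by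
      have := variance_fun_id_gaussianReal (μ := 0) (v := v)
      rw [variance_eq_integral (by fun_prop)] at this
      simpa using this
    rw [← h1, ← hv, integral_map (hm y) (by fun_prop)]
    have e : ∀ ω, ⟪y, X ω⟫ ^ 2 = ∑ j : Fin m, t j * (⟪u j, X ω⟫ * ⟪y, X ω⟫) := by
      intro ω
      rw [pow_two]
      nth_rewrite 1 [hyx]
      rw [Finset.sum_mul]
      exact Finset.sum_congr rfl fun j _ => by ring
    simp_rw [e]
    rw [integral_finsetSum _ fun j _ => (h.integrable_inner_mul _ _).const_mul _]
    refine Finset.sum_congr rfl fun j _ => ?_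
    rw [integral_const_mul, h.eig, hyu]
    ring
  have hchar : charFun ((P.map (fun ω (j : Fin m) => ⟪u j, X ω⟫)).map (WithLp.toLp 2)) t =
      charFun (gaussianReal 0 v) 1 := by
    rw [← hv, charFun_apply, charFun_apply, integral_map (by fun_prop) (by fun_prop),
      integral_map hmp (by fun_prop), integral_map (hm y) (by fun_prop)]
    refine integral_congr_ae (.of_forall fun ω => ?_)
    simp only [hyx, PiLp.inner_apply]
    simp [mul_comm]
  rw [hchar, charFun_gaussianReal]
  simp_rw [charFun_gaussianReal]
  rw [← Complex.exp_sum]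
  congr 1
  have hvc : ((v : ℝ) : ℂ) = ((∑ j : Fin m, t j ^ 2 * lam j : ℝ) : ℂ) := by rw [hvar]
  have hc : ∀ j : Fin m, (((lam j).toNNReal : ℝ) : ℂ) = lam j := fun j => by
    rw [Real.coe_toNNReal _ (h.pos j).le]
  simp only [hvc, hc]
  push_cast
  simp only [Finset.sum_div, mul_zero, zero_mul, zero_sub, one_pow, mul_one,
    ← Finset.sum_neg_distrib]
  refine Finset.sum_congr rfl fun j _ => ?_
  ring

/-- Parseval's identity on the closed span of an orthonormal sequence. -/
theorem hasSum_inner_sq [CompleteSpace H] (hu : Orthonormal ℝ u) {x : H}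
    (hx : x ∈ closure (Submodule.span ℝ (Set.range u) : Set H)) :
    HasSum (fun j => ⟪u j, x⟫ ^ 2) (‖x‖ ^ 2) := by
  obtain ⟨w, b, hw, hb⟩ := hu.toSubtypeRange.exists_hilbertBasis_extension
  set ι : ℕ → w := fun j => ⟨u j, hw ⟨j, rfl⟩⟩ with hι
  have hinj : Function.Injective ι := fun i j hij =>
    hu.linearIndependent.injective (congrArg Subtype.val hij)
  have hs := b.hasSum_inner_mul_inner x x
  rw [real_inner_self_eq_norm_sq, ← hinj.hasSum_iff] at hs
  · refine hs.congr_fun fun j => ?_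
    simp [hb, hι, real_inner_comm, pow_two]
  · intro i hi
    have hz : ⟪b i, x⟫ = 0 := by
      have hcl : IsClosed {z : H | ⟪b i, z⟫ = 0} :=
        isClosed_eq (by fun_prop) continuous_const
      have hsub : (Submodule.span ℝ (Set.range u) : Set H) ⊆ {z : H | ⟪b i, z⟫ = 0} := by
        intro z hz
        induction hz using Submodule.span_induction with
        | mem z hz =>
          obtain ⟨j, rfl⟩ := hz
          have hij : i ≠ ι j := fun hij => hi ⟨j, hij.symm⟩
          have := b.orthonormal.2 hij
          simpa [hb, hι] using this
        | zero => simp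
        | add x y _ _ hx hy =>
          simp only [Set.mem_ofPred_eq] at hx hy ⊢
          rw [inner_add_right, hx, hy, add_zero]
        | smul c x _ hx =>
          simp only [Set.mem_ofPred_eq] at hx ⊢
          rw [real_inner_smul_right, hx, mul_zero]
      exact closure_minimal hsub hcl hx
    simp [hz]

theorem IsGaussianWithSpectrum.hasSum_integral [CompleteSpace H]
    (h : IsGaussianWithSpectrum P X u lam) (hs : Summable lam) :
    HasSum lam (∫ ω, ‖X ω‖ ^ 2 ∂P) := by
  have h1 := hasSum_integral_of_summable_integral_norm (μ := P)
    (F := fun j ω => ⟪u j, X ω⟫ ^ 2)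
    (fun j => by simpa [pow_two] using h.integrable_inner_mul (u j) (u j))
    (by simpa [h.integral_inner_sq] using hs)
  simp_rw [h.integral_inner_sq] at h1
  have h2 : ∫ ω, ‖X ω‖ ^ 2 ∂P = ∫ ω, ∑' j, ⟪u j, X ω⟫ ^ 2 ∂P := by
    refine integral_congr_ae ?_
    filter_upwards [h.span] with ω hω
    exact (hasSum_inner_sq h.orth hω).tsum_eq.symm
  rwa [h2]

/-- The mean squared distance from `X` to the span of the first `m` eigenvectors. -/
theorem IsGaussianWithSpectrum.integral_tail [CompleteSpace H]
    (h : IsGaussianWithSpectrum P X u lam) (hs : Summable lam) (m : ℕ) :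
    ∫ ω, (‖X ω‖ ^ 2 - ∑ j ∈ Finset.range m, ⟪u j, X ω⟫ ^ 2) ∂P = ∑' j, lam (m + j) := by
  have hi : ∀ j, Integrable (fun ω => ⟪u j, X ω⟫ ^ 2) P := fun j => by
    simpa [pow_two] using h.integrable_inner_mul (u j) (u j)
  rw [integral_sub h.int (integrable_finsetSum _ fun j _ => hi j),
    integral_finsetSum _ fun j _ => hi j, ← (h.hasSum_integral hs).tsum_eq,
    ← hs.sum_add_tsum_nat_add m]
  simp_rw [h.integral_inner_sq, add_comm m]
  ring

end Spectrum

/-- The squared distance from `x` to the finite set `α`. -/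
noncomputable def sqDist {H : Type*} [NormedAddCommGroup H] (α : Finset H) (x : H) : ℝ :=
  sInf ((fun a => ‖x - a‖ ^ 2) '' (α : Set H))

section SqDist

variable {H : Type*} [NormedAddCommGroup H] {α : Finset H}

theorem sqDist_eq_inf' (hα : α.Nonempty) (x : H) :
    sqDist α x = α.inf' hα fun a => ‖x - a‖ ^ 2 :=
  (Finset.inf'_eq_csInf_image α hα _).symm

theorem sqDist_le {a : H} (ha : a ∈ α) (x : H) : sqDist α x ≤ ‖x - a‖ ^ 2 := by
  rw [sqDist_eq_inf' ⟨a, ha⟩]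
  exact Finset.inf'_le _ ha

theorem exists_sqDist_eq (hα : α.Nonempty) (x : H) : ∃ a ∈ α, sqDist α x = ‖x - a‖ ^ 2 := by
  rw [sqDist_eq_inf' hα]
  exact Finset.exists_mem_eq_inf' hα _

theorem sqDist_nonneg (hα : α.Nonempty) (x : H) : 0 ≤ sqDist α x := by
  obtain ⟨a, -, ha⟩ := exists_sqDist_eq hα x
  rw [ha]
  positivity

theorem continuous_sqDist (hα : α.Nonempty) : Continuous (sqDist α) := by
  rw [funext (sqDist_eq_inf' hα)]
  exact Continuous.finset_inf'_apply hα fun a _ => by fun_prop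

theorem integrable_sqDist {Ω : Type*} [MeasurableSpace Ω] {P : Measure Ω} [IsFiniteMeasure P]
    {X : Ω → H} (hX : MemLp X 2 P) (hα : α.Nonempty) :
    Integrable (fun ω => sqDist α (X ω)) P := by
  obtain ⟨a, ha⟩ := hα
  have h1 : MemLp (fun ω => X ω - a) 2 P := hX.sub (memLp_const a)
  refine ((memLp_two_iff_integrable_sq_norm h1.1).1 h1).mono'
    ((continuous_sqDist ⟨a, ha⟩).comp_aestronglyMeasurable hX.1) (.of_forall fun ω => ?_)
  rw [Real.norm_of_nonneg (sqDist_nonneg ⟨a, ha⟩ _)]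
  exact sqDist_le ha _

end SqDist

theorem sum_Ico_le_sum_mul_one_sub {lam : ℕ → ℝ} (hpos : ∀ j, 0 < lam j) (hanti : Antitone lam)
    {w : ℕ → ℝ} (hw0 : ∀ j, 0 ≤ w j) (hw1 : ∀ j, w j ≤ 1) {k J : ℕ}
    (hw : ∑ j ∈ Finset.range J, w j ≤ k) :
    ∑ j ∈ Finset.Ico k J, lam j ≤ ∑ j ∈ Finset.range J, lam j * (1 - w j) := by
  rcases le_or_gt J k with hJ | hJ
  · rw [Finset.Ico_eq_empty (by omega), Finset.sum_empty]
    exact Finset.sum_nonneg fun j _ => mul_nonneg (hpos j).le (by linarith [hw1 j])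
  have h1 : ∑ j ∈ Finset.range J, lam j * (1 - w j) =
      ∑ j ∈ Finset.range J, (lam j - lam k) * (1 - w j) +
        lam k * (J - ∑ j ∈ Finset.range J, w j) := by
    rw [mul_sub, Finset.mul_sum, ← sub_eq_zero]
    simp only [sub_mul, mul_sub, Finset.sum_sub_distrib, Finset.sum_const, Finset.card_range,
      nsmul_eq_mul]
    ring
  have h2 : ∑ j ∈ Finset.Ico k J, (lam j - lam k) ≤
      ∑ j ∈ Finset.range J, (lam j - lam k) * (1 - w j) := by
    rw [← Finset.sum_range_add_sum_Ico _ hJ.le]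
    refine le_add_of_nonneg_of_le (Finset.sum_nonneg fun j hj => ?_)
      (Finset.sum_le_sum fun j hj => ?_)
    · have := hanti (Finset.mem_range.1 hj).le
      exact mul_nonneg (by linarith) (by linarith [hw1 j])
    · have := hanti (Finset.mem_Ico.1 hj).1
      nlinarith [hw0 j]
  rw [Finset.sum_sub_distrib, Finset.sum_const, Nat.card_Ico, nsmul_eq_mul,
    Nat.cast_sub hJ.le] at h2
  have h3 := hpos k
  nlinarith

theorem sum_norm_starProjection_sq_le {H : Type*} [NormedAddCommGroup H] [InnerProductSpace ℝ H]
    {u : ℕ → H} (hu : Orthonormal ℝ u) (V : Submodule ℝ H) [FiniteDimensional ℝ V]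
    (s : Finset ℕ) : ∑ j ∈ s, ‖V.starProjection (u j)‖ ^ 2 ≤ Module.finrank ℝ V := by
  set v := stdOrthonormalBasis ℝ V
  have h1 : ∀ j, ‖V.starProjection (u j)‖ ^ 2 = ∑ i, ‖⟪u j, (v i : H)⟫‖ ^ 2 := by
    intro j
    have := v.sum_sq_norm_inner_right (V.orthogonalProjectionOnto (u j))
    rw [Submodule.starProjection_apply, ← Submodule.coe_norm, ← this]
    refine Finset.sum_congr rfl fun i _ => ?_
    rw [real_inner_comm, Submodule.inner_orthogonalProjectionOnto_eq_of_mem_right]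
  simp_rw [h1]
  rw [Finset.sum_comm]
  calc _ ≤ ∑ i, ‖(v i : H)‖ ^ 2 :=
        Finset.sum_le_sum fun i _ => hu.sum_inner_products_le (v i : H)
    _ = _ := by
        have : ∀ i, ‖(v i : H)‖ = 1 := fun i => v.orthonormal.1 i
        simp [this]

/-- A codebook spanning a `k`-dimensional space has distortion at least the eigenvalue tail. -/
theorem IsGaussianWithSpectrum.sum_Ico_le_integral_sqDist {H : Type*} [NormedAddCommGroup H]
    [InnerProductSpace ℝ H] {Ω : Type*} [MeasurableSpace Ω] {P : Measure Ω}
    [IsProbabilityMeasure P] {X : Ω → H} {u : ℕ → H} {lam : ℕ → ℝ}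
    (h : IsGaussianWithSpectrum P X u lam) {α : Finset H} (hα : α.Nonempty) (J : ℕ) :
    ∑ j ∈ Finset.Ico (Module.finrank ℝ (Submodule.span ℝ (α : Set H))) J, lam j ≤
      ∫ ω, sqDist α (X ω) ∂P := by
  set V := Submodule.span ℝ (α : Set H) with hV
  have : FiniteDimensional ℝ V := FiniteDimensional.span_finset ℝ α
  set w : ℕ → ℝ := fun j => ‖V.starProjection (u j)‖ ^ 2 with hw
  have hw1 : ∀ j, w j ≤ 1 := fun j => by
    have h1 := V.norm_starProjection_apply_le (u j)
    rw [h.orth.1 j] at h1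
    exact pow_le_one₀ (norm_nonneg _) h1
  refine (sum_Ico_le_sum_mul_one_sub h.pos h.anti (fun j => sq_nonneg _) hw1
    (sum_norm_starProjection_sq_le h.orth V (Finset.range J))).trans ?_
  set q : H → H := fun x => x - V.starProjection x with hq
  set y : ℕ → H := fun j => (2 : ℝ) • q (u j) - ∑ i ∈ Finset.range J, ⟪u i, q (u j)⟫ • u i with hy
  have hqs : ∀ x z, ⟪q x, z⟫ = ⟪x, q z⟫ := fun x z => by
    rw [hq]
    simp only [inner_sub_left, inner_sub_right, Submodule.inner_starProjection_left_eq_right]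
  have hidem : ∀ x, V.starProjection (V.starProjection x) = V.starProjection x := fun x =>
    Submodule.starProjection_eq_self_iff.2 (V.starProjection_apply_mem x)
  have hqq : ∀ x, q (q x) = q x := fun x => by
    simp [hq, hidem]
  have hqu : ∀ j, ⟪u j, q (u j)⟫ = 1 - w j := fun j => by
    rw [hq]
    simp only
    rw [inner_sub_right, ← hidem (u j), ← Submodule.inner_starProjection_left_eq_right,
      real_inner_self_eq_norm_sq, real_inner_self_eq_norm_sq, h.orth.1 j, one_pow]
  have hpt : ∀ x, ∑ j ∈ Finset.range J, ⟪u j, x⟫ * ⟪y j, x⟫ ≤ ‖q x‖ ^ 2 := by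
    intro x
    set A : H := ∑ j ∈ Finset.range J, ⟪u j, x⟫ • u j with hA
    have h0 : 0 ≤ ‖q x - q A‖ ^ 2 := sq_nonneg _
    rw [norm_sub_sq_real] at h0
    have h1 : ⟪q x, q A⟫ = ∑ j ∈ Finset.range J, ⟪u j, x⟫ * ⟪q (u j), x⟫ := by
      rw [← hqs, hqq, hA, inner_sum]
      refine Finset.sum_congr rfl fun j _ => ?_
      rw [real_inner_smul_right, hqs, real_inner_comm x (q (u j))]
    have h2 : ‖q A‖ ^ 2 = ∑ j ∈ Finset.range J, ⟪u j, x⟫ *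
        ⟪∑ i ∈ Finset.range J, ⟪u i, q (u j)⟫ • u i, x⟫ := by
      rw [← real_inner_self_eq_norm_sq, ← hqs, hqq, real_inner_comm]
      nth_rewrite 1 [hA]
      rw [sum_inner]
      refine Finset.sum_congr rfl fun j _ => ?_
      rw [real_inner_smul_left, ← hqs, hA, inner_sum, sum_inner]
      congr 1
      refine Finset.sum_congr rfl fun i _ => ?_
      rw [real_inner_smul_right, real_inner_smul_left, real_inner_comm (q (u j)), mul_comm]
    have h3 : ∑ j ∈ Finset.range J, ⟪u j, x⟫ * ⟪y j, x⟫ = 2 * ⟪q x, q A⟫ - ‖q A‖ ^ 2 := by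
      rw [h1, h2, Finset.mul_sum, ← Finset.sum_sub_distrib]
      refine Finset.sum_congr rfl fun j _ => ?_
      rw [hy]
      simp only [inner_sub_left, real_inner_smul_left]
      ring
    linarith
  have hyu : ∀ j ∈ Finset.range J, ⟪u j, y j⟫ = 1 - w j := by
    intro j hj
    rw [hy]
    simp only [inner_sub_right, real_inner_smul_right]
    rw [h.orth.inner_right_sum _ hj, hqu]
    ring
  have hinteg : ∑ j ∈ Finset.range J, lam j * (1 - w j) =
      ∫ ω, ∑ j ∈ Finset.range J, ⟪u j, X ω⟫ * ⟪y j, X ω⟫ ∂P := by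
    rw [integral_finsetSum _ fun j _ => h.integrable_inner_mul _ _]
    refine Finset.sum_congr rfl fun j hj => ?_
    rw [h.eig, hyu j hj]
  rw [hinteg]
  refine integral_mono (integrable_finsetSum _ fun j _ => h.integrable_inner_mul _ _)
    (integrable_sqDist h.memLp hα) fun ω => (hpt _).trans ?_
  obtain ⟨a, ha, hae⟩ := exists_sqDist_eq hα (X ω)
  rw [hae]
  gcongr
  rw [V.starProjection_minimal]
  exact ciInf_le ⟨0, by rintro _ ⟨x, rfl⟩; exact norm_nonneg _⟩
    (⟨a, Submodule.subset_span ha⟩ : V)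

theorem norm_sub_sum_smul_sq {H : Type*} [NormedAddCommGroup H] [InnerProductSpace ℝ H]
    {u : ℕ → H} (hu : Orthonormal ℝ u) {m : ℕ} (x : H) (y : Fin m → ℝ) :
    ‖x - ∑ j, y j • u j‖ ^ 2 =
      (‖x‖ ^ 2 - ∑ j ∈ Finset.range m, ⟪u j, x⟫ ^ 2) + ∑ j : Fin m, (⟪u j, x⟫ - y j) ^ 2 := by
  have ho : Orthonormal ℝ fun i : Fin m => u i := hu.comp _ Fin.val_injective
  have h1 : ⟪x, ∑ j, y j • u j⟫ = ∑ j : Fin m, y j * ⟪u j, x⟫ := by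
    rw [inner_sum]
    refine Finset.sum_congr rfl fun j _ => ?_
    rw [real_inner_smul_right, real_inner_comm]
  have h2 : ‖∑ j, y j • u j‖ ^ 2 = ∑ j : Fin m, y j ^ 2 := by
    rw [← real_inner_self_eq_norm_sq, ho.inner_sum]
    simp [pow_two]
  rw [norm_sub_sq_real, h1, h2, ← Fin.sum_univ_eq_sum_range (fun j => ⟪u j, x⟫ ^ 2) m,
    Finset.mul_sum, sub_add, sub_add, ← Finset.sum_sub_distrib, ← Finset.sum_sub_distrib]
  congr 1
  refine Finset.sum_congr rfl fun j _ => ?_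
  ring

/-- A codebook for the first `m` eigencoordinates yields a quantizer of `X`. -/
theorem IsGaussianWithSpectrum.exists_quantizer {H : Type*} [NormedAddCommGroup H]
    [InnerProductSpace ℝ H] [CompleteSpace H] {Ω : Type*} [MeasurableSpace Ω] {P : Measure Ω}
    [IsProbabilityMeasure P] {X : Ω → H} {u : ℕ → H} {lam : ℕ → ℝ}
    (h : IsGaussianWithSpectrum P X u lam) (hs : Summable lam) {m M : ℕ}
    {ys : Fin M → Fin m → ℝ} {D E : ℝ} (hD : 0 ≤ D) (hE : 0 ≤ E)
    (hys : ∫⁻ x in {x | ∀ i, D < ∑ j, (x j - ys i j) ^ 2}, ENNReal.ofReal (∑ j, x j ^ 2)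
      ∂(Measure.pi fun j : Fin m => gaussianReal 0 (lam j).toNNReal) ≤ ENNReal.ofReal E) :
    ∃ α : Finset H, α.Nonempty ∧ α.card ≤ M + 1 ∧
      ∫ ω, sqDist α (X ω) ∂P ≤ D + E + ∑' j, lam (m + j) := by
  classical
  set z : Fin M → H := fun i => ∑ j, ys i j • u j with hz
  set α : Finset H := insert 0 (Finset.univ.image z) with hα
  have hne : α.Nonempty := Finset.insert_nonempty _ _
  refine ⟨α, hne, ?_, ?_⟩
  · refine (Finset.card_insert_le _ _).trans ?_
    have := Finset.card_image_le (s := Finset.univ) (f := z)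
    rw [Finset.card_univ, Fintype.card_fin] at this
    omega
  set S : Set (Fin m → ℝ) := {x | ∀ i, D < ∑ j, (x j - ys i j) ^ 2} with hS
  have hSm : MeasurableSet S := by
    rw [hS, Set.ofPred_forall]
    exact MeasurableSet.iInter fun i => measurableSet_lt (by fun_prop) (by fun_prop)
  set f : (Fin m → ℝ) → ℝ := S.indicator fun x => ∑ j, x j ^ 2 with hf
  have hfm : Measurable f := Measurable.indicator (by fun_prop) hSm
  have hf0 : ∀ x, 0 ≤ f x := fun x =>
    Set.indicator_nonneg (fun x _ => Finset.sum_nonneg fun j _ => sq_nonneg (x j)) x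
  set c : Ω → Fin m → ℝ := fun ω j => ⟪u j, X ω⟫ with hc
  have hcm : AEMeasurable c P := aemeasurable_pi_lambda _ fun j =>
    (h.memLp_inner _).aestronglyMeasurable.aemeasurable
  have hi : ∀ j, Integrable (fun ω => ⟪u j, X ω⟫ ^ 2) P := fun j => by
    simpa [pow_two] using h.integrable_inner_mul (u j) (u j)
  have hfi : Integrable (fun ω => f (c ω)) P := by
    refine (integrable_finsetSum Finset.univ fun j : Fin m => fun _ => hi j).mono'
      (hfm.comp_aemeasurable hcm).aestronglyMeasurable (.of_forall fun ω => ?_)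
    rw [Real.norm_of_nonneg (hf0 _)]
    exact Set.indicator_le_self' (fun x _ => Finset.sum_nonneg fun j _ => sq_nonneg (x j)) (c ω)
  have hfint : ∫ ω, f (c ω) ∂P ≤ E := by
    rw [← integral_map hcm hfm.aestronglyMeasurable, h.map_coords_eq_pi m,
      integral_eq_lintegral_of_nonneg_ae (.of_forall hf0) hfm.aestronglyMeasurable]
    refine ENNReal.toReal_le_of_le_ofReal hE (le_trans (le_of_eq ?_) hys)
    rw [← lintegral_indicator hSm]
    refine lintegral_congr fun x => ?_
    by_cases hx : x ∈ S <;> simp [hf, hx]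
  have hRi : Integrable (fun ω => ‖X ω‖ ^ 2 - ∑ j ∈ Finset.range m, ⟪u j, X ω⟫ ^ 2) P :=
    h.int.sub (integrable_finsetSum _ fun j _ => hi j)
  have hpt : ∀ ω, sqDist α (X ω) ≤
      (D + f (c ω)) + (‖X ω‖ ^ 2 - ∑ j ∈ Finset.range m, ⟪u j, X ω⟫ ^ 2) := by
    intro ω
    by_cases hω : c ω ∈ S
    · have h1 := sqDist_le (α := α) (Finset.mem_insert_self _ _) (X ω)
      have h2 := norm_sub_sum_smul_sq h.orth (X ω) (fun _ : Fin m => (0 : ℝ))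
      simp only [zero_smul, Finset.sum_const_zero, sub_zero] at h1 h2
      have h3 : f (c ω) = ∑ j : Fin m, ⟪u j, X ω⟫ ^ 2 := Set.indicator_of_mem hω _
      linarith
    · have hω' := hω
      simp only [hS, Set.mem_ofPred_eq, not_forall, not_lt] at hω'
      obtain ⟨i, hi⟩ := hω'
      have h1 := sqDist_le (α := α) (a := z i)
        (Finset.mem_insert_of_mem (Finset.mem_image_of_mem _ (Finset.mem_univ _))) (X ω)
      have h2 := norm_sub_sum_smul_sq h.orth (X ω) (ys i)
      have h3 := hf0 (c ω)
      simp only [hz, hc] at h1 hi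
      linarith
  have hDf : Integrable (fun ω => D + f (c ω)) P := (integrable_const D).add hfi
  calc ∫ ω, sqDist α (X ω) ∂P
      ≤ ∫ ω, (D + f (c ω)) + (‖X ω‖ ^ 2 - ∑ j ∈ Finset.range m, ⟪u j, X ω⟫ ^ 2) ∂P :=
        integral_mono (integrable_sqDist h.memLp hne)
          (hDf.add hRi) hpt
    _ = D + ∫ ω, f (c ω) ∂P + ∑' j, lam (m + j) := by
        rw [integral_add hDf hRi, h.integral_tail hs,
          integral_add (integrable_const D) hfi]
        simp
    _ ≤ _ := by gcongr

section Existence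

variable {H : Type*} [NormedAddCommGroup H] [InnerProductSpace ℝ H]

/-- The sequence `g` either escapes to infinity in norm or converges weakly. -/
def EscapesOrConverges (g : ℕ → H) : Prop :=
  Tendsto (fun k => ‖g k‖) atTop atTop ∨
    ∃ x : H, ∀ y, Tendsto (fun k => ⟪g k, y⟫) atTop (nhds ⟪x, y⟫)

theorem EscapesOrConverges.comp {g : ℕ → H} (hg : EscapesOrConverges g) {φ : ℕ → ℕ}
    (hφ : StrictMono φ) : EscapesOrConverges (g ∘ φ) := by
  rcases hg with h | ⟨x, h⟩
  · exact Or.inl (h.comp hφ.tendsto_atTop)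
  · exact Or.inr ⟨x, fun y => (h y).comp hφ.tendsto_atTop⟩

theorem exists_subseq_escapesOrConverges [CompleteSpace H] [TopologicalSpace.SeparableSpace H]
    (g : ℕ → H) : ∃ φ : ℕ → ℕ, StrictMono φ ∧ EscapesOrConverges (g ∘ φ) := by
  by_cases h : Tendsto (fun k => ‖g k‖) atTop atTop
  · exact ⟨id, strictMono_id, Or.inl h⟩
  · rw [tendsto_atTop] at h
    push Not at h
    obtain ⟨R, hR⟩ := h
    obtain ⟨φ, hφ, hφR⟩ := extraction_of_frequently_atTop hR
    obtain ⟨L, -, ψ, hψ, hL⟩ := WeakDual.isSeqCompact_closedBall ℝ H 0 R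
      (x := fun k => StrongDual.toWeakDual (InnerProductSpace.toDual ℝ H (g (φ k))))
      (fun k => by
        change InnerProductSpace.toDual ℝ H (g (φ k)) ∈ Metric.closedBall 0 R
        simpa using (hφR k).le)
    refine ⟨φ ∘ ψ, hφ.comp hψ, Or.inr
      ⟨(InnerProductSpace.toDual ℝ H).symm (WeakDual.toStrongDual L), fun y => ?_⟩⟩
    rw [InnerProductSpace.toDual_symm_apply]
    exact ((WeakDual.eval_continuous y).tendsto L).comp hL

theorem exists_subseq_forall_escapesOrConverges [CompleteSpace H]
    [TopologicalSpace.SeparableSpace H] {ι : Type*} (s : Finset ι) (f : ℕ → ι → H) :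
    ∃ φ : ℕ → ℕ, StrictMono φ ∧ ∀ i ∈ s, EscapesOrConverges fun k => f (φ k) i := by
  classical
  induction s using Finset.induction_on with
  | empty => exact ⟨id, strictMono_id, by simp⟩
  | insert a s _ ih =>
    obtain ⟨φ, hφ, h⟩ := ih
    obtain ⟨ψ, hψ, h'⟩ := exists_subseq_escapesOrConverges fun k => f (φ k) a
    refine ⟨φ ∘ ψ, hφ.comp hψ, fun i hi => ?_⟩
    rcases Finset.mem_insert.1 hi with rfl | hi
    · exact h'
    · exact (h i hi).comp hψ

theorem eventually_lt_norm_sub_sq_of_escapes {E : Type*} [NormedAddCommGroup E] {g : ℕ → E}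
    (hg : Tendsto (fun k => ‖g k‖) atTop atTop) (x : E) (r : ℝ) :
    ∀ᶠ k in atTop, r < ‖x - g k‖ ^ 2 := by
  filter_upwards [hg.eventually_ge_atTop (‖x‖ + |r| + 1)] with k hk
  have h1 := norm_sub_norm_le (g k) x
  rw [norm_sub_rev] at h1
  have h2 := le_abs_self r
  have h3 := abs_nonneg r
  nlinarith

theorem eventually_lt_norm_sub_sq_of_weak {g : ℕ → H} {z : H}
    (hg : ∀ y, Tendsto (fun k => ⟪g k, y⟫) atTop (nhds ⟪z, y⟫)) {x : H} {r : ℝ}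
    (hr : r < ‖x - z‖ ^ 2) : ∀ᶠ k in atTop, r < ‖x - g k‖ ^ 2 := by
  have h1 : Tendsto (fun k => 2 * (⟪x, x - z⟫ - ⟪g k, x - z⟫) - ‖x - z‖ ^ 2) atTop
      (nhds (2 * (⟪x, x - z⟫ - ⟪z, x - z⟫) - ‖x - z‖ ^ 2)) :=
    ((tendsto_const_nhds.sub (hg (x - z))).const_mul 2).sub_const _
  rw [← inner_sub_left, real_inner_self_eq_norm_sq,
    show 2 * ‖x - z‖ ^ 2 - ‖x - z‖ ^ 2 = ‖x - z‖ ^ 2 by ring] at h1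
  filter_upwards [h1.eventually_const_lt hr] with k hk
  refine hk.trans_le ?_
  rw [← inner_sub_left]
  have h2 : 0 ≤ ‖(x - g k) - (x - z)‖ ^ 2 := sq_nonneg _
  rw [norm_sub_sq_real] at h2
  linarith

theorem Finset.exists_image_fin_eq {γ : Type*} [DecidableEq γ] {α : Finset γ} (hα : α.Nonempty)
    {n : ℕ} (hn : α.card ≤ n) : ∃ f : Fin n → γ, Finset.univ.image f = α := by
  obtain ⟨a, ha⟩ := hα
  refine ⟨fun i => if h : i.1 < α.card then α.equivFin.symm ⟨i, h⟩ else a, ?_⟩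
  ext x
  simp only [Finset.mem_image, Finset.mem_univ, true_and]
  constructor
  · rintro ⟨i, rfl⟩
    split_ifs
    · exact Finset.coe_mem _
    · exact ha
  · intro hx
    refine ⟨⟨α.equivFin ⟨x, hx⟩, (α.equivFin ⟨x, hx⟩).2.trans_le hn⟩, ?_⟩
    simp

/-- Optimal quantizers exist. -/
theorem exists_forall_integral_sqDist_le [CompleteSpace H] [TopologicalSpace.SeparableSpace H]
    {Ω : Type*} [MeasurableSpace Ω] {P : Measure Ω} [IsProbabilityMeasure P] {X : Ω → H}
    (hX : MemLp X 2 P) {n : ℕ} (hn : 1 ≤ n) :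
    ∃ α : Finset H, α.Nonempty ∧ α.card ≤ n ∧ ∀ β : Finset H, β.Nonempty → β.card ≤ n →
      ∫ ω, sqDist α (X ω) ∂P ≤ ∫ ω, sqDist β (X ω) ∂P := by
  classical
  set S : Set ℝ := {r | ∃ α : Finset H, α.Nonempty ∧ α.card ≤ n ∧ r = ∫ ω, sqDist α (X ω) ∂P}
    with hS
  have hSne : S.Nonempty := ⟨_, {0}, Finset.singleton_nonempty _, by simpa using hn, rfl⟩
  have hSb : BddBelow S := by
    refine ⟨0, ?_⟩
    rintro _ ⟨α, hα, -, rfl⟩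
    exact integral_nonneg fun ω => sqDist_nonneg hα _
  obtain ⟨r, -, hr, hrS⟩ := exists_seq_tendsto_sInf hSne hSb
  choose α hαne hαn hαr using hrS
  choose f hf using fun k => Finset.exists_image_fin_eq (hαne k) (hαn k)
  obtain ⟨φ, hφ, hconv⟩ := exists_subseq_forall_escapesOrConverges Finset.univ f
  set W : Finset (Fin n) := Finset.univ.filter fun i =>
    ∃ x : H, ∀ y, Tendsto (fun k => ⟪f (φ k) i, y⟫) atTop (nhds ⟪x, y⟫) with hW
  have hWz : ∀ i, ∃ z : H, i ∈ W → ∀ y, Tendsto (fun k => ⟪f (φ k) i, y⟫) atTop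
      (nhds ⟪z, y⟫) := by
    intro i
    by_cases hi : i ∈ W
    · obtain ⟨z, hz⟩ := (Finset.mem_filter.1 hi).2
      exact ⟨z, fun _ => hz⟩
    · exact ⟨0, fun h => absurd h hi⟩
  choose z hz using hWz
  have hnotW : ∀ i ∉ W, Tendsto (fun k => ‖f (φ k) i‖) atTop atTop := by
    intro i hi
    rcases hconv i (Finset.mem_univ i) with h | h
    · exact h
    · exact absurd (Finset.mem_filter.2 ⟨Finset.mem_univ i, h⟩) hi
  have hev : ∀ (x : H) (t : ℝ), (∀ i ∈ W, t < ‖x - z i‖ ^ 2) →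
      ∀ᶠ k in atTop, t < sqDist (α (φ k)) x := by
    intro x t ht
    have h1 : ∀ᶠ k in atTop, ∀ i, t < ‖x - f (φ k) i‖ ^ 2 := by
      rw [eventually_all]
      intro i
      by_cases hi : i ∈ W
      · exact eventually_lt_norm_sub_sq_of_weak (hz i hi) (ht i hi)
      · exact eventually_lt_norm_sub_sq_of_escapes (hnotW i hi) x t
    filter_upwards [h1] with k hk
    obtain ⟨a, ha, hae⟩ := exists_sqDist_eq (hαne (φ k)) x
    rw [← hf, Finset.mem_image] at ha
    obtain ⟨i, -, rfl⟩ := ha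
    rw [hae]
    exact hk i
  have hlim : Tendsto (fun k => ∫⁻ ω, ENNReal.ofReal (sqDist (α (φ k)) (X ω)) ∂P) atTop
      (nhds (ENNReal.ofReal (sInf S))) := by
    refine ((ENNReal.continuous_ofReal.tendsto _).comp (hr.comp hφ.tendsto_atTop)).congr
      fun k => ?_
    simp only [Function.comp_apply]
    rw [hαr, ofReal_integral_eq_lintegral_ofReal (integrable_sqDist hX (hαne _))
      (.of_forall fun ω => sqDist_nonneg (hαne _) _)]
  have hfatou := lintegral_liminf_le' (μ := P) (u := atTop)
    (f := fun k ω => ENNReal.ofReal (sqDist (α (φ k)) (X ω)))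
    fun k => ((continuous_sqDist (hαne _)).comp_aestronglyMeasurable hX.1).aemeasurable.ennreal_ofReal
  rw [hlim.liminf_eq] at hfatou
  have hWne : W.Nonempty := by
    by_contra hempty
    rw [Finset.not_nonempty_iff_eq_empty] at hempty
    have htop : ∀ ω, liminf (fun k => ENNReal.ofReal (sqDist (α (φ k)) (X ω))) atTop = ∞ := by
      intro ω
      refine Tendsto.liminf_eq (ENNReal.tendsto_nhds_top fun N => ?_)
      filter_upwards [hev (X ω) N (by simp [hempty])] with k hk
      rw [← ENNReal.ofReal_natCast]
      exact (ENNReal.ofReal_lt_ofReal_iff_of_nonneg (Nat.cast_nonneg _)).2 hk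
    simp [htop] at hfatou
  refine ⟨W.image z, hWne.image z, ?_, fun β hβ hβn => ?_⟩
  · refine Finset.card_image_le.trans ((Finset.card_le_univ W).trans ?_)
    simp
  · have hne := hWne.image z
    have hle : ∀ ω, ENNReal.ofReal (sqDist (W.image z) (X ω)) ≤
        liminf (fun k => ENNReal.ofReal (sqDist (α (φ k)) (X ω))) atTop := by
      intro ω
      refine le_of_forall_lt_imp_le_of_dense fun c hc => ?_
      have hc1 := ENNReal.toReal_lt_of_lt_ofReal hc
      refine le_liminf_of_le (by isBoundedDefault) ?_
      filter_upwards [hev (X ω) c.toReal fun i hi =>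
        hc1.trans_le (sqDist_le (Finset.mem_image_of_mem z hi) _)] with k hk
      rw [← ENNReal.ofReal_toReal hc.ne_top]
      exact ENNReal.ofReal_le_ofReal hk.le
    have h1 := (lintegral_mono hle).trans hfatou
    rw [← ofReal_integral_eq_lintegral_ofReal (integrable_sqDist hX hne)
      (.of_forall fun ω => sqDist_nonneg hne _)] at h1
    have h0 : 0 ≤ sInf S := Real.sInf_nonneg fun _ ⟨α, hα, _, h⟩ =>
      h ▸ integral_nonneg fun ω => sqDist_nonneg hα _
    exact ((ENNReal.ofReal_le_ofReal_iff h0).1 h1).trans (csInf_le hSb ⟨β, hβ, hβn, rfl⟩)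

end Existence

section QuantErr

variable {H : Type*} [NormedAddCommGroup H] [InnerProductSpace ℝ H]
  {Ω : Type*} [MeasurableSpace Ω] {P : Measure Ω} {X : Ω → H} {n : ℕ}

theorem quantErr_le {β : Finset H} (hβ : β.Nonempty) (hβn : β.card ≤ n) :
    quantErr P X n ≤ (∫ ω, sqDist β (X ω) ∂P) ^ (1 / 2 : ℝ) := by
  refine csInf_le ⟨0, ?_⟩ ⟨β, hβ, hβn, rfl⟩
  rintro _ ⟨α, hα, -, rfl⟩
  exact Real.rpow_nonneg (integral_nonneg fun ω => sqDist_nonneg hα _) _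

theorem integral_sqDist_le_of_eq_quantErr {α β : Finset H} (hα : α.Nonempty)
    (hopt : (∫ ω, sqDist α (X ω) ∂P) ^ (1 / 2 : ℝ) = quantErr P X n)
    (hβ : β.Nonempty) (hβn : β.card ≤ n) :
    ∫ ω, sqDist α (X ω) ∂P ≤ ∫ ω, sqDist β (X ω) ∂P := by
  have h := hopt.le.trans (quantErr_le (P := P) (X := X) hβ hβn)
  rwa [Real.rpow_le_rpow_iff (integral_nonneg fun ω => sqDist_nonneg hα _)
    (integral_nonneg fun ω => sqDist_nonneg hβ _) (by norm_num)] at h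

theorem exists_eq_quantErr [CompleteSpace H] [TopologicalSpace.SeparableSpace H]
    [IsProbabilityMeasure P] (hX : MemLp X 2 P) (hn : 1 ≤ n) :
    ∃ α : Finset H, α.Nonempty ∧ α.card ≤ n ∧
      (∫ ω, sqDist α (X ω) ∂P) ^ (1 / 2 : ℝ) = quantErr P X n := by
  obtain ⟨α, hα, hαn, hmin⟩ := exists_forall_integral_sqDist_le hX hn
  refine ⟨α, hα, hαn, le_antisymm (le_csInf ⟨_, α, hα, hαn, rfl⟩ ?_) (quantErr_le hα hαn)⟩
  rintro _ ⟨β, hβ, hβn, rfl⟩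
  exact Real.rpow_le_rpow (integral_nonneg fun ω => sqDist_nonneg hα _) (hmin β hβ hβn)
    (by norm_num)

end QuantErr

theorem lt_rpow_one_sub_of_lt {b ρ : ℝ} (hb : 1 < b) (hρ0 : 0 < ρ)
    (hρ : ρ < b ^ (-(1 : ℝ) / (b - 1))) : b < ρ ^ (1 - b) := by
  have h1 := Real.rpow_lt_rpow_of_neg hρ0 hρ (show 1 - b < 0 by linarith)
  have hb1 : b - 1 ≠ 0 := by linarith
  rwa [← Real.rpow_mul (by linarith), show -(1 : ℝ) / (b - 1) * (1 - b) = 1 by field_simp; ring,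
    Real.rpow_one] at h1

/-- The distortion of a quantizer is at least the eigenvalue tail beyond its dimension. -/
theorem IsGaussianWithSpectrum.tsum_le_integral_sqDist {H : Type*} [NormedAddCommGroup H]
    [InnerProductSpace ℝ H] {Ω : Type*} [MeasurableSpace Ω] {P : Measure Ω}
    [IsProbabilityMeasure P] {X : Ω → H} {u : ℕ → H} {lam : ℕ → ℝ}
    (h : IsGaussianWithSpectrum P X u lam) {α : Finset H} (hα : α.Nonempty) :
    ∑' j, lam (Module.finrank ℝ (Submodule.span ℝ (α : Set H)) + j) ≤
      ∫ ω, sqDist α (X ω) ∂P := by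
  refine Real.tsum_le_of_sum_range_le (fun j => (h.pos _).le) fun N => ?_
  have := h.sum_Ico_le_integral_sqDist hα
    (Module.finrank ℝ (Submodule.span ℝ (α : Set H)) + N)
  rwa [Finset.sum_Ico_eq_sum_range, Nat.add_sub_cancel_left] at this

theorem eventually_rate_conditions {b ε κ : ℝ} (hb : 1 < b) (hε0 : 0 < ε) (hε1 : ε < 1)
    (hκ : κ ≤ b * ε / 8) :
    ∀ᶠ n : ℕ in atTop,
      Real.exp ((b / 2 + κ) * (⌊(1 - ε / 4) * (2 * Real.log n / b)⌋₊ : ℝ)) ≤ ((n - 1 : ℕ) : ℝ) ∧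
      (1 - ε) * (2 * Real.log n / b) ≤
        (1 - ε / 2) * (⌊(1 - ε / 4) * (2 * Real.log n / b)⌋₊ : ℝ) := by
  have hlog : Tendsto (fun n : ℕ => Real.log n) atTop atTop :=
    Real.tendsto_log_atTop.comp tendsto_natCast_atTop_atTop
  filter_upwards [hlog.eventually_ge_atTop (16 * Real.log 2 / ε ^ 2),
    hlog.eventually_ge_atTop (2 * b / ε), eventually_ge_atTop 2] with n h1 h2 h3
  have hn : (2 : ℝ) ≤ n := by exact_mod_cast h3
  have hl0 : 0 ≤ Real.log n := Real.log_nonneg (by linarith)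
  have hb0 : 0 < b := by linarith
  set l := 2 * Real.log n / b with hl
  have hl' : Real.log n = b / 2 * l := by rw [hl]; field_simp
  have hlpos : 0 ≤ l := by positivity
  set m : ℝ := (⌊(1 - ε / 4) * l⌋₊ : ℝ) with hm
  have hmle : m ≤ (1 - ε / 4) * l := Nat.floor_le (mul_nonneg (by linarith) hlpos)
  have hmge : (1 - ε / 4) * l < m + 1 := Nat.lt_floor_add_one _
  constructor
  · have h4 : (n : ℝ) / 2 ≤ ((n - 1 : ℕ) : ℝ) := by
      rw [Nat.cast_sub (by omega)]
      push_cast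
      linarith
    refine le_trans ?_ h4
    rw [← Real.le_log_iff_exp_le (by positivity), Real.log_div (by positivity) (by norm_num)]
    rw [div_le_iff₀ (by positivity)] at h1
    have h5 : (b / 2 + κ) * m ≤ (b / 2 + b * ε / 8) * ((1 - ε / 4) * l) := by gcongr
    have h6 : (b / 2 + b * ε / 8) * ((1 - ε / 4) * l) = (1 - ε ^ 2 / 16) * Real.log n := by
      rw [hl']; ring
    linarith
  · rw [div_le_iff₀ hε0, hl'] at h2
    have h7 : 4 ≤ l * ε := by
      by_contra hcon
      push Not at hcon
      nlinarith
    nlinarith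

/-- Lower bound for the dimension `d_n(X) = min{dim span α : α an L²-optimal n-quantizer}`
of the functional quantization problem of a centered Gaussian vector with regularly varying
eigenvalues: `d_n(X) ≳ b^{-1/(b-1)} · (2 log n)/b` as `n → ∞`. -/
theorem quantization_dimension_lower_bound
    {H : Type*} [NormedAddCommGroup H] [InnerProductSpace ℝ H] [CompleteSpace H]
    [TopologicalSpace.SeparableSpace H]
    {Ω : Type*} [MeasurableSpace Ω] (P : Measure Ω) [IsProbabilityMeasure P]
    (X : Ω → H)
    (hXmeas : AEStronglyMeasurable X P)
    (hXint : Integrable (fun ω => ‖X ω‖ ^ 2) P)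
    -- `X` is a centered Gaussian random vector
    (hGauss : ∀ y : H, ∃ v : ℝ≥0,
      Measure.map (fun ω => ⟪y, X ω⟫) P = gaussianReal 0 v)
    -- `lam` enumerates (in nonincreasing order, with multiplicity) the nonzero eigenvalues
    -- of the covariance operator, with orthonormal eigenvectors `u`
    (u : ℕ → H) (hu : Orthonormal ℝ u)
    (lam : ℕ → ℝ) (hlam_pos : ∀ j, 0 < lam j) (hlam_anti : Antitone lam)
    (heig : ∀ j, ∀ y : H, ∫ ω, ⟪u j, X ω⟫ * ⟪y, X ω⟫ ∂P = lam j * ⟪u j, y⟫)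
    (hspan : ∀ᵐ ω ∂P, X ω ∈ closure (Submodule.span ℝ (Set.range u) : Set H))
    -- `λ_j ~ φ(j)` with `φ : (s,∞) → (0,∞)` decreasing, regularly varying of index `-b < -1`
    (s b : ℝ) (hs : 0 ≤ s) (hb : 1 < b)
    (φ : ℝ → ℝ) (hφ_pos : ∀ x, s < x → 0 < φ x)
    (hφ_dec : ∀ x y, s < x → x ≤ y → φ y ≤ φ x)
    (hφ_rv : ∀ c : ℝ, 0 < c →
      Tendsto (fun x : ℝ => φ (c * x) / φ x) atTop (nhds (c ^ (-b))))
    (hasymp : Tendsto (fun j : ℕ => lam j / φ j) atTop (nhds 1))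
    -- `d n = d_n(X)`, the smallest dimension of the span of an `L²`-optimal `n`-quantizer
    (d : ℕ → ℕ)
    (hd : ∀ n : ℕ, d n = sInf { k : ℕ | ∃ α : Finset H, α.Nonempty ∧ α.card ≤ n ∧
      (∫ ω, sInf ((fun a => ‖X ω - a‖ ^ 2) '' (α : Set H)) ∂P) ^ (1/2 : ℝ) = quantErr P X n ∧
      k = Module.finrank ℝ (Submodule.span ℝ (α : Set H)) }) :
    -- `liminf_n d_n(X) / ((2 log n)/b) ≥ b^{-1/(b-1)}`
    ∀ ε : ℝ, 0 < ε → ∀ᶠ n : ℕ in atTop,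
      (1 - ε) * (b ^ (-(1 : ℝ)/(b - 1)) * (2 * Real.log n / b)) ≤ (d n : ℝ) := by
  intro ε hε0
  have hb0 : 0 < b := by linarith
  set ρ₀ := b ^ (-(1 : ℝ) / (b - 1)) with hρ₀
  have hρ₀0 : 0 < ρ₀ := Real.rpow_pos_of_pos hb0 _
  rcases le_or_gt 1 ε with hε1 | hε1
  · filter_upwards [eventually_ge_atTop 1] with n hn
    have hl : 0 ≤ Real.log n := Real.log_nonneg (by exact_mod_cast hn)
    exact (mul_nonpos_of_nonpos_of_nonneg (by linarith) (by positivity)).trans (Nat.cast_nonneg _)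
  have hX : IsGaussianWithSpectrum P X u lam :=
    ⟨hXmeas, hXint, hGauss, hu, hlam_pos, hlam_anti, heig, hspan⟩
  have hP : PotterBounds b lam := fun δ hδ => potter_seq hb hφ_pos hφ_dec hφ_rv hasymp hδ
  have hsum := hP.summable hb hlam_pos
  set ρ := (1 - ε / 2) * ρ₀ with hρ
  have hρ0 : 0 < ρ := mul_pos (by linarith) hρ₀0
  have hρlt : ρ < ρ₀ := by nlinarith
  have hρ₀1 : ρ₀ < 1 := Real.rpow_lt_one_of_one_lt_of_neg hb
    (div_neg_of_neg_of_pos (by norm_num) (by linarith))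
  obtain ⟨η, hη0, hη⟩ := hP.waterfilling_lt_tail hb hlam_pos hρ0 (hρlt.trans hρ₀1)
    (lt_rpow_one_sub_of_lt hb hρ0 hρlt)
  set κ := min (η / 2) (b * ε / 8) with hκ
  have hκ0 : 0 < κ := by rw [hκ]; positivity
  have hκη : κ ≤ η / 2 := min_le_left _ _
  have hm : Tendsto (fun n : ℕ => ⌊(1 - ε / 4) * (2 * Real.log n / b)⌋₊) atTop atTop := by
    refine tendsto_nat_floor_atTop.comp (Tendsto.const_mul_atTop (by linarith) ?_)
    exact ((Real.tendsto_log_atTop.comp tendsto_natCast_atTop_atTop).const_mul_atTop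
      (by norm_num)).atTop_div_const hb0
  filter_upwards [hm.eventually hη,
    hm.eventually (hP.eventually_exists_codebook hb hlam_pos hlam_anti hκ0),
    eventually_rate_conditions hb hε0 hε1 (min_le_right _ _),
    eventually_ge_atTop 1] with n h1 h2 h3 hn
  set m := ⌊(1 - ε / 4) * (2 * Real.log n / b)⌋₊
  obtain ⟨ys, hys⟩ := h2 (n - 1) h3.1
  have hml : 0 ≤ m * lam m := mul_nonneg (Nat.cast_nonneg _) (hlam_pos m).le
  obtain ⟨β, hβ, hβn, hβle⟩ := hX.exists_quantizer hsum
    (mul_nonneg (by linarith) hml) (mul_nonneg hκ0.le hml) hys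
  rw [Nat.sub_add_cancel hn] at hβn
  by_contra! hlt
  obtain ⟨α₀, hα₀, hα₀n, hα₀opt⟩ := exists_eq_quantErr hX.memLp hn
  obtain ⟨α, hα, -, hαopt, hαd⟩ := hd n ▸ Nat.sInf_mem (s := { k : ℕ | ∃ α : Finset H,
    α.Nonempty ∧ α.card ≤ n ∧
    (∫ ω, sInf ((fun a => ‖X ω - a‖ ^ 2) '' (α : Set H)) ∂P) ^ (1/2 : ℝ) = quantErr P X n ∧
    k = Module.finrank ℝ (Submodule.span ℝ (α : Set H)) }) ⟨_, α₀, hα₀, hα₀n, hα₀opt, rfl⟩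
  have hdle : d n ≤ ⌈ρ * m⌉₊ := by
    have : (d n : ℝ) ≤ ρ * m := by
      refine hlt.le.trans ?_
      calc (1 - ε) * (ρ₀ * (2 * Real.log n / b)) = ρ₀ * ((1 - ε) * (2 * Real.log n / b)) := by
            ring
        _ ≤ ρ₀ * ((1 - ε / 2) * m) := mul_le_mul_of_nonneg_left h3.2 hρ₀0.le
        _ = ρ * m := by rw [hρ]; ring
    exact_mod_cast this.trans (Nat.le_ceil _)
  have htail : ∀ k, Summable fun j => lam (k + j) := fun k => by
    simpa [add_comm] using (summable_nat_add_iff k).2 hsum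
  have h4 := hX.tsum_le_integral_sqDist hα
  rw [← hαd] at h4
  have h5 := integral_sqDist_le_of_eq_quantErr hα hαopt hβ hβn
  have h6 : ∑' j, lam (⌈ρ * m⌉₊ + j) ≤ ∑' j, lam (d n + j) :=
    (htail _).tsum_le_tsum (fun j => hlam_anti (by omega)) (htail _)
  have h7 : κ * (m * lam m) ≤ η / 2 * (m * lam m) := mul_le_mul_of_nonneg_right hκη hml
  linarith
end
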